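/- For every integer Δ ≥ 1 and all reals d, δ ∈ (0,1] there exist ε, μ > 0 and n₀ ∈ ℕ such that the following holds for every integer n ≥ n₀. Let 𝒞 be a colour set with |𝒞| ≥ δn and let 𝐆 = (G_c : c ∈ 𝒞) be a collection of bipartite graphs with the same vertex partition V₁, V₂, where n ≤ |V₁| ≤ |V₂| ≤ n/δ, such that: (a) for all V_i' ⊆ V_i with |V_i'| ≥ ε|V_i| (i = 1,2) and all 𝒞' ⊆ 𝒞 with |𝒞'| ≥ ε|𝒞| one has Σ_{c∈𝒞'} e_{G_c}(V₁',V₂') ≥ d|𝒞'||V₁'||V₂'|; (b) Σ_{c∈𝒞} d_{G_c}(v) ≥ d|𝒞|n for every v ∈ V₁ ∪ V₂; (c) e(G_c) ≥ dn² for every c ∈ 𝒞. Then for every μ-separable bipartite graph H with parts of sizes |V₁| and |V₂|, with exactly |𝒞| edges and maximum degree at most Δ, 𝐆 contains a transversal copy of H. -/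

import Mathlib

open Finset
open scoped Classical

/-- Number of ordered pairs `(x,y) ∈ A × B` with `{x,y}` an edge of `G`. -/
noncomputable def pairCount {V : Type*} (G : SimpleGraph V) (A B : Finset V) : ℕ :=
  ((A ×ˢ B).filter (fun p => G.Adj p.1 p.2)).card

/-- Number of neighbours of `v` in `B`. -/
noncomputable def degIn {V : Type*} (G : SimpleGraph V) (v : V) (B : Finset V) : ℕ :=
  (B.filter (fun w => G.Adj v w)).card

/-- Degree of `v` in `G`. -/
noncomputable def degOf {V : Type*} [Fintype V] (G : SimpleGraph V) (v : V) : ℕ :=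
  ((univ : Finset V).filter (fun w => G.Adj v w)).card

/-- Number of edges of `G`. -/
noncomputable def edgeCnt {V : Type*} [Fintype V] (G : SimpleGraph V) : ℕ :=
  ((univ : Finset (Sym2 V)).filter (fun e => e ∈ G.edgeSet)).card

/-- Number of edges of `H` with one endpoint in `A` and the other in `B`. -/
noncomputable def eBetween {W : Type*} [Fintype W] (H : SimpleGraph W) (A B : Finset W) : ℕ :=
  ((univ : Finset (Sym2 W)).filter
    (fun e => e ∈ H.edgeSet ∧ ∃ x ∈ A, ∃ y ∈ B, e = s(x, y))).card

/-- A graph `H` on `h` vertices is `μ`-separable if there is `X ⊆ V(H)` with `|X| ≤ μ h`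
such that every connected component of `H - X` has at most `μ h` vertices. -/
def Separable {W : Type*} [Fintype W] (H : SimpleGraph W) (μ : ℝ) : Prop :=
  ∃ X : Finset W, (X.card : ℝ) ≤ μ * (Fintype.card W : ℝ) ∧
    ∀ K : (SimpleGraph.induce ((↑X : Set W)ᶜ) H).ConnectedComponent,
      (K.supp.ncard : ℝ) ≤ μ * (Fintype.card W : ℝ)

/-- A transversal copy of `H` in the graph collection `G`. -/
def HasTransversal {V C W : Type*} (G : C → SimpleGraph V) (H : SimpleGraph W) : Prop :=
  ∃ (τ : W → V) (σ : Sym2 W → C),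
    Function.Injective τ ∧ Set.InjOn σ H.edgeSet ∧
    ∀ x y, H.Adj x y → (G (σ s(x, y))).Adj (τ x) (τ y)

/-- Density of a collection of bipartite graphs. -/
noncomputable def colDensity {V C : Type*} (G : C → SimpleGraph V)
    (A B : Finset V) (D : Finset C) : ℝ :=
  (∑ c ∈ D, (pairCount (G c) A B : ℝ)) / ((D.card : ℝ) * (A.card : ℝ) * (B.card : ℝ))

/-- `(ε,d)`-regularity of a collection of bipartite graphs with parts `V₁, V₂`
and colour set `D`. -/
def ColReg {V C : Type*} (ε d : ℝ) (G : C → SimpleGraph V)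
    (V₁ V₂ : Finset V) (D : Finset C) : Prop :=
  d ≤ colDensity G V₁ V₂ D ∧
  ∀ V₁' ⊆ V₁, ∀ V₂' ⊆ V₂, ∀ D' ⊆ D,
    ε * (V₁.card : ℝ) ≤ (V₁'.card : ℝ) → ε * (V₂.card : ℝ) ≤ (V₂'.card : ℝ) →
    ε * (D.card : ℝ) ≤ (D'.card : ℝ) →
    |colDensity G V₁' V₂' D' - colDensity G V₁ V₂ D| < ε

/-- `(ε,d)`-superregularity of a collection of bipartite graphs. -/
def ColSuperReg {V C : Type*} (ε d : ℝ) (G : C → SimpleGraph V)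
    (V₁ V₂ : Finset V) (D : Finset C) : Prop :=
  ColReg ε d G V₁ V₂ D ∧
  (∀ v ∈ V₁, d * (V₂.card : ℝ) * (D.card : ℝ) ≤ ∑ c ∈ D, (degIn (G c) v V₂ : ℝ)) ∧
  (∀ v ∈ V₂, d * (V₁.card : ℝ) * (D.card : ℝ) ≤ ∑ c ∈ D, (degIn (G c) v V₁ : ℝ)) ∧
  (∀ c ∈ D, d * (V₁.card : ℝ) * (V₂.card : ℝ) ≤ (pairCount (G c) V₁ V₂ : ℝ))

/-- `(ε,d)`-half-superregularity of a collection of bipartite graphs. -/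
def ColHalfSuperReg {V C : Type*} (ε d : ℝ) (G : C → SimpleGraph V)
    (V₁ V₂ : Finset V) (D : Finset C) : Prop :=
  (∀ V₁' ⊆ V₁, ∀ V₂' ⊆ V₂, ∀ D' ⊆ D,
    ε * (V₁.card : ℝ) ≤ (V₁'.card : ℝ) → ε * (V₂.card : ℝ) ≤ (V₂'.card : ℝ) →
    ε * (D.card : ℝ) ≤ (D'.card : ℝ) →
    d * (D'.card : ℝ) * (V₁'.card : ℝ) * (V₂'.card : ℝ) ≤
      ∑ c ∈ D', (pairCount (G c) V₁' V₂' : ℝ)) ∧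
  (∀ v ∈ V₁, d * (V₂.card : ℝ) * (D.card : ℝ) ≤ ∑ c ∈ D, (degIn (G c) v V₂ : ℝ)) ∧
  (∀ v ∈ V₂, d * (V₁.card : ℝ) * (D.card : ℝ) ≤ ∑ c ∈ D, (degIn (G c) v V₁ : ℝ)) ∧
  (∀ c ∈ D, d * (V₁.card : ℝ) * (V₂.card : ℝ) ≤ (pairCount (G c) V₁ V₂ : ℝ))

/-- `(ε,d)`-half-superregularity of a bipartite graph (given by an adjacency relation)
with parts `V₁, V₂`. -/
def BipHalfSuper {V : Type*} (ε d : ℝ) (A : V → V → Prop) (V₁ V₂ : Finset V) : Prop :=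
  (∀ U₁ ⊆ V₁, ∀ U₂ ⊆ V₂,
    ε * (V₁.card : ℝ) ≤ (U₁.card : ℝ) → ε * (V₂.card : ℝ) ≤ (U₂.card : ℝ) →
    d * (U₁.card : ℝ) * (U₂.card : ℝ) ≤
      (((U₁ ×ˢ U₂).filter (fun p => A p.1 p.2)).card : ℝ)) ∧
  (∀ x ∈ V₁, d * (V₂.card : ℝ) ≤ ((V₂.filter (fun y => A x y)).card : ℝ)) ∧
  (∀ y ∈ V₂, d * (V₁.card : ℝ) ≤ ((V₁.filter (fun x => A x y)).card : ℝ))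

/-- Number of ordered triples `(x₁,x₂,x₃) ∈ U₁ × U₂ × U₃` with `{x₁,x₂,x₃}` an edge. -/
noncomputable def tripCount {V : Type*} (E : Set (Finset V)) (U₁ U₂ U₃ : Finset V) : ℕ :=
  ((U₁ ×ˢ U₂ ×ˢ U₃).filter
    (fun p => ({p.1, p.2.1, p.2.2} : Finset V) ∈ E)).card

/-- Density of the triple `(U₁,U₂,U₃)` in a `3`-graph. -/
noncomputable def tripDensity {V : Type*} (E : Set (Finset V)) (U₁ U₂ U₃ : Finset V) : ℝ :=
  (tripCount E U₁ U₂ U₃ : ℝ) / ((U₁.card : ℝ) * (U₂.card : ℝ) * (U₃.card : ℝ))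

/-- Degree of a vertex in a hypergraph: the number of edges containing it. -/
noncomputable def hDeg {V : Type*} [Fintype V] (E : Set (Finset V)) (v : V) : ℕ :=
  ((univ : Finset (Finset V)).filter (fun e => e ∈ E ∧ v ∈ e)).card

/-- Weak `(ε,d)`-regularity of a 3-partite triple in a 3-graph. -/
def TripReg {V : Type*} (ε d : ℝ) (E : Set (Finset V)) (V₁ V₂ V₃ : Finset V) : Prop :=
  d ≤ tripDensity E V₁ V₂ V₃ ∧
  ∀ U₁ ⊆ V₁, ∀ U₂ ⊆ V₂, ∀ U₃ ⊆ V₃,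
    ε * (V₁.card : ℝ) ≤ (U₁.card : ℝ) → ε * (V₂.card : ℝ) ≤ (U₂.card : ℝ) →
    ε * (V₃.card : ℝ) ≤ (U₃.card : ℝ) →
    |tripDensity E U₁ U₂ U₃ - tripDensity E V₁ V₂ V₃| < ε

/-- Weak `(ε,d)`-half-superregularity of a 3-partite triple in a 3-graph. -/
def TripHalfSuper {V : Type*} (ε d : ℝ) (E : Set (Finset V)) (V₁ V₂ V₃ : Finset V) : Prop :=
  (∀ U₁ ⊆ V₁, ∀ U₂ ⊆ V₂, ∀ U₃ ⊆ V₃,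
    ε * (V₁.card : ℝ) ≤ (U₁.card : ℝ) → ε * (V₂.card : ℝ) ≤ (U₂.card : ℝ) →
    ε * (V₃.card : ℝ) ≤ (U₃.card : ℝ) →
    d * (U₁.card : ℝ) * (U₂.card : ℝ) * (U₃.card : ℝ) ≤ (tripCount E U₁ U₂ U₃ : ℝ)) ∧
  (∀ x ∈ V₁, d * (V₂.card : ℝ) * (V₃.card : ℝ) ≤ (tripCount E {x} V₂ V₃ : ℝ)) ∧
  (∀ y ∈ V₂, d * (V₁.card : ℝ) * (V₃.card : ℝ) ≤ (tripCount E V₁ {y} V₃ : ℝ)) ∧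
  (∀ z ∈ V₃, d * (V₁.card : ℝ) * (V₂.card : ℝ) ≤ (tripCount E V₁ V₂ {z} : ℝ))

/-- A copy of the 1-expansion of `H` in a 3-graph with edge set `E`. -/
def HasExpansionCopy {V W : Type*} (E : Set (Finset V)) (H : SimpleGraph W) : Prop :=
  ∃ (ρv : W → V) (ρe : Sym2 W → V),
    Function.Injective ρv ∧ Set.InjOn ρe H.edgeSet ∧
    (∀ x, ∀ e ∈ H.edgeSet, ρv x ≠ ρe e) ∧
    ∀ x y, H.Adj x y → ({ρv x, ρv y, ρe s(x, y)} : Finset V) ∈ E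

/-- Number of edges (as functions picking one vertex per part) inside the sets `U i`. -/
noncomputable def kCount {V : Type*} {k : ℕ} (E : Set (Fin k → V)) (U : Fin k → Finset V) : ℕ :=
  ((Fintype.piFinset U).filter (fun e => e ∈ E)).card

/-- Density of a `k`-tuple in a `k`-partite `k`-graph. -/
noncomputable def kDensity {V : Type*} {k : ℕ} (E : Set (Fin k → V)) (U : Fin k → Finset V) : ℝ :=
  (kCount E U : ℝ) / ∏ i, ((U i).card : ℝ)

/-- Degree of `x` as a vertex of the `i`-th part of a `k`-partite `k`-graph. -/
noncomputable def kDegAt {V : Type*} [Fintype V] {k : ℕ} (E : Set (Fin k → V))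
    (i : Fin k) (x : V) : ℕ :=
  ((univ : Finset (Fin k → V)).filter (fun e => e ∈ E ∧ e i = x)).card

/-- Weak ε-regularity of a `k`-tuple in a `k`-partite `k`-graph. -/
def KTupleReg {V : Type*} {k : ℕ} (ε : ℝ) (E : Set (Fin k → V)) (Wp : Fin k → Finset V) : Prop :=
  ∀ U : Fin k → Finset V, (∀ i, U i ⊆ Wp i) →
    (∀ i, ε * ((Wp i).card : ℝ) ≤ ((U i).card : ℝ)) →
    |kDensity E U - kDensity E Wp| < ε

/-- Weak `(ε,d)`-regularity of a `k`-partite `k`-graph with parts `P`. -/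
def KReg {V : Type*} {k : ℕ} (ε d : ℝ) (E : Set (Fin k → V)) (P : Fin k → Finset V) : Prop :=
  d ≤ kDensity E P ∧
  ∀ U : Fin k → Finset V, (∀ i, U i ⊆ P i) →
    (∀ i, ε * ((P i).card : ℝ) ≤ ((U i).card : ℝ)) →
    |kDensity E U - kDensity E P| < ε

/-- Weak `(ε,d)`-superregularity of a `k`-partite `k`-graph with parts `P`. -/
def KSuper {V : Type*} [Fintype V] {k : ℕ} (ε d : ℝ) (E : Set (Fin k → V))
    (P : Fin k → Finset V) : Prop :=
  KReg ε d E P ∧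
  ∀ i, ∀ x ∈ P i, d * (∏ j, ((P j).card : ℝ)) / ((P i).card : ℝ) ≤ (kDegAt E i x : ℝ)

/-- Weak `(ε,d)`-half-superregularity of a `k`-partite `k`-graph with parts `P`. -/
def KHalfSuper {V : Type*} [Fintype V] {k : ℕ} (ε d : ℝ) (E : Set (Fin k → V))
    (P : Fin k → Finset V) : Prop :=
  (∀ U : Fin k → Finset V, (∀ i, U i ⊆ P i) →
    (∀ i, ε * ((P i).card : ℝ) ≤ ((U i).card : ℝ)) →
    d ≤ kDensity E U) ∧
  ∀ i, ∀ x ∈ P i, d * (∏ j, ((P j).card : ℝ)) / ((P i).card : ℝ) ≤ (kDegAt E i x : ℝ)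

/-- An `R`-template: vertex clusters `Vc`, colour clusters `Cc i j` (one for each
edge `ij` of `R`), and for each colour `c ∈ Cc i j` a bipartite graph `Ge c i j`
with parts `Vc i`, `Vc j`.  The graph `G_c` of the collection is the union of the
`Ge c i j` over the edges `ij` of `R` whose colour cluster contains `c`. -/
structure GTemplate (V C : Type*) (r : ℕ) where
  R : SimpleGraph (Fin r)
  Vc : Fin r → Finset V
  Cc : Fin r → Fin r → Finset C
  Ge : C → Fin r → Fin r → SimpleGraph V
  Cc_symm : ∀ i j, Cc i j = Cc j i
  Ge_symm : ∀ c i j, Ge c i j = Ge c j i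
  Vc_disj : ∀ i j, i ≠ j → Disjoint (Vc i) (Vc j)
  Cc_support : ∀ i j, ¬ R.Adj i j → Cc i j = ∅
  Ge_support : ∀ c i j, c ∉ Cc i j → Ge c i j = ⊥
  Ge_bipartite : ∀ c i j x y, (Ge c i j).Adj x y →
    (x ∈ Vc i ∧ y ∈ Vc j) ∨ (x ∈ Vc j ∧ y ∈ Vc i)

namespace GTemplate

variable {V C : Type*} {r : ℕ}

/-- The graph `G_c` of the template: the union of the bipartite pieces. -/
noncomputable def Gc (T : GTemplate V C r) (c : C) : SimpleGraph V :=
  ⨆ i, ⨆ j, T.Ge c i j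

/-- `T` is an `R`-template with parameters `(m, ε, d, δ)`. -/
def IsParam (T : GTemplate V C r) (m ε d δ : ℝ) : Prop :=
  (∀ j, m ≤ ((T.Vc j).card : ℝ) ∧ ((T.Vc j).card : ℝ) ≤ m / δ) ∧
  (∀ i j, T.R.Adj i j → δ * m ≤ ((T.Cc i j).card : ℝ)) ∧
  (∀ i j, T.R.Adj i j →
    ColReg ε d (fun c => T.Ge c i j) (T.Vc i) (T.Vc j) (T.Cc i j))

/-- `T` is a super `R`-template with parameters `(m, ε, d, δ)`. -/
def IsSuperParam (T : GTemplate V C r) (m ε d δ : ℝ) : Prop :=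
  (∀ j, m ≤ ((T.Vc j).card : ℝ) ∧ ((T.Vc j).card : ℝ) ≤ m / δ) ∧
  (∀ i j, T.R.Adj i j → δ * m ≤ ((T.Cc i j).card : ℝ)) ∧
  (∀ i j, T.R.Adj i j →
    ColSuperReg ε d (fun c => T.Ge c i j) (T.Vc i) (T.Vc j) (T.Cc i j))

/-- `T` is a half-super `R`-template with parameters `(m, ε, d, δ)`. -/
def IsHalfSuperParam (T : GTemplate V C r) (m ε d δ : ℝ) : Prop :=
  (∀ j, m ≤ ((T.Vc j).card : ℝ) ∧ ((T.Vc j).card : ℝ) ≤ m / δ) ∧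
  (∀ i j, T.R.Adj i j → δ * m ≤ ((T.Cc i j).card : ℝ)) ∧
  (∀ i j, T.R.Adj i j →
    ColHalfSuperReg ε d (fun c => T.Ge c i j) (T.Vc i) (T.Vc j) (T.Cc i j))

/-- `T` is a semi-super `R`-template with parameters `(m, ε, d, δ)`. -/
def IsSemiSuperParam (T : GTemplate V C r) (m ε d δ : ℝ) : Prop :=
  T.IsParam m ε d δ ∧
  ∀ i j, T.R.Adj i j →
    (∀ v ∈ T.Vc i, d * ((T.Vc j).card : ℝ) * ((T.Cc i j).card : ℝ) ≤
      ∑ c ∈ T.Cc i j, (degIn (T.Ge c i j) v (T.Vc j) : ℝ)) ∧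
    (∀ v ∈ T.Vc j, d * ((T.Vc i).card : ℝ) * ((T.Cc i j).card : ℝ) ≤
      ∑ c ∈ T.Cc i j, (degIn (T.Ge c i j) v (T.Vc i) : ℝ))

/-- The template is rainbow: the colour clusters are pairwise disjoint. -/
def Rainbow (T : GTemplate V C r) : Prop :=
  ∀ i j k l, T.R.Adj i j → T.R.Adj k l → s(i, j) ≠ s(k, l) →
    Disjoint (T.Cc i j) (T.Cc k l)

/-- Adjacency in the `l`-thick graph of the template, between clusters `i` and `j`. -/
def ThickAdj (T : GTemplate V C r) (l : ℝ) (i j : Fin r) (x y : V) : Prop :=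
  l * ((T.Cc i j).card : ℝ) ≤
    (((T.Cc i j).filter (fun c => (T.Ge c i j).Adj x y)).card : ℝ)

end GTemplate

/-! ## Statement 1 -/


/-- List colouring: if each list has at least `#E` elements there is an injective choice. -/
lemma list_choice {α β : Type*} (E : Finset α) (l : α → Finset β)
    (h : ∀ e ∈ E, E.card ≤ (l e).card) [Nonempty β] :
    ∃ f : α → β, Set.InjOn f E ∧ ∀ e ∈ E, f e ∈ l e := by
  have key := (Finset.all_card_le_biUnion_card_iff_exists_injective (fun e : E => l e)).1 (by
    intro s
    rcases s.eq_empty_or_nonempty with rfl | ⟨x, hx⟩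
    · simp
    · calc s.card ≤ (univ : Finset E).card := card_le_card (subset_univ _)
        _ = E.card := by simp
        _ ≤ (l x).card := h x x.2
        _ ≤ _ := card_le_card (Finset.subset_biUnion_of_mem (fun e : E => l e) hx))
  obtain ⟨f, hf, hm⟩ := key
  refine ⟨fun e => if h : e ∈ E then f ⟨e, h⟩ else Classical.arbitrary β, ?_, ?_⟩
  · intro x hx y hy hxy
    simp only [mem_coe] at hx hy
    simp only [hx, hy, dif_pos] at hxy
    simpa using hf hxy
  · intro e he
    simp only [he, dif_pos]
    exact hm ⟨e, he⟩

/-- Hall for pairs with min degree and no holes. -/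
lemma hall_super {α β : Type*} [Nonempty β] (r : α → β → Prop) (A : Finset α) (B : Finset β) (t : ℝ)
    (hAB : A.card = B.card)
    (hA : ∀ x ∈ A, t ≤ ((B.filter (fun y => r x y)).card : ℝ))
    (hB : ∀ y ∈ B, t ≤ ((A.filter (fun x => r x y)).card : ℝ))
    (hole : ∀ S ⊆ A, ∀ T ⊆ B, t ≤ (S.card : ℝ) → t ≤ (T.card : ℝ) → ∃ x ∈ S, ∃ y ∈ T, r x y) :
    ∃ f : α → β, Set.InjOn f A ∧ ∀ x ∈ A, f x ∈ B ∧ r x (f x) := by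
  have key := (Finset.all_card_le_biUnion_card_iff_exists_injective
      (fun e : A => B.filter (fun y => r e y))).1 (by
    intro s
    rcases s.eq_empty_or_nonempty with rfl | ⟨x, hx⟩
    · simp
    by_contra hlt
    push Not at hlt
    set NS := s.biUnion (fun e : A => B.filter (fun y => r e y)) with hNS
    set S : Finset α := s.map (Function.Embedding.subtype _) with hS
    have hSA : S ⊆ A := by
      intro y hy
      simp [hS] at hy
      exact hy.1
    have hScard : S.card = s.card := by simp [hS]
    have hNSB : NS ⊆ B := by
      intro y hy
      simp [hNS] at hy
      tauto
    have h1 : t ≤ (S.card : ℝ) := by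
      have := hA x x.2
      have h2 : (B.filter (fun y => r x y)).card ≤ NS.card :=
        card_le_card (Finset.subset_biUnion_of_mem (fun e : A => B.filter (fun y => r e y)) hx)
      have h3 : NS.card ≤ S.card := by omega
      calc t ≤ _ := this
        _ ≤ (S.card : ℝ) := by exact_mod_cast h2.trans h3
    have hT : (B \ NS).card + NS.card = B.card := by
      rw [card_sdiff_add_card_eq_card hNSB]
    have noedge : ∀ x ∈ S, ∀ y ∈ B \ NS, ¬ r x y := by
      intro x hx y hy hr
      simp [hS] at hx
      obtain ⟨hxA, hxs⟩ := hx
      simp [hNS] at hy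
      exact hy.2 x hxA hxs hy.1 hr
    by_cases h2 : t ≤ ((B \ NS).card : ℝ)
    · obtain ⟨x, hx, y, hy, hr⟩ := hole S hSA _ sdiff_subset h1 h2
      exact noedge x hx y hy hr
    · have hSle : S.card ≤ A.card := card_le_card hSA
      have hne : (B \ NS).Nonempty := by
        rw [← card_pos]; omega
      obtain ⟨y, hy⟩ := hne
      have h3 := hB y (mem_sdiff.1 hy).1
      have h4 : (A.filter (fun x => r x y)) ⊆ A \ S := by
        intro z hz
        rw [mem_filter] at hz
        exact mem_sdiff.2 ⟨hz.1, fun hzS => noedge z hzS y hy hz.2⟩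
      have h5 := card_le_card h4
      have h6 : (A \ S).card + S.card = A.card := card_sdiff_add_card_eq_card hSA
      have h7 : (A \ S).card ≤ (B \ NS).card := by omega
      apply h2
      calc t ≤ _ := h3
        _ ≤ _ := by exact_mod_cast h5.trans h7)
  obtain ⟨f, hf, hm⟩ := key
  refine ⟨fun e => if h : e ∈ A then f ⟨e, h⟩ else Classical.arbitrary β, ?_, ?_⟩
  · intro x hx y hy hxy
    simp only [mem_coe] at hx hy
    simp only [hx, hy, dif_pos] at hxy
    simpa using hf hxy
  · intro e he
    simp only [he, dif_pos]
    simpa using hm ⟨e, he⟩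

/-- Potential (conditional expectations) lemma. -/
lemma potential {X Y J : Type*} [Nonempty Y] (conf : Y → Y → Prop) (hconf : ∀ y y', conf y y' → conf y' y)
    (Yb : Finset Y) (JJ : Finset J) (w : J → X → Y → ℝ) (lam : J → X → ℝ)
    (hw : ∀ j x y, 0 ≤ w j x y) (hl : ∀ j x, 0 ≤ lam j x) (M : ℕ)
    (hne : ∀ K : Finset Y, K.card ≤ M → (Yb.filter (fun y => ∀ k ∈ K, ¬ conf y k)).Nonempty)
    (I : Finset X) (hI : I.card ≤ M)
    (havg : ∀ j ∈ JJ, ∀ x ∈ I, ∀ K : Finset Y, K.card ≤ M →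
      ∑ y ∈ Yb.filter (fun y => ∀ k ∈ K, ¬ conf y k), w j x y ≤
        lam j x * ((Yb.filter (fun y => ∀ k ∈ K, ¬ conf y k)).card : ℝ)) :
    ∀ a : J → ℝ, (∀ j, 0 ≤ a j) →
    ∃ g : X → Y, (∀ x ∈ I, g x ∈ Yb) ∧ (∀ x ∈ I, ∀ x' ∈ I, x ≠ x' → ¬ conf (g x) (g x')) ∧
      ∑ j ∈ JJ, a j * ∏ x ∈ I, w j x (g x) ≤ ∑ j ∈ JJ, a j * ∏ x ∈ I, lam j x := by
  induction I using Finset.induction_on with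
  | empty => intro a _; exact ⟨fun _ => Classical.arbitrary Y, by simp⟩
  | insert x I hx ih =>
    intro a ha
    have hIM : I.card ≤ M := (card_le_card (subset_insert x I)).trans hI
    obtain ⟨g, hg1, hg2, hg3⟩ := ih hIM (fun j hj x hx => havg j hj x (mem_insert_of_mem hx))
      (fun j => a j * lam j x) (fun j => mul_nonneg (ha j) (hl j x))
    set K := I.image g
    have hK : K.card ≤ M := card_image_le.trans hIM
    set A := Yb.filter (fun y => ∀ k ∈ K, ¬ conf y k) with hA
    have hAne : A.Nonempty := hne K hK
    have : ∃ y ∈ A, ∑ j ∈ JJ, (a j * ∏ x ∈ I, w j x (g x)) * w j x y ≤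
        ∑ j ∈ JJ, (a j * ∏ x ∈ I, w j x (g x)) * lam j x := by
      apply Finset.exists_le_of_sum_le hAne
      rw [Finset.sum_comm, Finset.sum_const, nsmul_eq_mul, Finset.mul_sum]
      apply Finset.sum_le_sum
      intro j hj
      rw [← Finset.mul_sum]
      have h1 := havg j hj x (mem_insert_self x I) K hK
      have h2 : 0 ≤ a j * ∏ x ∈ I, w j x (g x) :=
        mul_nonneg (ha j) (Finset.prod_nonneg fun i _ => hw _ _ _)
      calc _ ≤ (a j * ∏ x ∈ I, w j x (g x)) * (lam j x * (A.card : ℝ)) :=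
            mul_le_mul_of_nonneg_left h1 h2
        _ = _ := by ring
    obtain ⟨y, hyA, hy⟩ := this
    have hyA' := (mem_filter.1 hyA)
    have hgx : ∀ z ∈ I, Function.update g x y z = g z := by
      intro z hz
      exact Function.update_of_ne (fun h : z = x => hx (h ▸ hz)) _ _
    refine ⟨Function.update g x y, ?_, ?_, ?_⟩
    · intro z hz
      rcases mem_insert.1 hz with rfl | hz
      · simpa using hyA'.1
      · rw [hgx z hz]; exact hg1 z hz
    · intro z hz z' hz' hzz
      rcases mem_insert.1 hz with hz1 | hz1
      · rcases mem_insert.1 hz' with hz2 | hz2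
        · exact absurd (hz1.trans hz2.symm) hzz
        · rw [hgx z' hz2, hz1, Function.update_self]
          exact hyA'.2 _ (mem_image_of_mem g hz2)
      · rcases mem_insert.1 hz' with hz2 | hz2
        · rw [hgx z hz1, hz2, Function.update_self]
          exact fun h => hyA'.2 _ (mem_image_of_mem g hz1) (hconf _ _ h)
        · rw [hgx z' hz2, hgx z hz1]
          exact hg2 z hz1 z' hz2 hzz
    · calc _ = ∑ j ∈ JJ, (a j * ∏ x ∈ I, w j x (g x)) * w j x y := by
            apply Finset.sum_congr rfl
            intro j _
            rw [Finset.prod_insert hx, Function.update_self,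
              Finset.prod_congr rfl (fun z hz => by rw [hgx z hz])]
            ring
        _ ≤ _ := hy
        _ = ∑ j ∈ JJ, a j * lam j x * ∏ x ∈ I, w j x (g x) := by
            apply Finset.sum_congr rfl; intro j _; ring
        _ ≤ _ := hg3
        _ = _ := by
            apply Finset.sum_congr rfl; intro j _
            rw [Finset.prod_insert hx]; ring

/-- Reserve lemma. -/
lemma reserve {V : Type*} (U : Finset V) (q : ℕ) (hq : 1 ≤ q) (J : Finset (Finset V)) (s0 t : ℕ)
    (hJ : ∀ S ∈ J, s0 ≤ (S ∩ U).card)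
    (hnum : (J.card : ℝ) * q * (2 ^ t * (1 - 1 / (2 * q : ℝ)) ^ s0) < 1) :
    ∃ R ⊆ U, R.card * q ≤ U.card ∧ ∀ S ∈ J, t ≤ (S ∩ R).card := by
  haveI : NeZero q := ⟨by omega⟩
  have hq0 : (0:ℝ) < q := by exact_mod_cast hq
  have hq1 : (1:ℝ) ≤ q := by exact_mod_cast hq
  have hb0 : (0:ℝ) ≤ 1 - 1 / (2 * q : ℝ) := by
    rw [sub_nonneg, div_le_one (by positivity)]; linarith
  have hb1 : 1 - 1 / (2 * q : ℝ) ≤ 1 := by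
    have : 0 ≤ 1 / (2 * q : ℝ) := by positivity
    linarith
  obtain ⟨g, -, -, hg⟩ := potential (X := V) (Y := Fin q) (J := Finset V × Fin q)
    (fun _ _ => False) (by simp) univ (J ×ˢ univ)
    (fun j x y => if x ∈ j.1 ∧ y = j.2 then 1/2 else 1)
    (fun j x => if x ∈ j.1 then 1 - 1 / (2 * q : ℝ) else 1)
    (by intro j x y; split_ifs <;> norm_num) (by intro j x; split_ifs; exact hb0; norm_num) U.card
    (by intro K _; simp) U le_rfl
    (by
      intro j _ x _ K _
      simp only [not_false_eq_true, implies_true, filter_true, card_univ, Fintype.card_fin]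
      by_cases hx : x ∈ j.1
      · simp only [hx, true_and, if_true]
        rw [Finset.sum_ite]
        simp only [sum_const, nsmul_eq_mul, Finset.filter_eq', mem_univ, if_true, card_singleton]
        rw [Finset.filter_ne', card_erase_of_mem (mem_univ _)]
        simp only [card_univ, Fintype.card_fin]
        rw [Nat.cast_sub hq]
        apply le_of_eq
        field_simp
        push_cast
        ring
      · simp [hx])
    (fun _ => 2 ^ t) (by intro; positivity)
  have hsum : ∑ j ∈ J ×ˢ (univ : Finset (Fin q)), (2:ℝ) ^ t *
      ∏ x ∈ U, (if x ∈ j.1 then 1 - 1 / (2 * q : ℝ) else 1) < 1 := by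
    refine lt_of_le_of_lt ?_ hnum
    calc _ ≤ ∑ j ∈ J ×ˢ (univ : Finset (Fin q)), ((2:ℝ) ^ t * (1 - 1 / (2 * q : ℝ)) ^ s0) := by
          apply Finset.sum_le_sum
          intro j hj
          apply mul_le_mul_of_nonneg_left _ (by positivity)
          rw [Finset.prod_ite]
          simp only [prod_const, one_pow, mul_one]
          apply pow_le_pow_of_le_one hb0 hb1
          have := hJ j.1 (mem_product.1 hj).1
          refine this.trans (card_le_card ?_)
          intro x hx
          simp at hx ⊢
          tauto
      _ = _ := by simp [card_product]
  have hsmall := lt_of_le_of_lt hg hsum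
  have hclass : ∀ S ∈ J, ∀ i : Fin q, t ≤ (S ∩ U.filter (fun x => g x = i)).card := by
    intro S hS i
    by_contra hlt
    push Not at hlt
    have h1 : (2:ℝ) ^ t * ∏ x ∈ U, (if x ∈ S ∧ g x = i then (1/2 : ℝ) else 1) < 1 := by
      refine lt_of_le_of_lt ?_ hsmall
      exact Finset.single_le_sum (f := fun j : Finset V × Fin q => (2:ℝ) ^ t *
        ∏ x ∈ U, (if x ∈ j.1 ∧ g x = j.2 then (1/2 : ℝ) else 1))
        (fun j _ => mul_nonneg (by positivity) (Finset.prod_nonneg fun x _ => by split_ifs <;> norm_num))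
        (show (S, i) ∈ J ×ˢ univ by simp [hS])
    rw [Finset.prod_ite] at h1
    simp only [prod_const, one_pow, mul_one] at h1
    have h2 : (U.filter (fun x => x ∈ S ∧ g x = i)).card = (S ∩ U.filter (fun x => g x = i)).card := by
      congr 1; ext x; simp; tauto
    rw [h2] at h1
    have h3 : (1:ℝ) ≤ 2 ^ t * (1/2) ^ (S ∩ U.filter (fun x => g x = i)).card := by
      have : ((1:ℝ)/2) ^ t ≤ (1/2) ^ (S ∩ U.filter (fun x => g x = i)).card :=
        pow_le_pow_of_le_one (by norm_num) (by norm_num) hlt.le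
      calc (1:ℝ) = 2 ^ t * (1/2) ^ t := by rw [← mul_pow]; norm_num
        _ ≤ _ := mul_le_mul_of_nonneg_left this (by positivity)
    linarith
  obtain ⟨i, -, hi⟩ : ∃ i ∈ (univ : Finset (Fin q)), (U.filter (fun x => g x = i)).card * q ≤ U.card := by
    by_contra hcon
    push Not at hcon
    have h1 : U.card = ∑ i : Fin q, (U.filter (fun x => g x = i)).card :=
      Finset.card_eq_sum_card_fiberwise (fun x _ => by simp)
    have h2 : ∑ i : Fin q, U.card < ∑ i : Fin q, (U.filter (fun x => g x = i)).card * q :=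
      Finset.sum_lt_sum_of_nonempty univ_nonempty hcon
    rw [← Finset.sum_mul, ← h1] at h2
    simp [mul_comm] at h2
  exact ⟨_, filter_subset _ _, hi, fun S hS => hclass S hS i⟩


/-- Edge count of a relation, as a real number. -/
noncomputable def ecnt {α β : Type*} (r : α → β → Prop) (P : Finset α) (Q : Finset β) : ℝ :=
  ∑ x ∈ P, ((Q.filter (fun y => r x y)).card : ℝ)

lemma ecnt_swap {α β : Type*} (r : α → β → Prop) (P : Finset α) (Q : Finset β) :
    ecnt r P Q = ecnt (fun y x => r x y) Q P := by
  unfold ecnt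
  have := Finset.sum_card_bipartiteAbove_eq_sum_card_bipartiteBelow (s := P) (t := Q) r
  unfold bipartiteAbove bipartiteBelow at this
  exact_mod_cast this

lemma ecnt_nonneg {α β : Type*} (r : α → β → Prop) (P : Finset α) (Q : Finset β) :
    0 ≤ ecnt r P Q := Finset.sum_nonneg fun _ _ => by positivity

lemma ecnt_le {α β : Type*} (r : α → β → Prop) (P : Finset α) (Q : Finset β) :
    ecnt r P Q ≤ (P.card : ℝ) * Q.card := by
  unfold ecnt
  calc _ ≤ ∑ x ∈ P, (Q.card : ℝ) :=
        Finset.sum_le_sum fun _ _ => by exact_mod_cast card_le_card (filter_subset _ _)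
    _ = _ := by simp

/-- Shrinking a set while not decreasing the average of a weight. -/
lemma shrink_avg {α : Type*} (f : α → ℝ) (P : Finset α) (k : ℕ) (hk : k ≤ P.card) :
    ∃ P' ⊆ P, P'.card = k ∧ (k : ℝ) * ∑ x ∈ P, f x ≤ (P.card : ℝ) * ∑ x ∈ P', f x := by
  induction P using Finset.strongInduction with
  | H P ih =>
  rcases hk.eq_or_lt with h | h
  · exact ⟨P, Subset.rfl, h.symm, by rw [h]⟩
  · have hne : P.Nonempty := card_pos.1 (by omega)
    obtain ⟨v, hv, hmin⟩ := Finset.exists_min_image P f hne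
    have hc : (P.erase v).card + 1 = P.card := card_erase_add_one hv
    obtain ⟨P', hP', hk', hav⟩ := ih (P.erase v) (erase_ssubset hv) (by omega)
    refine ⟨P', hP'.trans (erase_subset _ _), hk', ?_⟩
    have hsum : ∑ x ∈ P.erase v, f x + f v = ∑ x ∈ P, f x := Finset.sum_erase_add _ _ hv
    have hfv : (P.card : ℝ) * f v ≤ ∑ x ∈ P, f x := by
      have := Finset.card_nsmul_le_sum P f (f v) hmin
      simpa using this
    rcases Nat.eq_zero_or_pos k with hk0 | hk0
    · subst hk0
      rw [card_eq_zero] at hk'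
      simp [hk']
    have hp : (0:ℝ) < (P.erase v).card := by
      have : 0 < (P.erase v).card := by omega
      exact_mod_cast this
    have hc' : (P.card : ℝ) = (P.erase v).card + 1 := by exact_mod_cast hc.symm
    have hkr : (0:ℝ) < k := by exact_mod_cast hk0
    set p : ℝ := ((P.erase v).card : ℝ)
    set S := ∑ x ∈ P, f x
    set S1 := ∑ x ∈ P.erase v, f x
    set S2 := ∑ x ∈ P', f x
    rw [hc'] at hfv ⊢
    have h1 : p * S ≤ (p + 1) * S1 := by nlinarith
    have h2 : p * (k * S) ≤ p * ((p + 1) * S2) := by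
      calc p * (k * S) = k * (p * S) := by ring
        _ ≤ k * ((p + 1) * S1) := mul_le_mul_of_nonneg_left h1 hkr.le
        _ = (p + 1) * (k * S1) := by ring
        _ ≤ (p + 1) * (p * S2) := mul_le_mul_of_nonneg_left hav (by linarith)
        _ = _ := by ring
    exact le_of_mul_le_mul_left h2 hp

lemma shrink_dens {α β : Type*} (r : α → β → Prop) (P : Finset α) (Q : Finset β) (k : ℕ)
    (hk : k ≤ P.card) (hk0 : 0 < k) :
    ∃ P' ⊆ P, P'.card = k ∧ ecnt r P Q / (P.card * Q.card) ≤ ecnt r P' Q / (k * Q.card) := by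
  obtain ⟨P', h1, h2, h3⟩ := shrink_avg (fun x => ((Q.filter (fun y => r x y)).card : ℝ)) P k hk
  refine ⟨P', h1, h2, ?_⟩
  have hkr : (0:ℝ) < k := by exact_mod_cast hk0
  have hpr : (0:ℝ) < P.card := by exact_mod_cast lt_of_lt_of_le hk0 hk
  rcases Nat.eq_zero_or_pos Q.card with hq | hq
  · simp [hq]
  · have hqr : (0:ℝ) < Q.card := by exact_mod_cast hq
    rw [div_le_div_iff₀ (by positivity) (by positivity)]
    unfold ecnt
    nlinarith

/-- minimum degree part of the max pair lemma -/
lemma maxpair_deg {α β : Type*} (r : α → β → Prop) (P : Finset α) (Q : Finset β) (s : ℕ) (D : ℝ)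
    (L : ℕ) (hL : 3 ≤ L) (hs : 4 ≤ s) (hD : 0 < D) (hP : P.card = s) (hQ : Q.card = s)
    (he : ecnt r P Q = D * s ^ 2)
    (hmax : ∀ P' ⊆ P, 0 < P'.card →
      (ecnt r P' Q / (P'.card * s)) ^ L * P'.card ≤ D ^ L * s) :
    ∀ x ∈ P, D / 2 * s ≤ ((Q.filter (fun y => r x y)).card : ℝ) := by
  intro v hv
  by_contra hlt
  push Not at hlt
  have hc : (P.erase v).card + 1 = P.card := card_erase_add_one hv
  have h1 := hmax (P.erase v) (erase_subset _ _) (by omega)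
  have hsum : ecnt r (P.erase v) Q + ((Q.filter (fun y => r v y)).card : ℝ) = ecnt r P Q :=
    Finset.sum_erase_add _ _ hv
  have hcs : ((P.erase v).card : ℝ) = s - 1 := by
    rw [hP] at hc
    have : ((P.erase v).card : ℝ) + 1 = s := by exact_mod_cast hc
    linarith
  rw [hcs] at h1
  have hsr : (4:ℝ) ≤ s := by exact_mod_cast hs
  have hdens : D * (1 + 1 / (2 * (s - 1))) ≤ ecnt r (P.erase v) Q / ((s - 1) * s) := by
    have h0 : (0:ℝ) < s - 1 := by linarith
    rw [le_div_iff₀ (by nlinarith)]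
    have : D * (1 + 1 / (2 * ((s:ℝ) - 1))) * ((s - 1) * s) = D * s * (s - 1/2) := by
      field_simp; ring
    rw [this]
    nlinarith
  have hx : (0:ℝ) ≤ 1 / (2 * (s - 1)) := by
    apply div_nonneg <;> linarith
  have hbern := one_add_mul_le_pow (a := (1:ℝ) / (2 * (s - 1))) (by linarith) L
  have hpow : (D * (1 + 1 / (2 * ((s:ℝ) - 1)))) ^ L ≤ (ecnt r (P.erase v) Q / ((s - 1) * s)) ^ L :=
    pow_le_pow_left₀ (by positivity) hdens L
  rw [mul_pow] at hpow
  have hDL : 0 < D ^ L := by positivity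
  have h3 : D ^ L * (1 + L * (1 / (2 * ((s:ℝ) - 1)))) * (s - 1) ≤ D ^ L * s := by
    calc _ ≤ D ^ L * (1 + 1 / (2 * ((s:ℝ) - 1))) ^ L * (s - 1) := by
          apply mul_le_mul_of_nonneg_right _ (by linarith)
          exact mul_le_mul_of_nonneg_left hbern hDL.le
      _ ≤ (ecnt r (P.erase v) Q / ((s - 1) * s)) ^ L * (s - 1) :=
          mul_le_mul_of_nonneg_right hpow (by linarith)
      _ ≤ _ := h1
  have h4 : D ^ L * (1 + L * (1 / (2 * ((s:ℝ) - 1)))) * (s - 1) = D ^ L * (s - 1 + L / 2) := by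
    have h0 : (s:ℝ) - 1 ≠ 0 := by linarith
    field_simp
  rw [h4] at h3
  have h5 := le_of_mul_le_mul_left h3 hDL
  have : (3:ℝ) ≤ L := by exact_mod_cast hL
  linarith

/-- Max pair lemma. -/
lemma max_pair {α β : Type*} (r : α → β → Prop) (A : Finset α) (B : Finset β) (a θ : ℝ) (L : ℕ)
    (ha : 0 < a) (hθ : 0 < θ) (hθ4 : θ ≤ 1/4) (hL3 : 3 ≤ L)
    (hL : 1 / θ ≤ (1 + θ ^ 2) ^ L) (hAB : A.card ≤ B.card)
    (hdeg : ∀ x ∈ A, a * B.card ≤ ((B.filter (fun y => r x y)).card : ℝ))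
    (hbig : 4 ≤ a ^ L * A.card) :
    ∃ A' ⊆ A, ∃ B' ⊆ B, A'.card = B'.card ∧ a ^ L * A.card ≤ (A'.card : ℝ) ∧
      (∀ x ∈ A', a / 2 * A'.card ≤ ((B'.filter (fun y => r x y)).card : ℝ)) ∧
      (∀ y ∈ B', a / 2 * A'.card ≤ ((A'.filter (fun x => r x y)).card : ℝ)) ∧
      (∀ S ⊆ A', ∀ T ⊆ B', θ * A'.card ≤ (S.card : ℝ) → θ * A'.card ≤ (T.card : ℝ) →
        ∃ x ∈ S, ∃ y ∈ T, r x y) := by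
  have hApos : 0 < A.card := by
    rcases Nat.eq_zero_or_pos A.card with h | h
    · rw [h] at hbig; norm_num at hbig
    · exact h
  have hBpos : 0 < B.card := lt_of_lt_of_le hApos hAB
  set fam := ((A.powerset ×ˢ B.powerset).filter
    (fun p => p.1.card = p.2.card ∧ 0 < p.1.card)) with hfam
  set psi : Finset α × Finset β → ℝ :=
    fun p => (ecnt r p.1 p.2 / (p.1.card * p.2.card)) ^ L * p.1.card with hpsi
  -- balanced representatives
  have hbal : ∀ P ⊆ A, ∀ Q ⊆ B, 0 < P.card → 0 < Q.card → ∀ k : ℕ, k = min P.card Q.card →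
      ∃ p ∈ fam, (ecnt r P Q / (P.card * Q.card)) ^ L * k ≤ psi p := by
    intro P hP Q hQ hp hq k hk
    have hk0 : 0 < k := by rw [hk]; exact lt_min hp hq
    obtain ⟨P', hP', hPc, hd1⟩ := shrink_dens r P Q k (hk ▸ min_le_left _ _) hk0
    obtain ⟨Q', hQ', hQc, hd2⟩ := shrink_dens (fun y x => r x y) Q P' k (hk ▸ min_le_right _ _) hk0
    refine ⟨(P', Q'), ?_, ?_⟩
    · simp only [hfam, mem_filter, mem_product, mem_powerset]
      exact ⟨⟨hP'.trans hP, hQ'.trans hQ⟩, hPc.trans hQc.symm, hPc ▸ hk0⟩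
    · simp only [hpsi, hPc, hQc]
      apply mul_le_mul_of_nonneg_right _ (by positivity)
      apply pow_le_pow_left₀ (div_nonneg (ecnt_nonneg _ _ _) (by positivity))
      rw [← ecnt_swap r P' Q, ← ecnt_swap r P' Q', hPc] at hd2
      calc _ ≤ _ := hd1
        _ = ecnt r P' Q / (Q.card * k) := by rw [mul_comm (k:ℝ)]
        _ ≤ _ := hd2
  have hfne : fam.Nonempty := by
    obtain ⟨p, hp, -⟩ := hbal A Subset.rfl B Subset.rfl hApos hBpos _ rfl
    exact ⟨p, hp⟩
  obtain ⟨⟨P, Q⟩, hPQ, hmax⟩ := Finset.exists_max_image fam psi hfne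
  have hPQ' := hPQ
  simp only [hfam, mem_filter, mem_product, mem_powerset] at hPQ'
  obtain ⟨⟨hPA, hQB⟩, hcard, hPpos⟩ := hPQ'
  obtain ⟨s, hs⟩ : ∃ s, s = P.card := ⟨_, rfl⟩
  have hQs : Q.card = s := by rw [hs, hcard]
  rw [← hs] at hPpos
  have hsr : (0:ℝ) < s := by exact_mod_cast hPpos
  obtain ⟨D, hD⟩ : ∃ D, D = ecnt r P Q / (s * s) := ⟨_, rfl⟩
  have hD0 : 0 ≤ D := by rw [hD]; exact div_nonneg (ecnt_nonneg _ _ _) (by positivity)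
  have he : ecnt r P Q = D * s ^ 2 := by rw [hD]; field_simp
  have hD1 : D ≤ 1 := by
    have := ecnt_le r P Q
    rw [← hs, hQs] at this
    rw [hD]; exact div_le_one_of_le₀ this (by positivity)
  have hpsiPQ : psi (P, Q) = D ^ L * s := by
    simp only [hpsi, ← hs, hQs, hD]
  have hM : ∀ P' ⊆ A, ∀ Q' ⊆ B, 0 < P'.card → 0 < Q'.card → ∀ k : ℕ, k = min P'.card Q'.card →
      (ecnt r P' Q' / (P'.card * Q'.card)) ^ L * k ≤ D ^ L * s := by
    intro P' hP' Q' hQ' hp hq k hk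
    obtain ⟨p, hp, hle⟩ := hbal P' hP' Q' hQ' hp hq k hk
    exact hle.trans (hpsiPQ ▸ hmax p hp)
  -- the density is at least a
  have hA0 : a ^ L * A.card ≤ D ^ L * s := by
    refine le_trans ?_ (hM A Subset.rfl B Subset.rfl hApos hBpos A.card (by omega))
    apply mul_le_mul_of_nonneg_right _ (Nat.cast_nonneg _)
    apply pow_le_pow_left₀ ha.le
    rw [le_div_iff₀ (mul_pos (Nat.cast_pos.2 hApos) (Nat.cast_pos.2 hBpos))]
    unfold ecnt
    calc a * (A.card * B.card) = ∑ x ∈ A, a * (B.card : ℝ) := by simp; ring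
      _ ≤ _ := Finset.sum_le_sum hdeg
  have hsA : a ^ L * A.card ≤ s := by
    refine hA0.trans ?_
    have : D ^ L ≤ 1 := pow_le_one₀ hD0 hD1
    nlinarith
  have haD : a ≤ D := by
    by_contra hlt
    push Not at hlt
    have h1 : D ^ L < a ^ L := pow_lt_pow_left₀ hlt hD0 (by omega)
    have h2 : (s:ℝ) ≤ A.card := by rw [hs]; exact_mod_cast card_le_card hPA
    have h3 : (0:ℝ) < A.card := by exact_mod_cast hApos
    have : D ^ L * s ≤ D ^ L * A.card := mul_le_mul_of_nonneg_left h2 (by positivity)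
    nlinarith
  have hDpos : 0 < D := lt_of_lt_of_le ha haD
  have hs4 : 4 ≤ s := by
    have : (4:ℝ) ≤ s := hbig.trans hsA
    exact_mod_cast this
  have hs4r : (4:ℝ) ≤ s := by exact_mod_cast hs4
  have hDL : 0 < D ^ L := by positivity
  refine ⟨P, hPA, Q, hQB, hcard, hs ▸ hsA, ?_, ?_, ?_⟩
  · intro x hx
    have := maxpair_deg r P Q s D L hL3 hs4 hDpos hs.symm hQs he (by
      intro P' hP' hp
      have h1 : P'.card ≤ s := hs ▸ card_le_card hP'
      have := hM P' (hP'.trans hPA) Q hQB hp (by omega) P'.card (by omega)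
      rwa [hQs] at this) x hx
    rw [← hs]
    refine le_trans ?_ this
    apply mul_le_mul_of_nonneg_right _ hsr.le
    linarith
  · intro y hy
    have := maxpair_deg (fun y x => r x y) Q P s D L hL3 hs4 hDpos hQs hs.symm
      (by rw [← ecnt_swap r P Q]; exact he) (by
      intro Q' hQ' hp
      have h1 : Q'.card ≤ s := hQs ▸ card_le_card hQ'
      have := hM P hPA Q' (hQ'.trans hQB) (by omega) hp Q'.card (by omega)
      rwa [← hs, mul_comm (s:ℝ), ecnt_swap] at this) y hy
    rw [← hs]
    refine le_trans ?_ this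
    apply mul_le_mul_of_nonneg_right _ hsr.le
    linarith
  · intro S0 hS0 T0 hT0 hSc hTc
    rw [← hs] at hSc hTc
    by_contra hno
    push Not at hno
    set t := ⌈θ * s⌉₊ with ht
    have ht1 : θ * s ≤ t := Nat.le_ceil _
    have ht2 : (t:ℝ) < θ * s + 1 := Nat.ceil_lt_add_one (by positivity)
    have ht3 : 2 * (t:ℝ) ≤ s := by nlinarith
    have ht3' : 2 * t ≤ s := by exact_mod_cast ht3
    have ht0 : (0:ℝ) < t := lt_of_lt_of_le (by positivity) ht1
    have ht0' : 0 < t := by exact_mod_cast ht0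
    obtain ⟨S, hSS, hS⟩ := Finset.exists_subset_card_eq (Nat.ceil_le.2 hSc)
    obtain ⟨T, hTT, hT⟩ := Finset.exists_subset_card_eq (Nat.ceil_le.2 hTc)
    rw [← ht] at hS hT
    have hSP := hSS.trans hS0
    have hTQ := hTT.trans hT0
    have hc1 : (P \ S).card = s - t := by rw [card_sdiff_of_subset hSP, hS, hs]
    have hc2 : (Q \ T).card = s - t := by rw [card_sdiff_of_subset hTQ, hT, hQs]
    have hst : ((s - t : ℕ) : ℝ) = s - t := Nat.cast_sub (by omega)
    have m1 := hM (P \ S) (sdiff_subset.trans hPA) Q hQB (by omega) (by omega) (s - t) (by omega)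
    have m2 := hM S (hSP.trans hPA) (Q \ T) (sdiff_subset.trans hQB) (by omega) (by omega) t
      (by omega)
    rw [hc1, hQs, hst] at m1
    rw [hc2, hS, hst] at m2
    have hstp : (0:ℝ) < s - t := by linarith
    have hθinv : (4:ℝ) ≤ 1 / θ := by rw [le_div_iff₀ hθ]; linarith
    have key : ∀ x k : ℝ, 0 ≤ x → 0 < k → θ * s ≤ k → x ^ L * k ≤ D ^ L * s →
        x ≤ D * (1 + θ ^ 2) := by
      intro x k hx hk hθk hxk
      by_contra hlt
      push Not at hlt
      have h1 : (D * (1 + θ ^ 2)) ^ L < x ^ L := pow_lt_pow_left₀ hlt (by positivity) (by omega)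
      rw [mul_pow] at h1
      have h2 : D ^ L * (1 / θ) ≤ D ^ L * (1 + θ ^ 2) ^ L := mul_le_mul_of_nonneg_left hL hDL.le
      have h3 : D ^ L * (1 / θ) < x ^ L := lt_of_le_of_lt h2 h1
      have h4 : D ^ L * (1 / θ) * k < D ^ L * s := lt_of_lt_of_le (mul_lt_mul_of_pos_right h3 hk) hxk
      have h5 : D ^ L * s ≤ D ^ L * (1 / θ) * k := by
        rw [mul_assoc]
        apply mul_le_mul_of_nonneg_left _ hDL.le
        rw [one_div_mul_eq_div, le_div_iff₀ hθ]
        linarith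
      linarith
    have d1 := key _ _ (div_nonneg (ecnt_nonneg _ _ _) (by positivity)) hstp (by nlinarith) m1
    have d2 := key _ _ (div_nonneg (ecnt_nonneg _ _ _) (by positivity)) ht0 ht1 m2
    rw [div_le_iff₀ (by positivity)] at d1 d2
    have hsplit : ecnt r P Q = ecnt r (P \ S) Q + ecnt r S (Q \ T) := by
      unfold ecnt
      rw [← Finset.sum_sdiff hSP]
      congr 1
      apply Finset.sum_congr rfl
      intro x hx
      congr 2
      ext y
      simp only [mem_filter, mem_sdiff]
      constructor
      · rintro ⟨h1, h2⟩
        exact ⟨⟨h1, fun h3 => hno x (hSS hx) y (hTT h3) h2⟩, h2⟩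
      · rintro ⟨⟨h1, _⟩, h2⟩
        exact ⟨h1, h2⟩
    rw [he] at hsplit
    have h1 : D * s ^ 2 ≤ D * ((1 + θ ^ 2) * (s ^ 2 - t ^ 2)) := by
      rw [hsplit]
      linarith [d1, d2]
    have h2 := le_of_mul_le_mul_left h1 hDpos
    have h3 : (θ * s) ^ 2 ≤ (t:ℝ) ^ 2 := pow_le_pow_left₀ (by positivity) ht1 2
    have h4 : 0 < θ ^ 2 * (θ * s) ^ 2 := by positivity
    have h5 : 0 ≤ θ ^ 2 * (t:ℝ)^2 := by positivity
    have h6 : (θ * s) ^ 2 = θ ^ 2 * s ^ 2 := by ring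
    have h7 : θ ^ 2 * (θ * s) ^ 2 ≤ θ ^ 2 * (t:ℝ) ^ 2 :=
      mul_le_mul_of_nonneg_left h3 (by positivity)
    linarith [h2, h3, h4, h5, h6, h7]


/-- `uv` is an edge of at least `θ` of the graphs with colours in `D`. -/
def Thick {V C : Type*} (G : C → SimpleGraph V) (D : Finset C) (θ : ℝ) (u v : V) : Prop :=
  θ ≤ ((D.filter (fun c => (G c).Adj u v)).card : ℝ)

lemma Thick.symm {V C : Type*} {G : C → SimpleGraph V} {D : Finset C} {θ : ℝ} {u v : V}
    (h : Thick G D θ u v) : Thick G D θ v u := by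
  unfold Thick at *
  have : (D.filter (fun c => (G c).Adj v u)) = (D.filter (fun c => (G c).Adj u v)) := by
    ext c
    simp only [mem_filter, SimpleGraph.adj_comm]
  rwa [this]

/-- typical vertices have the right degree into every large set. -/
def Typ {V : Type*} (T : V → V → Prop) (Vs : Bool → Finset V) (e q : ℝ) : Prop :=
  ∀ i, ∀ B ⊆ Vs (!i), e ≤ (B.card : ℝ) →
    (((Vs i).filter (fun a => ((B.filter (fun b => T a b)).card : ℝ) < q * B.card)).card : ℝ) < e

lemma Typ.mono {V : Type*} {T T' : V → V → Prop} {Vs : Bool → Finset V} {e q : ℝ}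
    (h : Typ T Vs e q) (hTT : ∀ u v, T u v → T' u v) : Typ T' Vs e q := by
  intro i B hB he
  refine lt_of_le_of_lt ?_ (h i B hB he)
  apply Nat.cast_le.2
  apply card_le_card
  intro a ha
  rw [mem_filter] at ha ⊢
  refine ⟨ha.1, lt_of_le_of_lt ?_ ha.2⟩
  apply Nat.cast_le.2
  apply card_le_card
  intro b hb
  rw [mem_filter] at hb ⊢
  exact ⟨hb.1, hTT _ _ hb.2⟩

lemma pairCount_eq {V : Type*} (G : SimpleGraph V) (A B : Finset V) :
    pairCount G A B = ∑ a ∈ A, (B.filter (fun b => G.Adj a b)).card := by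
  unfold pairCount
  rw [Finset.card_filter, Finset.sum_product]
  apply Finset.sum_congr rfl
  intro a _
  rw [Finset.card_filter]

lemma pairCount_comm {V : Type*} (G : SimpleGraph V) (A B : Finset V) :
    pairCount G A B = pairCount G B A := by
  rw [pairCount_eq, pairCount_eq]
  have := Finset.sum_card_bipartiteAbove_eq_sum_card_bipartiteBelow (s := A) (t := B)
    (fun a b => G.Adj a b)
  unfold bipartiteAbove bipartiteBelow at this
  rw [this]
  apply Finset.sum_congr rfl
  intro a _
  congr 1
  ext b
  simp [SimpleGraph.adj_comm]

/-- the colour-degree of a vertex into a set in terms of thick neighbours -/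
lemma coldeg_le {V C : Type*} (G : C → SimpleGraph V) (D : Finset C) (θ : ℝ) (a : V) (hθ : 0 ≤ θ)
    (B : Finset V) :
    ∑ c ∈ D, ((B.filter (fun b => (G c).Adj a b)).card : ℝ) ≤
      ((B.filter (fun b => Thick G D θ a b)).card : ℝ) * D.card + B.card * θ := by
  have h1 : ∑ c ∈ D, ((B.filter (fun b => (G c).Adj a b)).card : ℝ) =
      ∑ b ∈ B, ((D.filter (fun c => (G c).Adj a b)).card : ℝ) := by
    have := Finset.sum_card_bipartiteAbove_eq_sum_card_bipartiteBelow (s := D) (t := B)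
      (fun c b => (G c).Adj a b)
    unfold bipartiteAbove bipartiteBelow at this
    exact_mod_cast this
  rw [h1]
  have h2 : ∀ b ∈ B, ((D.filter (fun c => (G c).Adj a b)).card : ℝ) ≤
      (if Thick G D θ a b then (D.card : ℝ) else 0) + θ := by
    intro b _
    split_ifs with h
    · have : ((D.filter (fun c => (G c).Adj a b)).card : ℝ) ≤ D.card := by
        exact_mod_cast card_le_card (filter_subset _ _)
      linarith
    · unfold Thick at h
      push Not at h
      linarith
  refine (Finset.sum_le_sum h2).trans ?_
  rw [Finset.sum_add_distrib, ← Finset.sum_filter]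
  simp

lemma typ_thick {V C : Type*} (G : C → SimpleGraph V) (D : Finset C) (Vs : Bool → Finset V)
    (d e : ℝ) (hd : 0 < d) (he : 0 < e) (hD : 0 < D.card)
    (hreg : ∀ i, ∀ A ⊆ Vs i, ∀ B ⊆ Vs (!i), e ≤ (A.card : ℝ) → e ≤ (B.card : ℝ) →
      d * D.card * A.card * B.card ≤ ∑ c ∈ D, (pairCount (G c) A B : ℝ)) :
    Typ (Thick G D (d / 2 * D.card)) Vs e (d / 2) := by
  intro i B hB heB
  by_contra hlt
  push Not at hlt
  set A := (Vs i).filter (fun a =>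
    ((B.filter (fun b => Thick G D (d / 2 * D.card) a b)).card : ℝ) < d / 2 * B.card) with hA
  have h1 := hreg i A (filter_subset _ _) B hB hlt heB
  have hDr : (0:ℝ) < D.card := by exact_mod_cast hD
  have hne : A.Nonempty := by
    rw [← card_pos]
    have : (0:ℝ) < A.card := lt_of_lt_of_le he hlt
    exact_mod_cast this
  have h2 : ∑ c ∈ D, (pairCount (G c) A B : ℝ) =
      ∑ a ∈ A, ∑ c ∈ D, ((B.filter (fun b => (G c).Adj a b)).card : ℝ) := by
    rw [Finset.sum_comm]
    apply Finset.sum_congr rfl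
    intro c _
    rw [pairCount_eq]
    push_cast
    rfl
  have h3 : ∑ a ∈ A, ∑ c ∈ D, ((B.filter (fun b => (G c).Adj a b)).card : ℝ) <
      ∑ a ∈ A, d * D.card * B.card := by
    apply Finset.sum_lt_sum_of_nonempty hne
    intro a ha
    have h4 := coldeg_le G D (d / 2 * D.card) a (by positivity) B
    have h5 := (mem_filter.1 ha).2
    nlinarith
  rw [h2] at h1
  have h6 : ∑ a ∈ A, d * D.card * B.card = d * D.card * A.card * B.card := by
    simp; ring
  linarith

/-- Greedy embedding lemma. -/
lemma greedy {V W : Type*} [Fintype W] (H : SimpleGraph W) (part : W → Bool)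
    (hbip : ∀ x y, H.Adj x y → part y = !(part x)) (Δ : ℕ) (hdeg : ∀ w, degOf H w ≤ Δ) (hΔ : 1 ≤ Δ)
    (Vs : Bool → Finset V) (T : V → V → Prop) (hsymm : ∀ u v, T u v → T v u) (e q : ℝ) (he : 0 < e)
    (hq0 : 0 ≤ q) (hq1 : q ≤ 1) (hT : Typ T Vs e q) (Z : Finset W) (C0 : W → Finset V)
    (hC0 : ∀ z ∈ Z, C0 z ⊆ Vs (part z)) (c0 : ℝ) (hc0 : 0 ≤ c0) (hcard : ∀ z ∈ Z, c0 ≤ ((C0 z).card : ℝ))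
    [Nonempty V]
    (L : Finset W) (hLZ : L ⊆ Z) (hbig : (L.card : ℝ) + Δ * e < q ^ Δ * c0) :
    ∃ τ : W → V, Set.InjOn τ L ∧ (∀ z ∈ L, τ z ∈ C0 z) ∧
      (∀ x ∈ L, ∀ y ∈ L, H.Adj x y → T (τ x) (τ y)) ∧
      ∀ z ∈ Z, q ^ Δ * c0 ≤
        (((C0 z).filter (fun v => ∀ y ∈ L, H.Adj z y → T v (τ y))).card : ℝ) := by
  suffices h : ∃ τ : W → V, Set.InjOn τ L ∧ (∀ z ∈ L, τ z ∈ C0 z) ∧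
      (∀ x ∈ L, ∀ y ∈ L, H.Adj x y → T (τ x) (τ y)) ∧
      ∀ z ∈ Z, q ^ (L.filter (fun y => H.Adj z y)).card * c0 ≤
        (((C0 z).filter (fun v => ∀ y ∈ L, H.Adj z y → T v (τ y))).card : ℝ) by
    obtain ⟨τ, h1, h2, h3, h4⟩ := h
    refine ⟨τ, h1, h2, h3, fun z hz => le_trans ?_ (h4 z hz)⟩
    apply mul_le_mul_of_nonneg_right _ hc0
    apply pow_le_pow_of_le_one hq0 hq1
    exact (card_le_card (filter_subset_filter _ (subset_univ _))).trans (hdeg z)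
  induction L using Finset.induction_on with
  | empty => exact ⟨fun _ => Classical.arbitrary V, by simp, by simp, by simp, by simpa using hcard⟩
  | insert x L hx ih =>
    have hcl : ((insert x L).card : ℝ) = L.card + 1 := by
      rw [card_insert_of_notMem hx]; push_cast; ring
    obtain ⟨τ, h1, h2, h3, h4⟩ := ih ((subset_insert x L).trans hLZ) (by linarith)
    have hxZ : x ∈ Z := hLZ (mem_insert_self x L)
    set cand : W → Finset V := fun z => (C0 z).filter (fun v => ∀ y ∈ L, H.Adj z y → T v (τ y))
      with hcand
    have hcandbig : ∀ z ∈ Z, q ^ Δ * c0 ≤ ((cand z).card : ℝ) := by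
      intro z hz
      refine le_trans ?_ (h4 z hz)
      apply mul_le_mul_of_nonneg_right _ hc0
      apply pow_le_pow_of_le_one hq0 hq1
      exact (card_le_card (filter_subset_filter _ (subset_univ _))).trans (hdeg z)
    set Nx := (univ : Finset W).filter (fun w => H.Adj x w) with hNx
    set bad : W → Finset V := fun z => if z ∈ Z then (Vs (part x)).filter (fun a =>
      (((cand z).filter (fun b => T a b)).card : ℝ) < q * (cand z).card) else ∅ with hbad
    have hΔr : (1:ℝ) ≤ Δ := by exact_mod_cast hΔ
    have hbadc : ∀ z ∈ Nx, ((bad z).card : ℝ) ≤ e := by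
      intro z hz
      simp only [hbad]
      split_ifs with hzZ
      · apply le_of_lt
        have hp := hbip x z (mem_filter.1 hz).2
        apply hT (part x) (cand z)
        · rw [← hp]; exact (filter_subset _ _).trans (hC0 z hzZ)
        · refine le_trans ?_ (hcandbig z hzZ)
          have h0 : (0:ℝ) ≤ (insert x L).card := by positivity
          nlinarith
      · simp [he.le]
    have hex : ∃ v ∈ cand x, v ∉ L.image τ ∪ Nx.biUnion bad := by
      by_contra hcon
      push Not at hcon
      have hsub : cand x ⊆ L.image τ ∪ Nx.biUnion bad := hcon
      have c1 : ((cand x).card : ℝ) ≤ L.card + Δ * e := by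
        calc ((cand x).card : ℝ) ≤ ((L.image τ ∪ Nx.biUnion bad).card : ℝ) := by
              exact_mod_cast card_le_card hsub
          _ ≤ ((L.image τ).card : ℝ) + ((Nx.biUnion bad).card : ℝ) := by
              exact_mod_cast card_union_le _ _
          _ ≤ L.card + ∑ z ∈ Nx, ((bad z).card : ℝ) := by
              gcongr
              · exact card_image_le
              · exact_mod_cast card_biUnion_le
          _ ≤ L.card + ∑ z ∈ Nx, e := by gcongr with z hz; exact hbadc z hz
          _ ≤ L.card + Δ * e := by
              simp only [sum_const, nsmul_eq_mul]
              gcongr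
              exact hdeg x
      have := hcandbig x hxZ
      linarith
    obtain ⟨v, hv, hvn⟩ := hex
    rw [mem_union, not_or] at hvn
    have hv' := mem_filter.1 hv
    have hup : ∀ z ∈ L, Function.update τ x v z = τ z := fun z hz =>
      Function.update_of_ne (fun h : z = x => hx (h ▸ hz)) _ _
    refine ⟨Function.update τ x v, ?_, ?_, ?_, ?_⟩
    · intro z hz z' hz' hzz
      rw [mem_coe, mem_insert] at hz hz'
      rcases hz with rfl | hz <;> rcases hz' with rfl | hz'
      · rfl
      · rw [hup z' hz', Function.update_self] at hzz
        exact absurd (hzz ▸ mem_image_of_mem τ hz') hvn.1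
      · rw [hup z hz, Function.update_self] at hzz
        exact absurd (hzz ▸ mem_image_of_mem τ hz) hvn.1
      · rw [hup z hz, hup z' hz'] at hzz
        exact h1 hz hz' hzz
    · intro z hz
      rcases mem_insert.1 hz with rfl | hz
      · rw [Function.update_self]; exact hv'.1
      · rw [hup z hz]; exact h2 z hz
    · intro z hz z' hz' hadj
      rcases mem_insert.1 hz with hz1 | hz1 <;> rcases mem_insert.1 hz' with hz2 | hz2
      · rw [hz1, hz2] at hadj
        exact absurd hadj (H.loopless.irrefl _)
      · rw [hup z' hz2, hz1, Function.update_self]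
        exact hv'.2 z' hz2 (hz1 ▸ hadj)
      · rw [hup z hz1, hz2, Function.update_self]
        exact hsymm _ _ (hv'.2 z hz1 (hz2 ▸ hadj.symm))
      · rw [hup z hz1, hup z' hz2]; exact h3 z hz1 z' hz2 hadj
    · intro z hz
      by_cases hzx : H.Adj z x
      · have hzN : z ∈ Nx := by simp [hNx, hzx.symm]
        have hnb : v ∉ bad z := fun h => hvn.2 (mem_biUnion.2 ⟨z, hzN, h⟩)
        simp only [hbad, hz, if_true, mem_filter, not_and, not_lt] at hnb
        have hvV : v ∈ Vs (part x) := hC0 x hxZ hv'.1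
        have h5 := hnb hvV
        have h6 : (cand z).filter (fun b => T v b) ⊆ (C0 z).filter
            (fun u => ∀ y ∈ insert x L, H.Adj z y → T u (Function.update τ x v y)) := by
          intro b hb
          rw [mem_filter] at hb
          rw [mem_filter]
          have hb1 := mem_filter.1 hb.1
          refine ⟨hb1.1, ?_⟩
          intro y hy hzy
          rcases mem_insert.1 hy with rfl | hy
          · rw [Function.update_self]; exact hsymm _ _ hb.2
          · rw [hup y hy]; exact hb1.2 y hy hzy
        have h7 : ((insert x L).filter (fun y => H.Adj z y)).card =
            (L.filter (fun y => H.Adj z y)).card + 1 := by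
          rw [filter_insert, if_pos hzx, card_insert_of_notMem (by simp [hx])]
        rw [h7, pow_succ]
        calc _ = q * (q ^ (L.filter (fun y => H.Adj z y)).card * c0) := by ring
          _ ≤ q * (cand z).card := mul_le_mul_of_nonneg_left (h4 z hz) hq0
          _ ≤ _ := h5
          _ ≤ _ := by exact_mod_cast card_le_card h6
      · have h7 : ((insert x L).filter (fun y => H.Adj z y)) =
            (L.filter (fun y => H.Adj z y)) := by
          rw [filter_insert, if_neg hzx]
        rw [h7]
        refine (h4 z hz).trans ?_
        apply Nat.cast_le.2
        apply card_le_card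
        intro b hb
        rw [mem_filter] at hb ⊢
        refine ⟨hb.1, ?_⟩
        intro y hy hzy
        rcases mem_insert.1 hy with rfl | hy
        · exact absurd hzy hzx
        · rw [hup y hy]; exact hb.2 y hy hzy


/-- all tuples of length `D` with entries in `Q` -/
noncomputable def Tup {V : Type*} (Q : Finset V) (D : ℕ) : Finset (Fin D → V) :=
  Fintype.piFinset (fun _ => Q)

lemma mem_Tup {V : Type*} (Q : Finset V) (D : ℕ) (y : Fin D → V) : y ∈ Tup Q D ↔ ∀ j, y j ∈ Q := by
  simp [Tup]

lemma card_Tup {V : Type*} (Q : Finset V) (D : ℕ) : (Tup Q D).card = Q.card ^ D := by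
  simp [Tup]

lemma tup_in_card {V : Type*} (Q S : Finset V) (D : ℕ) (j : Fin D) :
    ((Tup Q D).filter (fun y => y j ∈ S)).card * Q.card ≤ S.card * Q.card ^ D := by
  rw [← card_Tup, ← card_product, ← card_product]
  apply Finset.card_le_card_of_injOn (fun p => (p.1 j, Function.update p.1 j p.2))
  · intro p hp
    simp only [coe_product, Set.mem_prod, mem_coe, mem_filter, mem_Tup] at hp ⊢
    refine ⟨hp.1.2, fun i => ?_⟩
    by_cases h : i = j
    · subst h; simpa using hp.2
    · rw [Function.update_of_ne h]; exact hp.1.1 i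
  · rintro ⟨y, a⟩ _ ⟨y', a'⟩ _ h
    simp only [Prod.mk.injEq] at h ⊢
    have h2 : a = a' := by simpa using congrFun h.2 j
    refine ⟨?_, h2⟩
    ext i
    by_cases hi : i = j
    · subst hi; exact h.1
    · simpa [Function.update_of_ne hi] using congrFun h.2 i

lemma tup_eq_card {V : Type*} (Q : Finset V) (D : ℕ) (j j' : Fin D) (hj : j ≠ j') :
    ((Tup Q D).filter (fun y => y j = y j')).card * Q.card ≤ Q.card ^ D := by
  rw [← card_Tup, ← card_product]
  apply Finset.card_le_card_of_injOn (fun p => Function.update p.1 j p.2)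
  · intro p hp
    simp only [coe_product, Set.mem_prod, mem_coe, mem_filter, mem_Tup] at hp ⊢
    intro i
    by_cases h : i = j
    · subst h; simpa using hp.2
    · rw [Function.update_of_ne h]; exact hp.1.1 i
  · rintro ⟨y, a⟩ hy ⟨y', a'⟩ hy' h
    simp only [coe_product, Set.mem_prod, mem_coe, mem_filter, mem_Tup] at hy hy'
    simp only [Prod.mk.injEq] at h ⊢
    have h2 : a = a' := by simpa using congrFun h j
    refine ⟨?_, h2⟩
    have h3 : ∀ i, i ≠ j → y i = y' i := by
      intro i hi
      simpa [Function.update_of_ne hi] using congrFun h i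
    ext i
    by_cases hi : i = j
    · rw [hi, hy.1.2, hy'.1.2]; exact h3 j' hj.symm
    · exact h3 i hi

/-- bad tuples are few -/
lemma tup_bad_card {V : Type*} (T : V → V → Prop) (P Q : Finset V) (e q : ℝ) (hq0 : 0 ≤ q)
    (hq1 : q ≤ 1) (he : 0 ≤ e)
    (hT : ∀ B ⊆ P, e ≤ (B.card : ℝ) →
      ((Q.filter (fun a => ((B.filter (fun b => T b a)).card : ℝ) < q * B.card)).card : ℝ) ≤ e)
    (D : ℕ) : ∀ B ⊆ P, e ≤ q ^ D * B.card →
    (((Tup Q D).filter (fun y => ((B.filter (fun b => ∀ j, T b (y j))).card : ℝ) < q ^ D * B.card)).card : ℝ)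
      * Q.card ≤ D * e * (Q.card : ℝ) ^ D := by
  induction D with
  | zero =>
    intro B hB _
    simp
  | succ D ih =>
    intro B hB heB
    have hB0 : (0:ℝ) ≤ B.card := by positivity
    have hqD : q ^ (D+1) ≤ 1 := pow_le_one₀ hq0 hq1
    have heB' : e ≤ B.card := heB.trans (by nlinarith)
    set Ba := Q.filter (fun a => ((B.filter (fun b => T b a)).card : ℝ) < q * B.card) with hBa
    set Bt : V → Finset (Fin D → V) := fun a => (Tup Q D).filter
      (fun y => (((B.filter (fun b => T b a)).filter (fun b => ∀ j, T b (y j))).card : ℝ) <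
        q ^ D * (B.filter (fun b => T b a)).card) with hBt
    have hsub : (Tup Q (D+1)).filter
        (fun y => ((B.filter (fun b => ∀ j, T b (y j))).card : ℝ) < q ^ (D+1) * B.card) ⊆
        (Ba ×ˢ Tup Q D).image (fun p => (Fin.cons p.1 p.2 : Fin (D+1) → V)) ∪
        (Q \ Ba).biUnion (fun a => (Bt a).image (fun y => (Fin.cons a y : Fin (D+1) → V))) := by
      intro y hy
      rw [mem_filter, mem_Tup] at hy
      have htail : Fin.tail y ∈ Tup Q D := (mem_Tup _ _ _).2 fun j => hy.1 _
      rw [mem_union]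
      by_cases h0 : y 0 ∈ Ba
      · left
        rw [mem_image]
        exact ⟨(y 0, Fin.tail y), mem_product.2 ⟨h0, htail⟩, Fin.cons_self_tail y⟩
      · right
        rw [mem_biUnion]
        refine ⟨y 0, mem_sdiff.2 ⟨hy.1 0, h0⟩, mem_image.2 ⟨Fin.tail y, ?_, Fin.cons_self_tail y⟩⟩
        simp only [hBt, mem_filter]
        refine ⟨htail, ?_⟩
        have h1 : (B.filter (fun b => T b (y 0))).filter (fun b => ∀ j, T b (Fin.tail y j)) =
            B.filter (fun b => ∀ j, T b (y j)) := by
          ext b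
          rw [mem_filter, mem_filter, mem_filter, Fin.forall_fin_succ]
          simp only [Fin.tail]
          tauto
        rw [h1]
        refine lt_of_lt_of_le hy.2 ?_
        simp only [hBa, mem_filter, hy.1 0, true_and, not_lt] at h0
        calc q ^ (D+1) * B.card = q ^ D * (q * B.card) := by ring
          _ ≤ _ := mul_le_mul_of_nonneg_left h0 (by positivity)
    have hc1 : ((Ba ×ˢ Tup Q D).image (fun p => (Fin.cons p.1 p.2 : Fin (D+1) → V))).card ≤
        Ba.card * Q.card ^ D := by
      refine card_image_le.trans ?_
      rw [card_product, card_Tup]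
    have hc2 : ((Q \ Ba).biUnion (fun a => (Bt a).image (fun y => (Fin.cons a y : Fin (D+1) → V)))).card
        ≤ ∑ a ∈ Q \ Ba, (Bt a).card := by
      refine card_biUnion_le.trans ?_
      exact Finset.sum_le_sum fun a _ => card_image_le
    have hBac : (Ba.card : ℝ) ≤ e := hT B hB heB'
    have hBtc : ∀ a ∈ Q \ Ba, ((Bt a).card : ℝ) * Q.card ≤ D * e * (Q.card : ℝ) ^ D := by
      intro a ha
      apply ih _ ((filter_subset _ _).trans hB)
      have h0 := (mem_sdiff.1 ha).2
      simp only [hBa, mem_filter, (mem_sdiff.1 ha).1, true_and, not_lt] at h0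
      refine heB.trans ?_
      calc q ^ (D+1) * B.card = q ^ D * (q * B.card) := by ring
        _ ≤ _ := mul_le_mul_of_nonneg_left h0 (by positivity)
    calc _ ≤ ((Ba.card : ℝ) * (Q.card : ℝ) ^ D + ∑ a ∈ Q \ Ba, ((Bt a).card : ℝ)) * Q.card := by
          apply mul_le_mul_of_nonneg_right _ (by positivity)
          have := (card_le_card hsub).trans ((card_union_le _ _).trans (add_le_add hc1 hc2))
          exact_mod_cast this
      _ = (Ba.card : ℝ) * (Q.card : ℝ) ^ (D+1) + ∑ a ∈ Q \ Ba, ((Bt a).card : ℝ) * Q.card := by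
          rw [add_mul, Finset.sum_mul]; ring
      _ ≤ e * (Q.card : ℝ) ^ (D+1) + ∑ a ∈ Q \ Ba, D * e * (Q.card : ℝ) ^ D := by
          apply add_le_add
          · exact mul_le_mul_of_nonneg_right hBac (by positivity)
          · exact Finset.sum_le_sum hBtc
      _ ≤ e * (Q.card : ℝ) ^ (D+1) + Q.card * (D * e * (Q.card : ℝ) ^ D) := by
          rw [sum_const, nsmul_eq_mul]
          gcongr
          exact sdiff_subset
      _ = _ := by push_cast; ring

/-- The tuple lemma. -/
lemma tuple {V X : Type*} [Nonempty V] (T : V → V → Prop) (P Q P0 Used : Finset V) (D : ℕ)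
    (e q q1 : ℝ) (hq0 : 0 < q) (hq1 : q ≤ 1) (he : 0 < e) (hq10 : 0 ≤ q1) (hq11 : q1 ≤ 1)
    (hT : ∀ B ⊆ P, e ≤ (B.card : ℝ) →
      ((Q.filter (fun a => ((B.filter (fun b => T b a)).card : ℝ) < q * B.card)).card : ℝ) ≤ e)
    (heP : e ≤ q ^ D * P.card)
    (hP0 : ∀ v ∈ P0, q1 * Q.card ≤ ((Q.filter (fun a => T v a)).card : ℝ))
    (hQ : 0 < Q.card) (I : Finset X) (ξ : ℝ)
    (hξ : D * (Used.card + D * I.card + D + e) ≤ ξ * Q.card) (hξ1 : ξ ≤ q1 ^ D / 2) (hξ2 : ξ ≤ 1 / 2)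
    (t s1 : ℕ) (hη : 2 * D * e / Q.card ≤ 1)
    (hnum : (P0.card : ℝ) * (2 ^ t * (1 - q1 ^ D / 4) ^ I.card) +
      2 ^ (I.card + P.card) * (2 * D * e / Q.card) ^ s1 < 1) :
    ∃ g : X → (Fin D → V), (∀ x ∈ I, ∀ j, g x j ∈ Q ∧ g x j ∉ Used) ∧
      (∀ x ∈ I, ∀ x' ∈ I, ∀ j j', g x j = g x' j' → x = x' ∧ j = j') ∧
      (∀ x ∈ I, q ^ D * P.card ≤ ((P.filter (fun v => ∀ j, T v (g x j))).card : ℝ)) ∧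
      (∀ v ∈ P0, t ≤ (I.filter (fun x => ∀ j, T v (g x j))).card) ∧
      (∀ S ⊆ I, ∀ B ⊆ P, s1 ≤ S.card → e ≤ q ^ D * B.card →
        ∃ x ∈ S, ∃ v ∈ B, ∀ j, T v (g x j)) := by
  set N : ℝ := (Q.card : ℝ) ^ D with hN
  have hQr : (0:ℝ) < Q.card := by exact_mod_cast hQ
  have hN0 : 0 < N := by positivity
  obtain ⟨conf, hconf⟩ : ∃ conf : (Fin D → V) → (Fin D → V) → Prop,
    ∀ y k, conf y k ↔ ∃ j j', y j = k j' := ⟨fun y k => ∃ j j', y j = k j', fun _ _ => Iff.rfl⟩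
  set Bad := (Tup Q D).filter
    (fun y => ((P.filter (fun b => ∀ j, T b (y j))).card : ℝ) < q ^ D * P.card) with hBad
  set Yb := (Tup Q D).filter (fun y => (∀ j, y j ∉ Used) ∧ (∀ j j', y j = y j' → j = j') ∧
    q ^ D * P.card ≤ ((P.filter (fun b => ∀ j, T b (y j))).card : ℝ)) with hYb
  -- allowed tuples are most tuples
  have hAll : ∀ K : Finset (Fin D → V), K.card ≤ I.card →
      ((Tup Q D \ Yb.filter (fun y => ∀ k ∈ K, ¬ conf y k)).card : ℝ) ≤ ξ * N := by
    intro K hK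
    set U := Used ∪ K.biUnion (fun k => univ.image k) with hU
    have hUc : (U.card : ℝ) ≤ Used.card + D * I.card := by
      have h1 : U.card ≤ Used.card + I.card * D := by
        refine (card_union_le _ _).trans (Nat.add_le_add_left ?_ _)
        refine (card_biUnion_le_card_mul K _ D ?_).trans (Nat.mul_le_mul_right _ hK)
        intro k _
        refine card_image_le.trans (by simp)
      have : (U.card : ℝ) ≤ Used.card + I.card * D := by exact_mod_cast h1
      linarith
    have hsub : Tup Q D \ Yb.filter (fun y => ∀ k ∈ K, ¬ conf y k) ⊆
        ((univ : Finset (Fin D)).biUnion (fun j => (Tup Q D).filter (fun y => y j ∈ U))) ∪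
        (((univ : Finset (Fin D × Fin D)).filter (fun p => p.1 ≠ p.2)).biUnion
          (fun p => (Tup Q D).filter (fun y => y p.1 = y p.2)) ∪ Bad) := by
      intro y hy
      rw [mem_sdiff] at hy
      obtain ⟨hyT, hy⟩ := hy
      by_contra hcon
      simp only [mem_union, mem_biUnion, mem_univ, true_and, mem_filter, hyT, hBad, not_or,
        not_exists, not_and, not_lt, hU, mem_image, Prod.forall] at hcon
      apply hy
      simp only [mem_filter, hYb, hyT, true_and]
      refine ⟨⟨fun j => (hcon.1 j).1, ?_, hcon.2.2⟩, ?_⟩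
      · intro j j' hjj
        by_contra hne
        exact hcon.2.1 j j' hne hjj
      · intro k hk hc
        obtain ⟨j, j', hjj⟩ := (hconf _ _).1 hc
        exact (hcon.1 j).2 k hk j' hjj.symm
    have hc : ((Tup Q D \ Yb.filter (fun y => ∀ k ∈ K, ¬ conf y k)).card : ℝ) * Q.card ≤
        (D * (Used.card + D * I.card + D + e)) * N := by
      calc _ ≤ (∑ j : Fin D, (((Tup Q D).filter (fun y => y j ∈ U)).card : ℝ) +
            (∑ p ∈ (univ : Finset (Fin D × Fin D)).filter (fun p => p.1 ≠ p.2),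
              (((Tup Q D).filter (fun y => y p.1 = y p.2)).card : ℝ) + Bad.card)) * Q.card := by
            apply mul_le_mul_of_nonneg_right _ hQr.le
            have := (card_le_card hsub).trans ((card_union_le _ _).trans (add_le_add card_biUnion_le
              ((card_union_le _ _).trans (add_le_add_left card_biUnion_le _))))
            exact_mod_cast this
        _ = ∑ j : Fin D, (((Tup Q D).filter (fun y => y j ∈ U)).card : ℝ) * Q.card +
            (∑ p ∈ (univ : Finset (Fin D × Fin D)).filter (fun p => p.1 ≠ p.2),
              (((Tup Q D).filter (fun y => y p.1 = y p.2)).card : ℝ) * Q.card +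
              Bad.card * Q.card) := by
            rw [add_mul, add_mul, Finset.sum_mul, Finset.sum_mul]
        _ ≤ ∑ j : Fin D, (Used.card + D * I.card) * N +
            (∑ p ∈ (univ : Finset (Fin D × Fin D)).filter (fun p => p.1 ≠ p.2), N +
              D * e * N) := by
            refine add_le_add (Finset.sum_le_sum fun j hj => ?_)
              (add_le_add (Finset.sum_le_sum fun p hp => ?_) ?_)
            · have : (((Tup Q D).filter (fun y => y j ∈ U)).card : ℝ) * Q.card ≤ U.card * N := by
                have := tup_in_card Q U D j
                rw [hN]
                exact_mod_cast this
              exact this.trans (mul_le_mul_of_nonneg_right hUc hN0.le)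
            · have := tup_eq_card Q D p.1 p.2 (mem_filter.1 hp).2
              rw [hN]
              exact_mod_cast this
            · exact tup_bad_card T P Q e q hq0.le hq1 he.le hT D P Subset.rfl heP
        _ ≤ D * ((Used.card + D * I.card) * N) + (D * D * N + D * e * N) := by
            have hp : (((univ : Finset (Fin D × Fin D)).filter (fun p => p.1 ≠ p.2)).card : ℝ) ≤ D * D := by
              have : ((univ : Finset (Fin D × Fin D)).filter (fun p => p.1 ≠ p.2)).card ≤ D * D := by
                refine (card_le_card (filter_subset _ _)).trans (by simp)
              exact_mod_cast this
            simp only [sum_const, nsmul_eq_mul, card_univ, Fintype.card_fin]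
            gcongr
        _ = _ := by ring
    have h2 : ((Tup Q D \ Yb.filter (fun y => ∀ k ∈ K, ¬ conf y k)).card : ℝ) * Q.card ≤
        ξ * N * Q.card := by
      refine hc.trans ?_
      calc _ ≤ ξ * Q.card * N := mul_le_mul_of_nonneg_right hξ hN0.le
        _ = _ := by ring
    exact le_of_mul_le_mul_right h2 hQr
  have hYsub : ∀ K : Finset (Fin D → V), Yb.filter (fun y => ∀ k ∈ K, ¬ conf y k) ⊆ Tup Q D :=
    fun K => (filter_subset _ _).trans (filter_subset _ _)
  have hTN : ((Tup Q D).card : ℝ) = N := by rw [card_Tup, hN]; push_cast; rfl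
  have hYle : ∀ K : Finset (Fin D → V),
      ((Yb.filter (fun y => ∀ k ∈ K, ¬ conf y k)).card : ℝ) ≤ N := by
    intro K
    rw [← hTN]; exact_mod_cast card_le_card (hYsub K)
  have hYge : ∀ K : Finset (Fin D → V), K.card ≤ I.card →
      N / 2 ≤ ((Yb.filter (fun y => ∀ k ∈ K, ¬ conf y k)).card : ℝ) := by
    intro K hK
    have h1 := hAll K hK
    have h2 := card_sdiff_add_card_eq_card (hYsub K)
    have h3 : ((Tup Q D \ Yb.filter (fun y => ∀ k ∈ K, ¬ conf y k)).card : ℝ) +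
      ((Yb.filter (fun y => ∀ k ∈ K, ¬ conf y k)).card : ℝ) = N := by
      rw [← hTN]; exact_mod_cast h2
    nlinarith
  set η : ℝ := 2 * D * e / Q.card with hηdef
  have hη0 : 0 ≤ η := by positivity
  have hq1D : q1 ^ D ≤ 1 := pow_le_one₀ hq10 hq11
  have hq1D0 : 0 ≤ q1 ^ D := by positivity
  set HH := (I.powerset ×ˢ P.powerset).filter (fun p => s1 ≤ p.1.card ∧ e ≤ q ^ D * p.2.card) with hHH
  set JJ : Finset (V ⊕ (Finset X × Finset V)) := P0.disjSum HH with hJJ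
  obtain ⟨g, hg1, hg2, hg3⟩ := potential conf (fun y y' h => by
      obtain ⟨j, j', h⟩ := (hconf _ _).1 h
      exact (hconf _ _).2 ⟨j', j, h.symm⟩) Yb JJ
    (fun j x y => Sum.elim (fun v => if ∀ i, T v (y i) then (1/2 : ℝ) else 1)
      (fun p => if x ∈ p.1 ∧ ∃ v ∈ p.2, ∀ i, T v (y i) then 0 else 1) j)
    (fun j x => Sum.elim (fun _ => 1 - q1 ^ D / 4) (fun p => if x ∈ p.1 then η else 1) j)
    (by
      rintro (v | p) x y
      · simp only [Sum.elim_inl]; split_ifs <;> norm_num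
      · simp only [Sum.elim_inr]; split_ifs <;> norm_num)
    (by
      rintro (v | p) x
      · simp only [Sum.elim_inl]; linarith
      · simp only [Sum.elim_inr]; split_ifs; exact hη0; norm_num)
    I.card
    (by
      intro K hK
      rw [← card_pos]
      have := hYge K hK
      have : (0:ℝ) < ((Yb.filter (fun y => ∀ k ∈ K, ¬ conf y k)).card : ℝ) := by linarith
      exact_mod_cast this)
    I le_rfl
    (by
      intro j hj x hx K hK
      set Y := Yb.filter (fun y => ∀ k ∈ K, ¬ conf y k) with hY
      rcases j with v | p
      · simp only [Sum.elim_inl]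
        rw [hJJ, inl_mem_disjSum] at hj
        set Gd := (Tup Q D).filter (fun y => ∀ i, T v (y i)) with hGd
        have hGdc : q1 ^ D * N ≤ Gd.card := by
          have h1 : Gd = Tup (Q.filter (fun a => T v a)) D := by
            ext y
            simp only [hGd, mem_filter, mem_Tup]
            exact ⟨fun h i => ⟨h.1 i, h.2 i⟩, fun h => ⟨fun i => (h i).1, fun i => (h i).2⟩⟩
          rw [h1, card_Tup, hN, ← mul_pow]
          push_cast
          exact pow_le_pow_left₀ (by positivity) (hP0 v hj) D
        have hGY : (Gd.card : ℝ) ≤ (Y.filter (fun y => ∀ i, T v (y i))).card + ξ * N := by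
          have h1 : Gd ⊆ Y.filter (fun y => ∀ i, T v (y i)) ∪ (Tup Q D \ Y) := by
            intro y hy
            rw [mem_filter] at hy
            rw [mem_union, mem_filter, mem_sdiff]
            tauto
          have h2 := (card_le_card h1).trans (card_union_le _ _)
          have h3 : (Gd.card : ℝ) ≤ (Y.filter (fun y => ∀ i, T v (y i))).card + (Tup Q D \ Y).card := by
            exact_mod_cast h2
          linarith [hAll K hK]
        have hfin : q1 ^ D / 2 * Y.card ≤ (Y.filter (fun y => ∀ i, T v (y i))).card := by
          have h1 : q1 ^ D / 2 * Y.card ≤ q1 ^ D / 2 * N :=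
            mul_le_mul_of_nonneg_left (hYle K) (by positivity)
          have h2 : ξ * N ≤ q1 ^ D / 2 * N := mul_le_mul_of_nonneg_right hξ1 hN0.le
          linarith
        have hsum : ∑ y ∈ Y, (if ∀ i, T v (y i) then (1/2 : ℝ) else 1) =
            Y.card - (Y.filter (fun y => ∀ i, T v (y i))).card / 2 := by
          have h1 : ∀ y ∈ Y, (if ∀ i, T v (y i) then (1/2 : ℝ) else 1) =
              1 - (if ∀ i, T v (y i) then (1/2 : ℝ) else 0) := by
            intro y _; split_ifs <;> norm_num
          rw [Finset.sum_congr rfl h1, Finset.sum_sub_distrib, ← Finset.sum_filter]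
          simp only [sum_const, nsmul_eq_mul]
          ring
        rw [hsum]
        linarith
      · simp only [Sum.elim_inr]
        rw [hJJ, inr_mem_disjSum, hHH, mem_filter, mem_product, mem_powerset, mem_powerset] at hj
        by_cases hxp : x ∈ p.1
        · simp only [hxp, true_and, if_true]
          have hb := tup_bad_card T P Q e q hq0.le hq1 he.le hT D p.2 hj.1.2 hj.2.2
          have hpos : (0:ℝ) < q ^ D * p.2.card := lt_of_lt_of_le he hj.2.2
          have hsum : ∑ y ∈ Y, (if ∃ v ∈ p.2, ∀ i, T v (y i) then (0:ℝ) else 1) ≤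
              (((Tup Q D).filter (fun y => ((p.2.filter (fun b => ∀ j, T b (y j))).card : ℝ) <
                q ^ D * p.2.card)).card : ℝ) := by
            have h1 : ∀ y ∈ Y, (if ∃ v ∈ p.2, ∀ i, T v (y i) then (0:ℝ) else 1) =
                if ¬ (∃ v ∈ p.2, ∀ i, T v (y i)) then (1:ℝ) else 0 := by
              intro y _; split_ifs <;> simp_all
            rw [Finset.sum_congr rfl h1, ← Finset.sum_filter]
            simp only [sum_const, nsmul_eq_mul, mul_one]
            apply Nat.cast_le.2
            apply card_le_card
            intro y hy
            rw [mem_filter] at hy ⊢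
            refine ⟨hYsub K hy.1, ?_⟩
            have : p.2.filter (fun b => ∀ j, T b (y j)) = ∅ := by
              rw [Finset.filter_eq_empty_iff]
              intro v hv hall
              exact hy.2 ⟨v, hv, hall⟩
            rw [this]
            simpa using hpos
          refine hsum.trans ?_
          have h3 : (((Tup Q D).filter (fun y => ((p.2.filter (fun b => ∀ j, T b (y j))).card : ℝ) <
                q ^ D * p.2.card)).card : ℝ) ≤ D * e * N / Q.card := by
            rw [le_div_iff₀ hQr]; exact hb
          refine h3.trans ?_
          calc D * e * N / Q.card = η * (N / 2) := by rw [hηdef]; field_simp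
            _ ≤ _ := mul_le_mul_of_nonneg_left (hYge K hK) hη0
        · simp [hxp])
    (fun j => Sum.elim (fun _ => 2 ^ t) (fun _ => 1) j)
    (by rintro (v | p) <;> simp)
  have hRHS : ∑ j ∈ JJ, (Sum.elim (fun _ => (2:ℝ) ^ t) (fun _ => 1) j) *
      ∏ x ∈ I, (Sum.elim (fun _ => 1 - q1 ^ D / 4) (fun p => if x ∈ p.1 then η else 1) j) < 1 := by
    refine lt_of_le_of_lt ?_ hnum
    rw [hJJ, Finset.sum_disjSum]
    simp only [Sum.elim_inl, Sum.elim_inr, one_mul, prod_const, sum_const, nsmul_eq_mul]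
    gcongr
    have h1 : ∀ p ∈ HH, ∏ x ∈ I, (if x ∈ p.1 then η else 1) ≤ η ^ s1 := by
      intro p hp
      rw [hHH, mem_filter, mem_product, mem_powerset, mem_powerset] at hp
      rw [Finset.prod_ite]
      simp only [prod_const, one_pow, mul_one]
      have : I.filter (fun x => x ∈ p.1) = p.1 := by
        ext x; simp only [mem_filter]; exact ⟨fun h => h.2, fun h => ⟨hp.1.1 h, h⟩⟩
      rw [this]
      exact pow_le_pow_of_le_one hη0 hη hp.2.1
    refine (Finset.sum_le_sum h1).trans ?_
    rw [sum_const, nsmul_eq_mul]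
    gcongr
    have h2 : HH.card ≤ 2 ^ (I.card + P.card) := by
      refine (card_le_card (filter_subset _ _)).trans ?_
      rw [card_product, card_powerset, card_powerset, pow_add]
    exact_mod_cast h2
  have hlt := lt_of_le_of_lt hg3 hRHS
  have hterm : ∀ j ∈ JJ, (Sum.elim (fun _ => (2:ℝ) ^ t) (fun _ => 1) j) *
      ∏ x ∈ I, (Sum.elim (fun v => if ∀ i, T v (g x i) then (1/2 : ℝ) else 1)
      (fun p => if x ∈ p.1 ∧ ∃ v ∈ p.2, ∀ i, T v (g x i) then 0 else 1) j) < 1 := by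
    intro j hj
    refine lt_of_le_of_lt ?_ hlt
    apply Finset.single_le_sum (f := fun j : V ⊕ (Finset X × Finset V) =>
      (Sum.elim (fun _ => (2:ℝ) ^ t) (fun _ => 1) j) *
      ∏ x ∈ I, (Sum.elim (fun v => if ∀ i, T v (g x i) then (1/2 : ℝ) else 1)
      (fun p => if x ∈ p.1 ∧ ∃ v ∈ p.2, ∀ i, T v (g x i) then 0 else 1) j)) _ hj
    rintro (v | p) _
    · apply mul_nonneg
      · simp
      · apply Finset.prod_nonneg; intro x _; simp only [Sum.elim_inl]; split_ifs <;> norm_num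
    · apply mul_nonneg
      · simp
      · apply Finset.prod_nonneg; intro x _; simp only [Sum.elim_inr]; split_ifs <;> norm_num
  refine ⟨g, ?_, ?_, ?_, ?_, ?_⟩
  · intro x hx j
    have := mem_filter.1 (hg1 x hx)
    exact ⟨(mem_Tup _ _ _).1 this.1 j, this.2.1 j⟩
  · intro x hx x' hx' j j' hjj
    by_cases hxx : x = x'
    · subst hxx
      exact ⟨rfl, (mem_filter.1 (hg1 x hx)).2.2.1 j j' hjj⟩
    · exact absurd ((hconf _ _).2 ⟨j, j', hjj⟩) (hg2 x hx x' hx' hxx)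
  · intro x hx
    exact (mem_filter.1 (hg1 x hx)).2.2.2
  · intro v hv
    by_contra hcon
    push Not at hcon
    have h1 := hterm (Sum.inl v) (by rw [hJJ, inl_mem_disjSum]; exact hv)
    simp only [Sum.elim_inl] at h1
    rw [Finset.prod_ite] at h1
    simp only [prod_const, one_pow, mul_one] at h1
    have h3 : (1:ℝ) ≤ 2 ^ t * (1/2) ^ (I.filter (fun x => ∀ j, T v (g x j))).card := by
      have : ((1:ℝ)/2) ^ t ≤ (1/2) ^ (I.filter (fun x => ∀ j, T v (g x j))).card :=
        pow_le_pow_of_le_one (by norm_num) (by norm_num) hcon.le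
      calc (1:ℝ) = 2 ^ t * (1/2) ^ t := by rw [← mul_pow]; norm_num
        _ ≤ _ := mul_le_mul_of_nonneg_left this (by positivity)
    linarith
  · intro S hS B hB hs hb
    by_contra hcon
    push Not at hcon
    have h1 := hterm (Sum.inr (S, B)) (by
      rw [hJJ, inr_mem_disjSum, hHH, mem_filter, mem_product, mem_powerset, mem_powerset]
      exact ⟨⟨hS, hB⟩, hs, hb⟩)
    simp only [Sum.elim_inr, one_mul] at h1
    have h2 : ∏ x ∈ I, (if x ∈ S ∧ ∃ v ∈ B, ∀ i, T v (g x i) then (0:ℝ) else 1) = 1 := by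
      apply Finset.prod_eq_one
      intro x _
      rw [if_neg]
      rintro ⟨hxS, v, hv, hall⟩
      obtain ⟨j, hj⟩ := hcon x hxS v hv
      exact hj (hall j)
    rw [h2] at h1
    exact lt_irrefl _ h1


/-- edges of `H` as a finset -/
noncomputable def EH {W : Type*} [Fintype W] (H : SimpleGraph W) : Finset (Sym2 W) :=
  (univ : Finset (Sym2 W)).filter (fun e => e ∈ H.edgeSet)

lemma mem_EH {W : Type*} [Fintype W] (H : SimpleGraph W) (e : Sym2 W) :
    e ∈ EH H ↔ e ∈ H.edgeSet := by simp [EH]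

lemma mem_EH_mk {W : Type*} [Fintype W] (H : SimpleGraph W) (x y : W) :
    s(x, y) ∈ EH H ↔ H.Adj x y := by simp [EH]

/-- colour `c` is valid for edge `e` under `τ` -/
def Val {V C W : Type*} (G : C → SimpleGraph V) (τ : W → V) (c : C) (e : Sym2 W) : Prop :=
  e.map τ ∈ (G c).edgeSet

lemma Val_mk {V C W : Type*} (G : C → SimpleGraph V) (τ : W → V) (c : C) (x y : W) :
    Val G τ c s(x, y) ↔ (G c).Adj (τ x) (τ y) := by simp [Val]

lemma Val_congr {V C W : Type*} (G : C → SimpleGraph V) (τ τ' : W → V) (c : C) (e : Sym2 W)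
    (h : ∀ x ∈ e, τ x = τ' x) : Val G τ c e ↔ Val G τ' c e := by
  induction e using Sym2.ind with
  | _ x y =>
    rw [Val_mk, Val_mk, h x (by simp), h y (by simp)]

/-- edges touching a set -/
lemma card_touch {W : Type*} [Fintype W] (H : SimpleGraph W) (Δ : ℕ) (hdeg : ∀ w, degOf H w ≤ Δ)
    (S : Finset W) : ((EH H).filter (fun e => ∃ x ∈ e, x ∈ S)).card ≤ S.card * Δ := by
  have hsub : (EH H).filter (fun e => ∃ x ∈ e, x ∈ S) ⊆
      S.biUnion (fun x => ((univ : Finset W).filter (fun w => H.Adj x w)).image (fun w => s(x, w))) := by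
    intro e he
    rw [mem_filter] at he
    obtain ⟨he, x, hxe, hxS⟩ := he
    obtain ⟨y, rfl⟩ := Sym2.mem_iff_exists.1 hxe
    rw [mem_EH_mk] at he
    rw [mem_biUnion]
    exact ⟨x, hxS, mem_image.2 ⟨y, by simp [he], rfl⟩⟩
  refine (card_le_card hsub).trans ?_
  apply card_biUnion_le_card_mul
  intro x _
  exact card_image_le.trans (hdeg x)

/-- neighbourhood of a set -/
noncomputable def NS {W : Type*} [Fintype W] (H : SimpleGraph W) (S : Finset W) : Finset W :=
  univ.filter (fun z => ∃ x ∈ S, H.Adj x z)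

lemma mem_NS {W : Type*} [Fintype W] (H : SimpleGraph W) (S : Finset W) (z : W) :
    z ∈ NS H S ↔ ∃ x ∈ S, H.Adj x z := by simp [NS]

lemma card_NS {W : Type*} [Fintype W] (H : SimpleGraph W) (Δ : ℕ) (hdeg : ∀ w, degOf H w ≤ Δ)
    (S : Finset W) : (NS H S).card ≤ S.card * Δ := by
  have hsub : NS H S ⊆ S.biUnion (fun x => (univ : Finset W).filter (fun w => H.Adj x w)) := by
    intro z hz
    rw [mem_NS] at hz
    obtain ⟨x, hx, hxz⟩ := hz
    rw [mem_biUnion]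
    exact ⟨x, hx, by simp [hxz]⟩
  refine (card_le_card hsub).trans ?_
  apply card_biUnion_le_card_mul
  intro x _
  exact hdeg x

/-- Final assembly. -/
lemma assemble {V C W : Type*} [Fintype W] [Nonempty C] (G : C → SimpleGraph V) (H : SimpleGraph W)
    (τ : W → V) (hτ : Function.Injective τ) (B : Finset C) (Efl EA EAf Ecol : Finset (Sym2 W))
    (hcover : ∀ e ∈ H.edgeSet, e ∈ Efl ∨ e ∈ EA ∨ e ∈ Ecol)
    (σ0 : Sym2 W → C) (hσ0 : Set.InjOn σ0 Ecol) (hσ1 : ∀ e ∈ Ecol, σ0 e ∉ B ∧ Val G τ (σ0 e) e)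
    (hfl : ∀ e ∈ Efl, Efl.card ≤ (B.filter (fun c => Val G τ c e)).card)
    (hEA : EA ⊆ EAf) (hcnt : EA.card + Efl.card = B.card) (hcnt2 : EAf.card = B.card) (lam : ℝ)
    (hlam : (Efl.card : ℝ) ≤ lam)
    (hA : ∀ e ∈ EAf, 2 * lam ≤ ((B.filter (fun c => Val G τ c e)).card : ℝ))
    (hB : ∀ c ∈ B, 2 * lam ≤ ((EAf.filter (fun e => Val G τ c e)).card : ℝ))
    (hole : ∀ S ⊆ EAf, ∀ T ⊆ B, lam ≤ (S.card : ℝ) → lam ≤ (T.card : ℝ) →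
      ∃ e ∈ S, ∃ c ∈ T, Val G τ c e) : HasTransversal G H := by
  obtain ⟨σ1, h1i, h1m⟩ := list_choice Efl (fun e => B.filter (fun c => Val G τ c e)) hfl
  set B2 := B \ Efl.image σ1 with hB2
  have himg : (Efl.image σ1).card = Efl.card := card_image_of_injOn h1i
  have himgB : Efl.image σ1 ⊆ B := by
    intro c hc
    obtain ⟨e, he, rfl⟩ := mem_image.1 hc
    exact (mem_filter.1 (h1m e he)).1
  have hB2c : B2.card + Efl.card = B.card := by
    rw [← himg]; exact card_sdiff_add_card_eq_card himgB
  obtain ⟨σ2, h2i, h2m⟩ := hall_super (fun e c => Val G τ c e) EA B2 lam (by omega)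
    (by
      intro e he
      have h1 := hA e (hEA he)
      have h2 : (B.filter (fun c => Val G τ c e)) ⊆ (B2.filter (fun c => Val G τ c e)) ∪ Efl.image σ1 := by
        intro c hc
        rw [mem_filter] at hc
        rw [mem_union, mem_filter, hB2, mem_sdiff]
        tauto
      have h3 : ((B.filter (fun c => Val G τ c e)).card : ℝ) ≤
          (B2.filter (fun c => Val G τ c e)).card + Efl.card := by
        have := (card_le_card h2).trans (card_union_le _ _)
        rw [himg] at this
        exact_mod_cast this
      linarith)
    (by
      intro c hc
      have h1 := hB c (mem_sdiff.1 hc).1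
      have h2 : (EAf.filter (fun e => Val G τ c e)) ⊆ (EA.filter (fun e => Val G τ c e)) ∪ (EAf \ EA) := by
        intro c hc
        rw [mem_filter] at hc
        rw [mem_union, mem_filter, mem_sdiff]
        tauto
      have h4 : (EAf \ EA).card = Efl.card := by
        have := card_sdiff_add_card_eq_card hEA
        omega
      have h3 : ((EAf.filter (fun e => Val G τ c e)).card : ℝ) ≤
          (EA.filter (fun e => Val G τ c e)).card + Efl.card := by
        have := (card_le_card h2).trans (card_union_le _ _)
        rw [h4] at this
        exact_mod_cast this
      linarith)
    (fun S hS T hT h1 h2 => hole S (hS.trans hEA) T (hT.trans sdiff_subset) h1 h2)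
  refine ⟨τ, fun e => if e ∈ Ecol then σ0 e else if e ∈ Efl then σ1 e else σ2 e, hτ, ?_, ?_⟩
  · intro e he e' he' hee
    have hE1 : ∀ e ∈ Efl, σ1 e ∈ B := fun e he => (mem_filter.1 (h1m e he)).1
    have hE2 : ∀ e ∈ EA, σ2 e ∈ B2 := fun e he => (h2m e he).1
    have hE2' : ∀ e ∈ EA, σ2 e ∈ B := fun e he => (mem_sdiff.1 (h2m e he).1).1
    have hx : ∀ e ∈ Efl, ∀ e' ∈ EA, σ1 e ≠ σ2 e' := by
      intro e he e' he' h
      have := (mem_sdiff.1 (hE2 e' he')).2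
      exact this (h ▸ mem_image_of_mem σ1 he)
    have c1 := hcover e he
    have c2 := hcover e' he'
    simp only at hee
    by_cases a1 : e ∈ Ecol <;> by_cases a2 : e' ∈ Ecol <;> by_cases b1 : e ∈ Efl <;>
      by_cases b2 : e' ∈ Efl <;> simp only [a1, a2, b1, b2, if_true, if_false, or_true, true_or,
        false_or, or_false] at hee c1 c2
    all_goals first
      | exact hσ0 a1 a2 hee
      | exact h1i b1 b2 hee
      | exact h2i c1 c2 hee
      | exact absurd (hee ▸ hE1 _ b2) (hσ1 e a1).1
      | exact absurd (hee ▸ hE2' _ c2) (hσ1 e a1).1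
      | exact absurd (hee ▸ hE1 _ b1) (hσ1 e' a2).1
      | exact absurd (hee ▸ hE2' _ c1) (hσ1 e' a2).1
      | exact absurd hee (hx _ b1 _ c2)
      | exact absurd hee.symm (hx _ b2 _ c1)
  · intro x y hxy
    rw [← Val_mk]
    beta_reduce
    have c1 := hcover s(x, y) (by simpa using hxy)
    by_cases a1 : s(x, y) ∈ Ecol
    · rw [if_pos a1]; exact (hσ1 _ a1).2
    · rw [if_neg a1]
      by_cases b1 : s(x, y) ∈ Efl
      · rw [if_pos b1]; exact (mem_filter.1 (h1m _ b1)).2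
      · rw [if_neg b1]
        have : s(x, y) ∈ EA := by tauto
        exact (h2m _ this).2

/-- State of the partial embedding. -/
structure Good {V C W : Type*} (G : C → SimpleGraph V) (part : W → Bool) (Vs : Bool → Finset V)
    (T1 : V → V → Prop) (B : Finset C) (Efl Ecol : Finset (Sym2 W)) (S : Finset W) (τ : W → V)
    (σ : Sym2 W → C) : Prop where
  inj : Set.InjOn τ S
  mem : ∀ z ∈ S, τ z ∈ Vs (part z)
  fl : ∀ x ∈ S, ∀ y ∈ S, s(x, y) ∈ Efl → T1 (τ x) (τ y)
  cinj : Set.InjOn σ {e | e ∈ Ecol ∧ ∀ x ∈ e, x ∈ S}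
  cval : ∀ e ∈ Ecol, (∀ x ∈ e, x ∈ S) → σ e ∉ B ∧ Val G τ (σ e) e

/-- Extension by a set `L` with given colours. -/
lemma Good.extend {V C W : Type*} {G : C → SimpleGraph V} {part : W → Bool}
    {Vs : Bool → Finset V} {T1 : V → V → Prop} {B : Finset C} {Efl Ecol : Finset (Sym2 W)}
    {S : Finset W} {τ : W → V} {σ : Sym2 W → C}
    (hg : Good G part Vs T1 B Efl Ecol S τ σ) (hT1 : ∀ u v, T1 u v → T1 v u) (L : Finset W)
    (hSL : Disjoint S L)
    (τL : W → V) (hinj : Set.InjOn τL L) (hmem : ∀ z ∈ L, τL z ∈ Vs (part z))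
    (hnew : ∀ z ∈ L, ∀ y ∈ S, τL z ≠ τ y)
    (hfl1 : ∀ z ∈ L, ∀ y ∈ S, s(z, y) ∈ Efl → T1 (τL z) (τ y))
    (hfl2 : ∀ z ∈ L, ∀ y ∈ L, s(z, y) ∈ Efl → T1 (τL z) (τL y))
    (σL : Sym2 W → C)
    (hσi : ∀ e ∈ Ecol, ∀ e' ∈ Ecol, (∀ x ∈ e, x ∈ S ∪ L) → (∀ x ∈ e', x ∈ S ∪ L) →
      (∃ x ∈ e, x ∈ L) → (∃ x ∈ e', x ∈ L) → σL e = σL e' → e = e')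
    (hσn : ∀ e ∈ Ecol, (∀ x ∈ e, x ∈ S ∪ L) → (∃ x ∈ e, x ∈ L) →
      σL e ∉ B ∧ Val G (fun z => if z ∈ L then τL z else τ z) (σL e) e ∧
      ∀ e' ∈ Ecol, (∀ x ∈ e', x ∈ S) → σ e' ≠ σL e) :
    Good G part Vs T1 B Efl Ecol (S ∪ L) (fun z => if z ∈ L then τL z else τ z)
      (fun e => if ∃ x ∈ e, x ∈ L then σL e else σ e) := by
  have hS : ∀ z ∈ S, z ∉ L := fun z hz hz' => disjoint_left.1 hSL hz hz'
  have hin : ∀ e : Sym2 W, (∀ x ∈ e, x ∈ S ∪ L) → (¬ ∃ x ∈ e, x ∈ L) → ∀ x ∈ e, x ∈ S := by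
    intro e h1 h2 x hx
    rcases mem_union.1 (h1 x hx) with h | h
    · exact h
    · exact absurd ⟨x, hx, h⟩ h2
  refine ⟨?_, ?_, ?_, ?_, ?_⟩
  · intro x hx y hy hxy
    simp only at hxy
    rw [mem_coe, mem_union] at hx hy
    by_cases a : x ∈ L <;> by_cases b : y ∈ L <;> simp only [a, b, if_true, if_false, or_false] at hxy hx hy
    · exact hinj a b hxy
    · exact absurd hxy (hnew x a y hy)
    · exact absurd hxy.symm (hnew y b x hx)
    · exact hg.inj hx hy hxy
  · intro z hz
    by_cases a : z ∈ L
    · simp only [a, if_true]; exact hmem z a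
    · simp only [a, if_false]; exact hg.mem z ((mem_union.1 hz).resolve_right a)
  · intro x hx y hy hxy
    rw [mem_union] at hx hy
    by_cases a : x ∈ L <;> by_cases b : y ∈ L <;> simp only [a, b, if_true, if_false, or_false] at hx hy ⊢
    · exact hfl2 x a y b hxy
    · exact hfl1 x a y hy hxy
    · exact hT1 _ _ (hfl1 y b x hx (by rwa [Sym2.eq_swap]))
    · exact hg.fl x hx y hy hxy
  · rintro e ⟨he, heS⟩ e' ⟨he', heS'⟩ hee
    simp only at hee
    by_cases a : ∃ x ∈ e, x ∈ L <;> by_cases b : ∃ x ∈ e', x ∈ L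
    · rw [if_pos a, if_pos b] at hee
      exact hσi e he e' he' heS heS' a b hee
    · rw [if_pos a, if_neg b] at hee
      exact absurd hee.symm ((hσn e he heS a).2.2 e' he' (hin e' heS' b))
    · rw [if_neg a, if_pos b] at hee
      exact absurd hee ((hσn e' he' heS' b).2.2 e he (hin e heS a))
    · rw [if_neg a, if_neg b] at hee
      exact hg.cinj ⟨he, hin e heS a⟩ ⟨he', hin e' heS' b⟩ hee
  · intro e he heS
    by_cases a : ∃ x ∈ e, x ∈ L
    · rw [if_pos a]
      exact ⟨(hσn e he heS a).1, (hσn e he heS a).2.1⟩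
    · rw [if_neg a]
      have h1 := hg.cval e he (hin e heS a)
      refine ⟨h1.1, ?_⟩
      rw [Val_congr G _ τ]
      · exact h1.2
      · intro x hx
        rw [if_neg]
        exact fun h => a ⟨x, hx, h⟩

/-- Extension by a set `L`, choosing colours from lists. -/
lemma Good.extend_list {V C W : Type*} [Nonempty C] {G : C → SimpleGraph V} {part : W → Bool}
    {Vs : Bool → Finset V} {T1 : V → V → Prop} {B : Finset C} {Efl Ecol : Finset (Sym2 W)}
    {S : Finset W} {τ : W → V} {σ : Sym2 W → C}
    (hg : Good G part Vs T1 B Efl Ecol S τ σ) (hT1 : ∀ u v, T1 u v → T1 v u) (L : Finset W)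
    (hSL : Disjoint S L)
    (τL : W → V) (hinj : Set.InjOn τL L) (hmem : ∀ z ∈ L, τL z ∈ Vs (part z))
    (hnew : ∀ z ∈ L, ∀ y ∈ S, τL z ≠ τ y)
    (hfl1 : ∀ z ∈ L, ∀ y ∈ S, s(z, y) ∈ Efl → T1 (τL z) (τ y))
    (hfl2 : ∀ z ∈ L, ∀ y ∈ L, s(z, y) ∈ Efl → T1 (τL z) (τL y))
    (D : Finset C) (hDB : Disjoint D B)
    (hD : ∀ e' ∈ Ecol, (∀ x ∈ e', x ∈ S) → σ e' ∉ D)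
    (E' : Finset (Sym2 W))
    (hE' : ∀ e ∈ Ecol, (∀ x ∈ e, x ∈ S ∪ L) → (∃ x ∈ e, x ∈ L) → e ∈ E')
    (hlist : ∀ e ∈ Ecol, (∀ x ∈ e, x ∈ S ∪ L) → (∃ x ∈ e, x ∈ L) → E'.card ≤ (D.filter (fun c => Val G (fun z => if z ∈ L then τL z else τ z) c e)).card) :
    ∃ σ', Good G part Vs T1 B Efl Ecol (S ∪ L) (fun z => if z ∈ L then τL z else τ z) σ' := by
  obtain ⟨σL, h1, h2⟩ := list_choice (Ecol.filter (fun e => (∀ x ∈ e, x ∈ S ∪ L) ∧ ∃ x ∈ e, x ∈ L))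
    (fun e => D.filter (fun c => Val G (fun z => if z ∈ L then τL z else τ z) c e))
    (fun e he => (card_le_card (fun e he => hE' e (mem_filter.1 he).1 (mem_filter.1 he).2.1
      (mem_filter.1 he).2.2)).trans
      (hlist e (mem_filter.1 he).1 (mem_filter.1 he).2.1 (mem_filter.1 he).2.2))
  refine ⟨_, hg.extend hT1 L hSL τL hinj hmem hnew hfl1 hfl2 σL ?_ ?_⟩
  · intro e he e' he' a a' b b' hee
    exact h1 (by rw [mem_coe, mem_filter]; exact ⟨he, a, b⟩) (by rw [mem_coe, mem_filter]; exact ⟨he', a', b'⟩) hee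
  · intro e he a b
    have h3 := mem_filter.1 (h2 e (mem_filter.2 ⟨he, a, b⟩))
    refine ⟨fun h => disjoint_left.1 hDB h3.1 h, h3.2, ?_⟩
    intro e' he' hS h
    exact hD e' he' hS (h ▸ h3.1)


/-- The data handed over to the second half of the embedding. -/
structure Dat (V C W : Type*) where
  G : C → SimpleGraph V
  H : SimpleGraph W
  part : W → Bool
  Vs : Bool → Finset V
  B : Finset C
  X : Finset W
  Q : Finset W
  F : Finset W
  I : Finset W
  GF : Finset W
  EA : Finset (Sym2 W)
  EAf : Finset (Sym2 W)
  nb : W → W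
  lab : W → Finset W
  τ0 : W → V
  R : Bool → Finset V
  Δ : ℕ
  k : ℕ
  Mx : ℕ
  t : ℕ
  θ1 : ℝ
  e : ℝ
  q : ℝ
  c0 : ℝ
  lamI : ℝ
  lam : ℝ

namespace Dat

set_option linter.unusedSectionVars false

variable {V C W : Type*} [Fintype C] [Fintype W]

/-- flexible edges -/
noncomputable def Efl (D : Dat V C W) : Finset (Sym2 W) :=
  (EH D.H).filter (fun e => (∃ x ∈ e, x ∈ D.X ∨ x ∈ D.I ∨ x ∈ NS D.H D.I) ∨
    ((∀ x ∈ e, x ∈ D.F) ∧ ∀ x ∈ D.GF, e ≠ s(x, D.nb x)))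

/-- edges coloured along the way -/
noncomputable def Ecol (D : Dat V C W) : Finset (Sym2 W) := (EH D.H \ D.Efl) \ D.EA

/-- the reduced thick graph -/
def T1 (D : Dat V C W) : V → V → Prop := Thick D.G D.B D.θ1

/-- initial domain -/
noncomputable def S0 (D : Dat V C W) : Finset W := D.X ∪ (D.Q \ D.I)

/-- good partial embeddings -/
def Gd (D : Dat V C W) (S : Finset W) (τ : W → V) (σ : Sym2 W → C) : Prop :=
  Good D.G D.part D.Vs D.T1 D.B D.Efl D.Ecol S τ σ

/-- Everything needed of the first half. -/
structure Ok (D : Dat V C W) : Prop where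
  hbip : ∀ x y, D.H.Adj x y → D.part y = !(D.part x)
  hΔ : 1 ≤ D.Δ
  hdeg : ∀ w, degOf D.H w ≤ D.Δ
  hVs : Disjoint (D.Vs false) (D.Vs true)
  hcard : ∀ i, ((univ : Finset W).filter (fun w => D.part w = i)).card = (D.Vs i).card
  hEH : (EH D.H).card = Fintype.card C
  he : 0 < D.e
  hq0 : 0 ≤ D.q
  hq1 : D.q ≤ 1
  hT1 : Typ D.T1 D.Vs D.e D.q
  hTD : ∀ K : Finset C, D.k ≤ K.card → Typ (Thick D.G K (D.q * K.card)) D.Vs D.e D.q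
  hXQ : Disjoint D.X D.Q
  hXF : Disjoint D.X D.F
  hQF : Disjoint D.Q D.F
  hQ : ∀ x ∈ D.Q, ∀ y, D.H.Adj x y → y ∈ D.Q ∨ y ∈ D.X
  hF : ∀ x ∈ D.F, ∀ y, D.H.Adj x y → y ∈ D.F ∨ y ∈ D.X
  hIQ : D.I ⊆ D.Q
  hNI : ∀ x ∈ D.I, ∀ y, D.H.Adj x y → y ∈ D.Q ∧ y ∉ D.I
  hlab : ∀ x y, D.H.Adj x y → x ∉ D.X → y ∉ D.X → D.lab x = D.lab y
  hMx : ∀ l, ((univ : Finset W).filter (fun w => w ∉ D.X ∧ D.lab w = l)).card ≤ D.Mx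
  hGF : D.GF ⊆ D.F
  hGFc : D.GF.card = D.k
  hnbF : ∀ x ∈ D.GF, D.nb x ∈ D.F
  hnbadj : ∀ x ∈ D.GF, D.H.Adj x (D.nb x)
  hGFp : ∀ x ∈ D.GF, D.part x = false
  hGF1 : ∀ x ∈ D.GF, ∀ x' ∈ D.GF, D.H.Adj x (D.nb x') → x = x'
  hGF2 : ∀ z, ∀ p ∈ D.GF ∪ D.GF.image D.nb, ∀ p' ∈ D.GF ∪ D.GF.image D.nb,
    D.H.Adj z p → D.H.Adj z p' → p = p'
  hGF3 : ∀ z, ∀ p ∈ D.GF ∪ D.GF.image D.nb, ∀ x ∈ D.X, D.H.Adj z p → ¬ D.H.Adj z x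
  hEAf : D.EAf ⊆ EH D.H
  hEAQ : ∀ e ∈ D.EAf, ∀ x ∈ e, x ∈ D.Q ∧ x ∉ D.I
  hEAfl : Disjoint D.EAf D.Efl
  hEA : D.EA ⊆ D.EAf
  hEAc : D.EA.card + D.Efl.card = D.B.card
  hEAfc : D.EAf.card = D.B.card
  hτinj : Set.InjOn D.τ0 D.S0
  hτmem : ∀ z ∈ D.S0, D.τ0 z ∈ D.Vs (D.part z)
  hτfl : ∀ x ∈ D.S0, ∀ y ∈ D.S0, s(x, y) ∈ D.Efl → D.T1 (D.τ0 x) (D.τ0 y)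
  hτcol : ∀ e ∈ D.Ecol, (∀ x ∈ e, x ∈ D.S0) →
    D.Q.card * D.Δ ≤ (D.Bᶜ.filter (fun c => Val D.G D.τ0 c e)).card
  hR : ∀ i, D.R i ⊆ D.Vs i
  hRτ : ∀ z ∈ D.S0, ∀ i, D.τ0 z ∉ D.R i
  hRI : ∀ i, D.c0 + (D.R i).card ≤ ((D.I.filter (fun x => D.part x = i)).card : ℝ)
  h1 : ∀ z, z ∉ D.X → D.t ≤ ((D.R (D.part z)).filter
    (fun v => ∀ x ∈ D.X, D.H.Adj z x → D.T1 v (D.τ0 x))).card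
  h2 : ∀ z ∈ D.I, D.t ≤ ((D.R (D.part z)).filter (fun v => ∀ y, D.H.Adj z y → D.T1 v (D.τ0 y))).card
  h3 : ∀ i, ∀ v ∈ D.Vs i, v ∉ D.S0.image D.τ0 → D.t ≤ ((D.R (!i)).filter (fun u => D.T1 v u)).card
  h4 : ∀ c, D.t ≤ ((D.R false).filter
    (fun u => D.t ≤ ((D.R true).filter (fun w => (D.G c).Adj u w)).card)).card
  h5 : ∀ i, ∀ v ∈ D.Vs i, v ∉ D.S0.image D.τ0 →
    D.lamI ≤ (((D.I.filter (fun x => D.part x = i)).filter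
      (fun x => ∀ y, D.H.Adj x y → D.T1 v (D.τ0 y))).card : ℝ)
  h6 : ∀ i, ∀ S ⊆ D.I.filter (fun x => D.part x = i), ∀ U ⊆ D.Vs i, D.lamI ≤ (S.card : ℝ) →
    D.lamI ≤ (U.card : ℝ) → ∃ x ∈ S, ∃ v ∈ U, ∀ y, D.H.Adj x y → D.T1 v (D.τ0 y)
  hc0 : 0 ≤ D.c0
  hn1 : D.c0 + D.X.card * D.Δ + 2 * D.k ≤ D.t
  hn2 : (D.Mx : ℝ) + D.Δ * D.e < D.q ^ D.Δ * D.c0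
  hn3 : (D.F.card : ℝ) + D.Δ * D.e < D.q ^ D.Δ * D.c0
  hn4 : (D.Mx * D.Δ : ℝ) ≤ D.q * D.k
  hn5 : D.X.card * D.Δ + D.k ≤ D.t
  hn6 : D.lamI + D.X.card * D.Δ + D.F.card ≤ D.t
  hfl1 : (D.Efl.card : ℝ) ≤ D.θ1
  hfl2 : (D.Efl.card : ℝ) ≤ D.lam
  hA : ∀ e ∈ D.EAf, 2 * D.lam ≤ ((D.B.filter (fun c => Val D.G D.τ0 c e)).card : ℝ)
  hB : ∀ c ∈ D.B, 2 * D.lam ≤ ((D.EAf.filter (fun e => Val D.G D.τ0 c e)).card : ℝ)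
  hole : ∀ S ⊆ D.EAf, ∀ K ⊆ D.B, D.lam ≤ (S.card : ℝ) → D.lam ≤ (K.card : ℝ) →
      ∃ e ∈ S, ∃ c ∈ K, Val D.G D.τ0 c e

variable {D : Dat V C W}

lemma T1_symm (D : Dat V C W) (u v : V) (h : D.T1 u v) : D.T1 v u := Thick.symm h

lemma Ok.part_eq (ok : D.Ok) {v : V} {i j : Bool} (hi : v ∈ D.Vs i) (hj : v ∈ D.Vs j) : i = j := by
  have hd := ok.hVs
  rw [disjoint_left] at hd
  cases i <;> cases j
  · rfl
  · exact absurd hj (hd hi)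
  · exact absurd hi (hd hj)
  · rfl

lemma mem_Efl (D : Dat V C W) (e : Sym2 W) : e ∈ D.Efl ↔ e ∈ D.H.edgeSet ∧
    ((∃ x ∈ e, x ∈ D.X ∨ x ∈ D.I ∨ x ∈ NS D.H D.I) ∨
    ((∀ x ∈ e, x ∈ D.F) ∧ ∀ x ∈ D.GF, e ≠ s(x, D.nb x))) := by
  rw [Efl, mem_filter, mem_EH]

lemma mem_Ecol (D : Dat V C W) (e : Sym2 W) : e ∈ D.Ecol ↔ e ∈ D.H.edgeSet ∧ e ∉ D.Efl ∧ e ∉ D.EA := by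
  rw [Ecol, mem_sdiff, mem_sdiff, mem_EH, and_assoc]

lemma Ok.card_Ecol (ok : D.Ok) : D.Ecol.card = D.Bᶜ.card := by
  have h1 : D.Efl ⊆ EH D.H := filter_subset _ _
  have h2 : D.EA ⊆ EH D.H \ D.Efl := by
    intro e he
    rw [mem_sdiff]
    exact ⟨ok.hEAf (ok.hEA he), fun h => disjoint_left.1 ok.hEAfl (ok.hEA he) h⟩
  have h3 := card_sdiff_add_card_eq_card h1
  have h4 := card_sdiff_add_card_eq_card h2
  have h5 := ok.hEH
  have h6 := ok.hEAc
  have h7 := card_compl_add_card D.B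
  unfold Ecol
  omega

/-- classification of coloured edges -/
lemma Ok.col_cases (ok : D.Ok) {x y : W} (h : s(x, y) ∈ D.Ecol) :
    D.H.Adj x y ∧ x ∉ D.X ∧ y ∉ D.X ∧ x ∉ D.I ∧ y ∉ D.I ∧
    ((x ∈ D.F ∨ y ∈ D.F) → (x ∈ D.F ∧ y ∈ D.F ∧ ∃ z ∈ D.GF, s(x, y) = s(z, D.nb z))) := by
  rw [mem_Ecol, mem_Efl] at h
  obtain ⟨h1, h2, h3⟩ := h
  have hadj : D.H.Adj x y := by simpa using h1
  push Not at h2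
  have h2 := h2 h1
  have hx := h2.1 x (by simp)
  have hy := h2.1 y (by simp)
  refine ⟨hadj, hx.1, hy.1, hx.2.1, hy.2.1, ?_⟩
  intro hF
  have hxy : x ∈ D.F ∧ y ∈ D.F := by
    rcases hF with h | h
    · exact ⟨h, (ok.hF x h y hadj).resolve_right hy.1⟩
    · exact ⟨(ok.hF y h x hadj.symm).resolve_right hx.1, h⟩
  refine ⟨hxy.1, hxy.2, ?_⟩
  apply h2.2
  intro z hz
  rw [Sym2.mem_iff] at hz
  rcases hz with rfl | rfl
  · exact hxy.1
  · exact hxy.2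

lemma Ok.M_mem (ok : D.Ok) {x : W} (hxG : x ∈ D.GF) : s(x, D.nb x) ∈ D.Ecol := by
  have hadj := ok.hnbadj x hxG
  have hxF := ok.hGF hxG
  have hyF := ok.hnbF x hxG
  rw [mem_Ecol, mem_Efl]
  refine ⟨by simpa using hadj, ?_, ?_⟩
  · rintro ⟨-, h | h⟩
    · obtain ⟨z, hz, h⟩ := h
      have hzF : z ∈ D.F := by
        rw [Sym2.mem_iff] at hz
        rcases hz with rfl | rfl
        · exact hxF
        · exact hyF
      have hzQ : z ∉ D.Q := fun h => disjoint_left.1 ok.hQF h hzF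
      rcases h with h | h | h
      · exact disjoint_left.1 ok.hXF h hzF
      · exact hzQ (ok.hIQ h)
      · rw [mem_NS] at h
        obtain ⟨x, hx, hxz⟩ := h
        exact hzQ (ok.hNI x hx z hxz).1
    · exact h.2 x hxG rfl
  · intro h'
    have := (ok.hEAQ _ (ok.hEA h') x (by simp)).1
    exact disjoint_left.1 ok.hQF this hxF

/-- The set of coloured edges not yet inside `S` matches the unused colours. -/
lemma Ok.unused (ok : D.Ok) {S : Finset W} {τ : W → V} {σ : Sym2 W → C} (hg : D.Gd S τ σ) :
    (D.Bᶜ \ (D.Ecol.filter (fun e => ∀ x ∈ e, x ∈ S)).image σ).card =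
      (D.Ecol.filter (fun e => ¬ ∀ x ∈ e, x ∈ S)).card := by
  have h1 : (D.Ecol.filter (fun e => ∀ x ∈ e, x ∈ S)).image σ ⊆ D.Bᶜ := by
    intro c hc
    obtain ⟨e, he, rfl⟩ := mem_image.1 hc
    rw [mem_filter] at he
    rw [mem_compl]
    exact (hg.cval e he.1 he.2).1
  have h2 : ((D.Ecol.filter (fun e => ∀ x ∈ e, x ∈ S)).image σ).card =
      (D.Ecol.filter (fun e => ∀ x ∈ e, x ∈ S)).card := by
    apply card_image_of_injOn
    intro e he e' he' h
    rw [mem_coe, mem_filter] at he he'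
    exact hg.cinj he he' h
  have h3 := card_sdiff_add_card_eq_card h1
  have h4 := ok.card_Ecol
  have h5 := card_filter_add_card_filter_not (s := D.Ecol) (fun e => ∀ x ∈ e, x ∈ S)
  omega

end Dat


namespace Dat

set_option linter.unusedSectionVars false

variable {V C W : Type*} [Fintype C] [Fintype W] {D : Dat V C W}

lemma Ok.start (ok : D.Ok) [Nonempty C] [Nonempty V] : ∃ σ, D.Gd D.S0 D.τ0 σ := by
  obtain ⟨c⟩ := (inferInstance : Nonempty C)
  have h0 : D.Gd ∅ D.τ0 (fun _ => c) := by
    refine ⟨by simp, by simp, by simp, ?_, ?_⟩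
    · rintro e ⟨he, h⟩
      induction e using Sym2.ind with
      | _ x y => exact absurd (h x (by simp)) (by simp)
    · intro e he h
      induction e using Sym2.ind with
      | _ x y => exact absurd (h x (by simp)) (by simp)
  have hval : ∀ e : Sym2 W, ∀ c, (∀ x ∈ e, x ∈ D.S0) →
      (Val D.G (fun z => if z ∈ D.S0 then D.τ0 z else D.τ0 z) c e ↔ Val D.G D.τ0 c e) := by
    intro e c h
    apply Val_congr
    intro x hx
    simp
  obtain ⟨σ', hσ⟩ := h0.extend_list D.T1_symm D.S0 (by simp) D.τ0 ok.hτinj ok.hτmem (by simp) (by simp)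
    ok.hτfl D.Bᶜ (disjoint_compl_left) (by
      intro e he h
      induction e using Sym2.ind with
      | _ x y => exact absurd (h x (by simp)) (by simp))
    ((EH D.H).filter (fun e => ∃ x ∈ e, x ∈ D.Q)) (by
      intro e' a b _
      · rw [mem_filter]
        simp only [empty_union] at b
        induction e' using Sym2.ind with
        | _ x y =>
          have hc := ok.col_cases a
          refine ⟨(mem_EH_mk _ _ _).2 hc.1, x, by simp, ?_⟩
          have := b x (by simp)
          rw [S0, mem_union] at this
          exact (mem_sdiff.1 (this.resolve_left hc.2.1)).1) (by
      intro e he h1 h2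
      simp only [empty_union] at h1
      refine le_trans (card_touch D.H D.Δ ok.hdeg D.Q) ((ok.hτcol e he h1).trans ?_)
      · apply card_le_card
        intro c hc
        rw [mem_filter] at hc ⊢
        exact ⟨hc.1, (hval e c h1).2 hc.2⟩)
  refine ⟨σ', ?_⟩
  have : (fun z => if z ∈ D.S0 then D.τ0 z else D.τ0 z) = D.τ0 := by ext z; simp
  rw [this] at hσ
  simpa [Gd] using hσ

/-- intermediate domain -/
noncomputable def SJ (D : Dat V C W) (J : Finset (Finset W)) : Finset W :=
  D.S0 ∪ univ.filter (fun z => z ∉ D.X ∧ z ∉ D.Q ∧ z ∉ D.F ∧ D.lab z ∈ J)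

lemma card_filter_image (S : Finset W) (τ : W → V) (U : Finset V) (N : Finset W) (n : ℕ) (hN : N.card ≤ n)
    (h : ∀ z ∈ S, τ z ∈ U → z ∈ N) (A : Finset V) (hA : A ⊆ U) :
    A.card ≤ (A \ S.image τ).card + n := by
  have h1 : A ⊆ (A \ S.image τ) ∪ N.image τ := by
    intro a ha
    by_cases h2 : a ∈ S.image τ
    · obtain ⟨z, hz, rfl⟩ := mem_image.1 h2
      exact mem_union_right _ (mem_image_of_mem _ (h z hz (hA ha)))
    · exact mem_union_left _ (mem_sdiff.2 ⟨ha, h2⟩)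
  have h2 := (card_le_card h1).trans (card_union_le _ _)
  have h3 : (N.image τ).card ≤ N.card := card_image_le
  omega

set_option maxHeartbeats 1000000 in
lemma Ok.step (ok : D.Ok) [Nonempty C] [Nonempty V] (J : Finset (Finset W)) (l : Finset W) (hl : l ∉ J)
    (τ : W → V) (σ : Sym2 W → C) (hg : D.Gd (D.SJ J) τ σ) (hτ : ∀ z ∈ D.S0, τ z = D.τ0 z)
    (hR : ∀ z ∈ D.SJ J, ∀ i, τ z ∈ D.R i → z ∈ NS D.H D.X) :
    ∃ τ' σ', D.Gd (D.SJ (insert l J)) τ' σ' ∧ (∀ z ∈ D.S0, τ' z = D.τ0 z) ∧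
      ∀ z ∈ D.SJ (insert l J), ∀ i, τ' z ∈ D.R i → z ∈ NS D.H D.X := by
  set L : Finset W := univ.filter (fun z => z ∉ D.X ∧ z ∉ D.Q ∧ z ∉ D.F ∧ D.lab z = l) with hL
  have hSL : D.SJ (insert l J) = D.SJ J ∪ L := by
    ext z
    simp only [SJ, hL, mem_union, mem_filter, mem_univ, true_and, mem_insert]
    tauto
  have hmL : ∀ z, z ∈ L ↔ z ∉ D.X ∧ z ∉ D.Q ∧ z ∉ D.F ∧ D.lab z = l := by simp [hL]
  have hdisj : Disjoint (D.SJ J) L := by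
    rw [disjoint_left]
    intro z hz hzL
    rw [hmL] at hzL
    simp only [SJ, S0, mem_union, mem_filter, mem_univ, true_and, mem_sdiff] at hz
    have : D.lab z ∉ J := hzL.2.2.2 ▸ hl
    tauto
  -- neighbours of L inside SJ are in X
  have hnbr : ∀ z ∈ L, ∀ y ∈ D.SJ J, D.H.Adj z y → y ∈ D.X := by
    intro z hz y hy hzy
    have hz' := (hmL z).1 hz
    by_contra hyX
    have hyQ : y ∉ D.Q := by
      intro h
      have := ok.hQ y h z hzy.symm
      tauto
    simp only [SJ, S0, mem_union, mem_filter, mem_univ, true_and, mem_sdiff] at hy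
    have h1 := ok.hlab z y hzy hz'.1 hyX
    have : D.lab y ∉ J := by rw [← h1, hz'.2.2.2]; exact hl
    tauto
  have hLnotfl : ∀ z ∈ L, ∀ y ∈ L, s(z, y) ∉ D.Efl := by
    intro z hz y hy h
    rw [mem_Efl] at h
    have hN : ∀ z ∈ L, ¬ (z ∈ D.X ∨ z ∈ D.I ∨ z ∈ NS D.H D.I) := by
      intro z hz h
      have hz' := (hmL z).1 hz
      rcases h with h | h | h
      · exact hz'.1 h
      · exact hz'.2.1 (ok.hIQ h)
      · rw [mem_NS] at h
        obtain ⟨x, hx, hxz⟩ := h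
        exact hz'.2.1 (ok.hNI x hx z hxz).1
    rcases h.2 with ⟨w, hw, h'⟩ | h
    · rw [Sym2.mem_iff] at hw
      rcases hw with rfl | rfl
      · exact hN _ hz h'
      · exact hN _ hy h'
    · exact ((hmL z).1 hz).2.2.1 (h.1 z (by simp))
  have hcolSL : ∀ z ∈ L, ∀ y ∈ D.SJ J, s(z, y) ∉ D.Ecol := by
    intro z hz y hy h
    have h1 := ok.col_cases h
    exact h1.2.2.1 (hnbr z hz y hy h1.1)
  -- unused colours
  set K := D.Bᶜ \ (D.Ecol.filter (fun e => ∀ x ∈ e, x ∈ D.SJ J)).image σ with hK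
  have hKc : D.k ≤ K.card := by
    rw [hK, ok.unused hg, ← ok.hGFc]
    apply card_le_card_of_injOn (fun x => s(x, D.nb x))
    · intro x hx
      have hx : x ∈ D.GF := hx
      rw [mem_coe, mem_filter]
      refine ⟨ok.M_mem hx, fun h => ?_⟩
      have h1 := h x (by simp)
      have h2 := ok.hGF hx
      have h3 : x ∉ D.X := fun h => disjoint_left.1 ok.hXF h h2
      have h4 : x ∉ D.Q := fun h => disjoint_left.1 ok.hQF h h2
      simp only [SJ, S0, mem_union, mem_filter, mem_univ, true_and, mem_sdiff] at h1
      tauto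
    · intro x hx y hy h
      have hx : x ∈ D.GF := hx
      have hy : y ∈ D.GF := hy
      simp only [Sym2.eq_iff] at h
      rcases h with h | h
      · exact h.1
      · have h1 := ok.hGFp x hx
        have h2 := ok.hGFp y hy
        have h3 := ok.hbip _ _ (ok.hnbadj x hx)
        rw [h.2, h1, h2] at h3
        simp at h3
  -- candidate sets
  set C0 : W → Finset V := fun z => if z ∈ NS D.H D.X then
      ((D.R (D.part z)).filter (fun v => ∀ x ∈ D.X, D.H.Adj z x → D.T1 v (D.τ0 x))) \ (D.SJ J).image τ
    else ((D.Vs (D.part z)) \ D.R (D.part z)) \ (D.SJ J).image τ with hC0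
  obtain ⟨τL, g1, g2, g3, -⟩ := greedy D.H D.part ok.hbip D.Δ ok.hdeg ok.hΔ D.Vs
    (Thick D.G K (D.q * K.card)) (fun u v h => Thick.symm h) D.e D.q ok.he ok.hq0 ok.hq1
    (ok.hTD K hKc) L C0 (by
      intro z hz v hv
      simp only [hC0] at hv
      split_ifs at hv with h
      · exact ok.hR _ (mem_filter.1 (mem_sdiff.1 hv).1).1
      · exact (mem_sdiff.1 (mem_sdiff.1 hv).1).1) D.c0 ok.hc0 (by
      intro z hz
      have hz' := (hmL z).1 hz
      simp only [hC0]
      split_ifs with h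
      · have h1 := ok.h1 z hz'.1
        have h2 := card_filter_image (D.SJ J) τ (D.R (D.part z)) (NS D.H D.X) _
          (card_NS D.H D.Δ ok.hdeg D.X) (fun z hz h => hR z hz _ h)
          ((D.R (D.part z)).filter (fun v => ∀ x ∈ D.X, D.H.Adj z x → D.T1 v (D.τ0 x))) (filter_subset _ _)
        have h3 := ok.hn1
        have h4 : (D.t : ℝ) ≤ (((D.R (D.part z)).filter (fun v => ∀ x ∈ D.X, D.H.Adj z x → D.T1 v (D.τ0 x))
          \ (D.SJ J).image τ).card : ℝ) + D.X.card * D.Δ := by exact_mod_cast h1.trans h2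
        have : (0:ℝ) ≤ 2 * D.k := by positivity
        linarith
      · have h1 := ok.hRI (D.part z)
        set i := D.part z
        have h2 : (D.Vs i).card ≤ ((D.Vs i \ D.R i) \ (D.SJ J).image τ).card + (D.R i).card +
            ((D.SJ J).filter (fun w => D.part w = i)).card := by
          have hs : D.Vs i ⊆ ((D.Vs i \ D.R i) \ (D.SJ J).image τ) ∪ D.R i ∪
              ((D.SJ J).filter (fun w => D.part w = i)).image τ := by
            intro v hv
            by_cases a : v ∈ D.R i
            · simp [a]
            by_cases b : v ∈ (D.SJ J).image τ
            · obtain ⟨w, hw, rfl⟩ := mem_image.1 b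
              have hwi := hg.mem w hw
              have hpi : D.part w = i := ok.part_eq hwi hv
              exact mem_union_right _ (mem_image_of_mem _ (mem_filter.2 ⟨hw, hpi⟩))
            · exact mem_union_left _ (mem_union_left _ (mem_sdiff.2 ⟨mem_sdiff.2 ⟨hv, a⟩, b⟩))
          have h5 := card_le_card hs
          have h6 := card_union_le (((D.Vs i \ D.R i) \ (D.SJ J).image τ) ∪ D.R i)
            (((D.SJ J).filter (fun w => D.part w = i)).image τ)
          have h7 := card_union_le ((D.Vs i \ D.R i) \ (D.SJ J).image τ) (D.R i)
          have h8 : (((D.SJ J).filter (fun w => D.part w = i)).image τ).card ≤ _ := card_image_le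
          omega
        have h3 : ((D.SJ J).filter (fun w => D.part w = i)).card + (D.I.filter (fun x => D.part x = i)).card
            ≤ (D.Vs i).card := by
          rw [← ok.hcard i, ← card_union_of_disjoint]
          · apply card_le_card
            intro w hw
            simp only [mem_union, mem_filter] at hw
            simp only [mem_filter, mem_univ, true_and]
            tauto
          · rw [disjoint_left]
            intro w hw hw'
            rw [mem_filter] at hw hw'
            have hwQ := ok.hIQ hw'.1
            have hwX : w ∉ D.X := fun h => disjoint_left.1 ok.hXQ h hwQ
            have := hw.1
            simp only [SJ, S0, mem_union, mem_filter, mem_univ, true_and, mem_sdiff] at this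
            tauto
        have h4 : ((D.I.filter (fun x => D.part x = i)).card : ℝ) ≤
            ((D.Vs i \ D.R i) \ (D.SJ J).image τ).card + (D.R i).card := by
          exact_mod_cast (by omega : (D.I.filter (fun x => D.part x = i)).card ≤
            ((D.Vs i \ D.R i) \ (D.SJ J).image τ).card + (D.R i).card)
        linarith) L subset_rfl (by
      have h1 : (L.card : ℝ) ≤ D.Mx := by
        have := ok.hMx l
        have h2 : L.card ≤ D.Mx := by
          refine le_trans (card_le_card ?_) this
          intro z hz
          have := (hmL z).1 hz
          simp only [mem_filter, mem_univ, true_and]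
          tauto
        exact_mod_cast h2
      have := ok.hn2
      linarith)
  have hC0i : ∀ z ∈ L, τL z ∈ D.Vs (D.part z) ∧ (∀ y ∈ D.SJ J, τL z ≠ τ y) ∧
      (∀ i, τL z ∈ D.R i → z ∈ NS D.H D.X) ∧
      (∀ x ∈ D.X, D.H.Adj z x → D.T1 (τL z) (D.τ0 x)) := by
    intro z hz
    have hv := g2 z hz
    simp only [hC0] at hv
    split_ifs at hv with h
    · rw [mem_sdiff, mem_filter] at hv
      refine ⟨ok.hR _ hv.1.1, fun y hy h => hv.2 (h ▸ mem_image_of_mem _ hy), fun _ _ => h, hv.1.2⟩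
    · rw [mem_sdiff, mem_sdiff] at hv
      refine ⟨hv.1.1, fun y hy h => hv.2 (h ▸ mem_image_of_mem _ hy), ?_, ?_⟩
      · intro i hi
        have hi' := ok.part_eq (ok.hR _ hi) hv.1.1
        exact absurd (hi' ▸ hi) hv.1.2
      · intro x hx hzx
        exact absurd ((mem_NS _ _ _).2 ⟨x, hx, hzx.symm⟩) h
  have hXS : D.X ⊆ D.S0 := subset_union_left
  have hS0S : D.S0 ⊆ D.SJ J := subset_union_left
  obtain ⟨σ', hσ'⟩ := hg.extend_list D.T1_symm L hdisj τL g1 (fun z hz => (hC0i z hz).1)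
    (fun z hz => (hC0i z hz).2.1) (by
      intro z hz y hy h
      have hadj : D.H.Adj z y := by simpa using ((mem_Efl _ _).1 h).1
      have hyX := hnbr z hz y hy hadj
      rw [hτ y (hXS hyX)]
      exact (hC0i z hz).2.2.2 y hyX hadj)
    (fun z hz y hy h => absurd h (hLnotfl z hz y hy)) K (by
      rw [disjoint_left]
      intro c hc
      exact mem_compl.1 (mem_sdiff.1 hc).1) (by
      intro e he h h'
      exact (mem_sdiff.1 h').2 (mem_image_of_mem _ (mem_filter.2 ⟨he, h⟩)))
    ((EH D.H).filter (fun e => ∃ x ∈ e, x ∈ L)) (by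
      intro e he _ h
      rw [mem_filter]
      exact ⟨(mem_EH _ _).2 ((mem_Ecol _ _).1 he).1, h⟩) (by
      intro e he h1 h2
      induction e using Sym2.ind with
      | _ x y =>
        have hxy : x ∈ L ∧ y ∈ L := by
          obtain ⟨w, hw, hwL⟩ := h2
          have hx := h1 x (by simp)
          have hy := h1 y (by simp)
          rw [mem_union] at hx hy
          rw [Sym2.mem_iff] at hw
          rcases hw with rfl | rfl
          · exact ⟨hwL, hy.resolve_left fun h => hcolSL _ hwL y h he⟩
          · exact ⟨hx.resolve_left fun h => hcolSL _ hwL x h (by rwa [Sym2.eq_swap]), hwL⟩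
        have hadj := (ok.col_cases he).1
        have h3 := g3 x hxy.1 y hxy.2 hadj
        have h4 := card_touch D.H D.Δ ok.hdeg L
        have h5 : L.card ≤ D.Mx := by
          refine le_trans (card_le_card ?_) (ok.hMx l)
          intro z hz
          have := (hmL z).1 hz
          simp only [mem_filter, mem_univ, true_and]
          tauto
        have h6 : (K.filter (fun c => Val D.G (fun z => if z ∈ L then τL z else τ z) c s(x, y))) =
            K.filter (fun c => (D.G c).Adj (τL x) (τL y)) := by
          apply filter_congr
          intro c _
          rw [Val_mk, if_pos hxy.1, if_pos hxy.2]
        rw [h6]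
        unfold Thick at h3
        have h7 : D.q * D.k ≤ D.q * K.card := mul_le_mul_of_nonneg_left (by exact_mod_cast hKc) ok.hq0
        have h8 := ok.hn4
        have h9 : ((D.Mx * D.Δ : ℕ) : ℝ) ≤ ((K.filter (fun c => (D.G c).Adj (τL x) (τL y))).card : ℝ) := by
          push_cast; linarith
        have h10 : D.Mx * D.Δ ≤ (K.filter (fun c => (D.G c).Adj (τL x) (τL y))).card := by exact_mod_cast h9
        exact (h4.trans (Nat.mul_le_mul_right _ h5)).trans h10)
  refine ⟨_, σ', by rw [hSL]; exact hσ', ?_, ?_⟩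
  · intro z hz
    have : z ∉ L := disjoint_left.1 hdisj (hS0S hz)
    simp only [this, if_false]
    exact hτ z hz
  · intro z hz i hi
    by_cases h : z ∈ L
    · simp only [h, if_true] at hi
      exact (hC0i z h).2.2.1 i hi
    · simp only [h, if_false] at hi
      rw [hSL, mem_union] at hz
      exact hR z (hz.resolve_right h) i hi

lemma Ok.phase1 (ok : D.Ok) [Nonempty C] [Nonempty V] (J : Finset (Finset W)) :
    ∃ τ σ, D.Gd (D.SJ J) τ σ ∧ (∀ z ∈ D.S0, τ z = D.τ0 z) ∧
      ∀ z ∈ D.SJ J, ∀ i, τ z ∈ D.R i → z ∈ NS D.H D.X := by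
  induction J using Finset.induction_on with
  | empty =>
    obtain ⟨σ, h⟩ := ok.start
    have : D.SJ ∅ = D.S0 := by simp [SJ]
    rw [this]
    exact ⟨D.τ0, σ, h, fun _ _ => rfl, fun z hz i hi => absurd hi (ok.hRτ z hz i)⟩
  | insert l J hl ih =>
    obtain ⟨τ, σ, h1, h2, h3⟩ := ih
    exact ok.step J l hl τ σ h1 h2 h3

end Dat


namespace Dat

set_option linter.unusedSectionVars false

variable {V C W : Type*} [Fintype C] [Fintype W] {D : Dat V C W}

/-- everything but `F` and `I` -/
noncomputable def S1 (D : Dat V C W) : Finset W := univ \ (D.F ∪ D.I)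

/-- endpoints of the special matching -/
noncomputable def PF (D : Dat V C W) : Finset W := D.GF ∪ D.GF.image D.nb

lemma Ok.SJ_all (ok : D.Ok) : D.SJ (univ.image D.lab) = D.S1 := by
  ext z
  simp only [SJ, S0, S1, mem_union, mem_filter, mem_univ, true_and, mem_sdiff, mem_image,
    exists_apply_eq_apply, and_true]
  have h1 : z ∈ D.X → z ∉ D.F := fun h => disjoint_left.1 ok.hXF h
  have h2 : z ∈ D.X → z ∉ D.Q := fun h => disjoint_left.1 ok.hXQ h
  have h3 : z ∈ D.Q → z ∉ D.F := fun h => disjoint_left.1 ok.hQF h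
  have h4 : z ∈ D.I → z ∈ D.Q := fun h => ok.hIQ h
  tauto

lemma Ok.S0_sub (ok : D.Ok) : D.S0 ⊆ D.S1 := by
  rw [← ok.SJ_all]
  exact subset_union_left

lemma Ok.PF_sub (ok : D.Ok) : D.PF ⊆ D.F := by
  intro z hz
  rw [PF, mem_union, mem_image] at hz
  rcases hz with h | ⟨x, hx, rfl⟩
  · exact ok.hGF h
  · exact ok.hnbF x hx

lemma Ok.PF_partner (ok : D.Ok) {z : W} (hz : z ∈ D.PF) :
    ∃ p ∈ D.PF, D.H.Adj z p ∧ s(z, p) ∈ D.Ecol := by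
  rw [PF, mem_union, mem_image] at hz
  rcases hz with h | ⟨x, hx, rfl⟩
  · exact ⟨D.nb z, mem_union_right _ (mem_image_of_mem _ h), ok.hnbadj z h, ok.M_mem h⟩
  · exact ⟨x, mem_union_left _ hx, (ok.hnbadj x hx).symm, by rw [Sym2.eq_swap]; exact ok.M_mem hx⟩

lemma Ok.K_card (ok : D.Ok) {τ : W → V} {σ : Sym2 W → C} (hg : D.Gd D.S1 τ σ) :
    D.k ≤ (D.Bᶜ \ (D.Ecol.filter (fun e => ∀ x ∈ e, x ∈ D.S1)).image σ).card := by
  rw [ok.unused hg, ← ok.hGFc]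
  apply card_le_card_of_injOn (fun x => s(x, D.nb x))
  · intro x hx
    have hx : x ∈ D.GF := hx
    rw [mem_coe, mem_filter]
    refine ⟨ok.M_mem hx, fun h => ?_⟩
    have h1 := h x (by simp)
    have h2 := ok.hGF hx
    simp only [S1, mem_sdiff, mem_union] at h1
    tauto
  · intro x hx y hy h
    have hx : x ∈ D.GF := hx
    have hy : y ∈ D.GF := hy
    simp only [Sym2.eq_iff] at h
    rcases h with h | h
    · exact h.1
    · have h1 := ok.hGFp x hx
      have h2 := ok.hGFp y hy
      have h3 := ok.hbip _ _ (ok.hnbadj x hx)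
      rw [h.2, h1, h2] at h3
      simp at h3

set_option maxHeartbeats 1000000 in
lemma Ok.phase2a (ok : D.Ok) [Nonempty C] [Nonempty V] :
    ∃ τ σ, D.Gd (D.S1 ∪ D.PF) τ σ ∧ (∀ z ∈ D.S0, τ z = D.τ0 z) ∧
      ∀ z ∈ D.S1 ∪ D.PF, ∀ i, τ z ∈ D.R i → z ∈ NS D.H D.X ∪ D.PF := by
  obtain ⟨τ, σ, hg, hτ, hR⟩ := ok.phase1 (univ.image D.lab)
  rw [ok.SJ_all] at hg hR
  have hKc := ok.K_card hg
  set K := D.Bᶜ \ (D.Ecol.filter (fun e => ∀ x ∈ e, x ∈ D.S1)).image σ with hK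
  obtain ⟨f, hf1, hf2⟩ := list_choice D.GF (fun _ => K) (fun x hx => by rw [ok.hGFc]; exact hKc)
  have hsz : ∀ A i, A ⊆ D.R i → D.t ≤ A.card → D.GF.card ≤ (A \ D.S1.image τ).card := by
    intro A i hA ht
    have h1 := card_filter_image D.S1 τ (D.R i) (NS D.H D.X) _
      (card_NS D.H D.Δ ok.hdeg D.X) (fun z hz h => hR z hz _ h) A hA
    have h2 := ok.hn5
    have h3 := ok.hGFc
    omega
  obtain ⟨u, hu1, hu2⟩ := list_choice D.GF (fun x => ((D.R false).filter
    (fun u => D.t ≤ ((D.R true).filter (fun w => (D.G (f x)).Adj u w)).card)) \ D.S1.image τ)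
    (fun x hx => hsz _ false (filter_subset _ _) (ok.h4 _))
  obtain ⟨v, hv1, hv2⟩ := list_choice D.GF (fun x => ((D.R true).filter
    (fun w => (D.G (f x)).Adj (u x) w)) \ D.S1.image τ)
    (fun x hx => hsz _ true (filter_subset _ _) (mem_filter.1 (mem_sdiff.1 (hu2 x hx)).1).2)
  have hnbinj : ∀ x ∈ D.GF, ∀ y ∈ D.GF, D.nb x = D.nb y → x = y := by
    intro x hx y hy h
    exact ok.hGF1 x hx y hy (h ▸ ok.hnbadj x hx)
  have hnbp : ∀ x ∈ D.GF, D.part (D.nb x) = true := by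
    intro x hx
    rw [ok.hbip _ _ (ok.hnbadj x hx), ok.hGFp x hx]; rfl
  have hnbG : ∀ x ∈ D.GF, D.nb x ∉ D.GF := by
    intro x hx h
    have h1 := hnbp x hx
    rw [ok.hGFp _ h] at h1
    exact absurd h1 (by simp)
  obtain ⟨τL, hτ1, hτ2⟩ : ∃ τL : W → V, (∀ x ∈ D.GF, τL x = u x) ∧ ∀ x ∈ D.GF, τL (D.nb x) = v x := by
    refine ⟨fun z => if z ∈ D.GF then u z else if h : ∃ x ∈ D.GF, D.nb x = z then v h.choose else u z, ?_, ?_⟩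
    · intro x hx
      simp [hx]
    · intro x hx
      have h : ∃ y ∈ D.GF, D.nb y = D.nb x := ⟨x, hx, rfl⟩
      simp only [hnbG x hx, if_false, dif_pos h]
      rw [hnbinj _ h.choose_spec.1 x hx h.choose_spec.2]
  have hMinj : ∀ x ∈ D.GF, ∀ y ∈ D.GF, s(x, D.nb x) = s(y, D.nb y) → x = y := by
    intro x hx y hy h
    rw [Sym2.eq_iff] at h
    rcases h with h | h
    · exact h.1
    · exact absurd (h.1 ▸ hx) (hnbG y hy)
  obtain ⟨σL, hσ⟩ : ∃ σL : Sym2 W → C, ∀ x ∈ D.GF, σL s(x, D.nb x) = f x := by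
    refine ⟨fun e => if h : ∃ x ∈ D.GF, s(x, D.nb x) = e then f h.choose else Classical.arbitrary C, ?_⟩
    intro x hx
    have h : ∃ y ∈ D.GF, s(y, D.nb y) = s(x, D.nb x) := ⟨x, hx, rfl⟩
    simp only [dif_pos h]
    rw [hMinj _ h.choose_spec.1 x hx h.choose_spec.2]
  have huR : ∀ x ∈ D.GF, u x ∈ D.R false := fun x hx => (mem_filter.1 (mem_sdiff.1 (hu2 x hx)).1).1
  have hvR : ∀ x ∈ D.GF, v x ∈ D.R true := fun x hx => (mem_filter.1 (mem_sdiff.1 (hv2 x hx)).1).1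
  have hPF : ∀ z ∈ D.PF, z ∈ D.GF ∨ ∃ x ∈ D.GF, D.nb x = z := by
    intro z hz
    rwa [PF, mem_union, mem_image] at hz
  have huv : ∀ x ∈ D.GF, ∀ y ∈ D.GF, u x ≠ v y := by
    intro x hx y hy h
    exact absurd (ok.part_eq (ok.hR _ (huR x hx)) (h ▸ ok.hR _ (hvR y hy))) (by simp)
  have hd : Disjoint D.S1 D.PF := by
    rw [disjoint_left]
    intro z hz hz'
    have := ok.PF_sub hz'
    simp only [S1, mem_sdiff, mem_union] at hz
    tauto
  have hcolM : ∀ e ∈ D.Ecol, (∃ x ∈ e, x ∈ D.PF) → ∃ z ∈ D.GF, e = s(z, D.nb z) := by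
    intro e he ⟨x, hx, hxP⟩
    have hxF := ok.PF_sub hxP
    obtain ⟨y, rfl⟩ := Sym2.mem_iff_exists.1 hx
    exact ((ok.col_cases he).2.2.2.2.2 (Or.inl hxF)).2.2
  have hgood := hg.extend D.T1_symm D.PF hd τL (by
      intro x hx y hy h
      replace hx := hPF x hx
      replace hy := hPF y hy
      rcases hx with hx | ⟨x, hx, rfl⟩ <;> rcases hy with hy | ⟨y, hy, rfl⟩
      · rw [hτ1 x hx, hτ1 y hy] at h; exact hu1 hx hy h
      · rw [hτ1 x hx, hτ2 y hy] at h; exact absurd h (huv x hx y hy)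
      · rw [hτ2 x hx, hτ1 y hy] at h; exact absurd h.symm (huv y hy x hx)
      · rw [hτ2 x hx, hτ2 y hy] at h; rw [hv1 hx hy h]) (by
      intro x hx
      replace hx := hPF x hx
      rcases hx with hx | ⟨x, hx, rfl⟩
      · rw [hτ1 x hx, ok.hGFp x hx]; exact ok.hR _ (huR x hx)
      · rw [hτ2 x hx, hnbp x hx]; exact ok.hR _ (hvR x hx)) (by
      intro x hx y hy h
      replace hx := hPF x hx
      rcases hx with hx | ⟨x, hx, rfl⟩
      · rw [hτ1 x hx] at h
        exact (mem_sdiff.1 (hu2 x hx)).2 (h ▸ mem_image_of_mem _ hy)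
      · rw [hτ2 x hx] at h
        exact (mem_sdiff.1 (hv2 x hx)).2 (h ▸ mem_image_of_mem _ hy)) (by
      intro z hz y hy h
      exfalso
      have hadj : D.H.Adj z y := by simpa using ((mem_Efl _ _).1 h).1
      obtain ⟨p, hp, hzp, -⟩ := ok.PF_partner hz
      have hyX : y ∈ D.X := by
        rcases ok.hF z (ok.PF_sub hz) y hadj with h | h
        · simp only [S1, mem_sdiff, mem_union] at hy
          tauto
        · exact h
      exact ok.hGF3 z p hp y hyX hzp hadj) (by
      intro z hz y hy h
      exfalso
      have hadj : D.H.Adj z y := by simpa using ((mem_Efl _ _).1 h).1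
      obtain ⟨p, hp, hzp, hc⟩ := ok.PF_partner hz
      have := ok.hGF2 z p hp y hy hzp hadj
      subst this
      exact ((mem_Ecol _ _).1 hc).2.1 h) σL (by
      intro e he e' he' _ _ h1 h2 h
      obtain ⟨z, hz, rfl⟩ := hcolM e he h1
      obtain ⟨z', hz', rfl⟩ := hcolM e' he' h2
      rw [hσ z hz, hσ z' hz'] at h
      rw [hf1 hz hz' h]) (by
      intro e he _ h1
      obtain ⟨z, hz, rfl⟩ := hcolM e he h1
      rw [hσ z hz]
      have hfz := mem_sdiff.1 (hf2 z hz)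
      refine ⟨mem_compl.1 hfz.1, ?_, ?_⟩
      · have a1 : z ∈ D.PF := mem_union_left _ hz
        have a2 : D.nb z ∈ D.PF := mem_union_right _ (mem_image_of_mem _ hz)
        rw [Val_mk, if_pos a1, if_pos a2, hτ1 z hz, hτ2 z hz]
        exact (mem_filter.1 (mem_sdiff.1 (hv2 z hz)).1).2
      · intro e' he' hS h
        exact hfz.2 (h ▸ mem_image_of_mem _ (mem_filter.2 ⟨he', hS⟩)))
  refine ⟨_, _, hgood, ?_, ?_⟩
  · intro z hz
    have : z ∉ D.PF := disjoint_left.1 hd (ok.S0_sub hz)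
    simp only [this, if_false]
    exact hτ z hz
  · intro z hz i hi
    by_cases h : z ∈ D.PF
    · exact mem_union_right _ h
    · simp only [h, if_false] at hi
      rw [mem_union] at hz
      exact mem_union_left _ (hR z (hz.resolve_right h) i hi)

lemma Ok.PF_card (ok : D.Ok) : D.PF.card ≤ 2 * D.k := by
  have h1 := card_union_le D.GF (D.GF.image D.nb)
  have h2 : (D.GF.image D.nb).card ≤ D.GF.card := card_image_le
  have h3 := ok.hGFc
  unfold PF
  omega

set_option maxHeartbeats 1000000 in
lemma Ok.phase2b (ok : D.Ok) [Nonempty C] [Nonempty V] :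
    ∃ τ σ, D.Gd (univ \ D.I) τ σ ∧ (∀ z ∈ D.S0, τ z = D.τ0 z) ∧
      ∀ z ∈ univ \ D.I, ∀ i, τ z ∈ D.R i → z ∈ NS D.H D.X ∪ D.F := by
  obtain ⟨τ, σ, hg, hτ, hR⟩ := ok.phase2a
  set S2 := D.S1 ∪ D.PF with hS2
  set L := D.F \ D.PF with hL
  have hU : univ \ D.I = S2 ∪ L := by
    ext z
    have h1 : z ∈ D.PF → z ∈ D.F := fun h => ok.PF_sub h
    have h3 : z ∈ D.Q → z ∉ D.F := fun h => disjoint_left.1 ok.hQF h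
    have h4 : z ∈ D.I → z ∈ D.Q := fun h => ok.hIQ h
    simp only [hS2, hL, S1, mem_union, mem_sdiff, mem_univ, true_and]
    tauto
  have hd : Disjoint S2 L := by
    rw [disjoint_left]
    intro z hz hz'
    rw [hL, mem_sdiff] at hz'
    simp only [hS2, S1, mem_union, mem_sdiff, mem_univ, true_and] at hz
    tauto
  have hXS : D.X ⊆ D.S0 := subset_union_left
  have hS0 : D.S0 ⊆ S2 := fun z hz => mem_union_left _ (ok.S0_sub hz)
  have hnbr : ∀ z ∈ L, ∀ y ∈ S2, D.H.Adj z y → y ∈ D.X ∨ y ∈ D.PF := by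
    intro z hz y hy h
    rcases ok.hF z (mem_sdiff.1 hz).1 y h with h | h
    · right
      simp only [hS2, S1, mem_union, mem_sdiff, mem_univ, true_and] at hy
      tauto
    · exact Or.inl h
  have hLX : ∀ z ∈ L, z ∉ D.X := fun z hz h => disjoint_left.1 ok.hXF h (mem_sdiff.1 hz).1
  have hcol : ∀ e ∈ D.Ecol, (∃ x ∈ e, x ∈ L) → False := by
    intro e he ⟨x, hx, hxL⟩
    rw [hL, mem_sdiff] at hxL
    obtain ⟨y, rfl⟩ := Sym2.mem_iff_exists.1 hx
    obtain ⟨z, hz, h⟩ := ((ok.col_cases he).2.2.2.2.2 (Or.inl hxL.1)).2.2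
    have : x ∈ s(z, D.nb z) := h ▸ hx
    rw [Sym2.mem_iff] at this
    apply hxL.2
    rcases this with rfl | rfl
    · exact mem_union_left _ hz
    · exact mem_union_right _ (mem_image_of_mem _ hz)
  set C0 : W → Finset V := fun z => ((D.R (D.part z)).filter
    (fun v => ∀ y ∈ S2, D.H.Adj z y → D.T1 v (τ y))) \ S2.image τ with hC0
  obtain ⟨τL, g1, g2, g3, -⟩ := greedy D.H D.part ok.hbip D.Δ ok.hdeg ok.hΔ D.Vs
    D.T1 D.T1_symm D.e D.q ok.he ok.hq0 ok.hq1 ok.hT1 L C0 (by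
      intro z hz v hv
      exact ok.hR _ (mem_filter.1 (mem_sdiff.1 hv).1).1) D.c0 ok.hc0 (by
      intro z hz
      have hN : (NS D.H D.X ∪ D.PF).card ≤ D.X.card * D.Δ + 2 * D.k := by
        have h1 := card_union_le (NS D.H D.X) D.PF
        have h2 := card_NS D.H D.Δ ok.hdeg D.X
        have h3 := ok.PF_card
        omega
      have hA : D.t ≤ ((D.R (D.part z)).filter (fun v => ∀ y ∈ S2, D.H.Adj z y → D.T1 v (τ y))).card := by
        by_cases hp : ∃ p ∈ D.PF, D.H.Adj z p
        · obtain ⟨p, hp, hzp⟩ := hp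
          have hpS : p ∈ S2 := mem_union_right _ hp
          have h3 := ok.h3 (D.part p) (τ p) (hg.mem p hpS) (by
            intro h
            obtain ⟨w, hw, hwp⟩ := mem_image.1 h
            rw [← hτ w hw] at hwp
            have := hg.inj (hS0 hw) hpS hwp
            subst this
            have := ok.S0_sub hw
            rw [S1, mem_sdiff, mem_union] at this
            exact this.2 (Or.inl (ok.PF_sub hp)))
          have hpar : (!(D.part p)) = D.part z := by rw [ok.hbip _ _ hzp]; simp
          rw [hpar] at h3
          refine h3.trans (card_le_card ?_)
          intro v hv
          rw [mem_filter] at hv ⊢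
          refine ⟨hv.1, fun y hy hzy => ?_⟩
          rcases hnbr z hz y hy hzy with h | h
          · exact absurd hzy (ok.hGF3 z p hp y h hzp)
          · rw [← ok.hGF2 z p hp y h hzp hzy]
            exact D.T1_symm _ _ hv.2
        · refine (ok.h1 z (hLX z hz)).trans (card_le_card ?_)
          intro v hv
          rw [mem_filter] at hv ⊢
          refine ⟨hv.1, fun y hy hzy => ?_⟩
          rcases hnbr z hz y hy hzy with h | h
          · rw [hτ y (hXS h)]; exact hv.2 y h hzy
          · exact absurd ⟨y, h, hzy⟩ hp
      have h2 := card_filter_image S2 τ (D.R (D.part z)) (NS D.H D.X ∪ D.PF) _ hN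
        (fun z hz h => hR z hz _ h) _ (filter_subset (fun v => ∀ y ∈ S2, D.H.Adj z y → D.T1 v (τ y)) _)
      have h4 : (D.t : ℝ) ≤ ((C0 z).card : ℝ) + (D.X.card * D.Δ + 2 * D.k) := by
        exact_mod_cast hA.trans h2
      have := ok.hn1
      linarith) L subset_rfl (by
      have h1 : (L.card : ℝ) ≤ D.F.card := by exact_mod_cast card_le_card sdiff_subset
      have := ok.hn3
      linarith)
  obtain ⟨σ', hσ'⟩ := hg.extend_list D.T1_symm L hd τL g1
    (fun z hz => ok.hR _ (mem_filter.1 (mem_sdiff.1 (g2 z hz)).1).1)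
    (fun z hz y hy h => (mem_sdiff.1 (g2 z hz)).2 (h ▸ mem_image_of_mem _ hy)) (by
      intro z hz y hy h
      have hadj : D.H.Adj z y := by simpa using ((mem_Efl _ _).1 h).1
      exact (mem_filter.1 (mem_sdiff.1 (g2 z hz)).1).2 y hy hadj)
    (by
      intro z hz y hy h
      have hadj : D.H.Adj z y := by simpa using ((mem_Efl _ _).1 h).1
      exact g3 z hz y hy hadj) ∅ (by simp) (by simp) ∅ (fun e he _ h => (hcol e he h).elim)
      (fun e he _ h => (hcol e he h).elim)
  rw [hU]
  refine ⟨_, σ', hσ', ?_, ?_⟩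
  · intro z hz
    have : z ∉ L := disjoint_left.1 hd (hS0 hz)
    simp only [this, if_false]
    exact hτ z hz
  · intro z hz i hi
    by_cases h : z ∈ L
    · exact mem_union_right _ (mem_sdiff.1 h).1
    · simp only [h, if_false] at hi
      rw [mem_union] at hz
      have := hR z (hz.resolve_right h) i hi
      rw [mem_union] at this ⊢
      exact this.imp id (fun h => ok.PF_sub h)

set_option maxHeartbeats 1000000 in
lemma Ok.phase3 (ok : D.Ok) [Nonempty C] [Nonempty V] :
    ∃ τ σ, D.Gd univ τ σ ∧ (∀ z ∈ D.S0, τ z = D.τ0 z) := by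
  obtain ⟨τ, σ, hg, hτ, hR⟩ := ok.phase2b
  have hS0 : D.S0 ⊆ univ \ D.I := by
    intro z hz
    have := ok.S0_sub hz
    simp only [S1, mem_sdiff, mem_union, mem_univ, true_and] at this ⊢
    tauto
  have key : ∀ i, ∃ f : W → V, Set.InjOn f (D.I.filter (fun x => D.part x = i)) ∧
      ∀ x ∈ D.I.filter (fun x => D.part x = i), f x ∈ D.Vs i \ (univ \ D.I).image τ ∧
        ∀ y, D.H.Adj x y → D.T1 (f x) (D.τ0 y) := by
    intro i
    apply hall_super (fun x v => ∀ y, D.H.Adj x y → D.T1 v (D.τ0 y))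
      (D.I.filter (fun x => D.part x = i)) (D.Vs i \ (univ \ D.I).image τ) D.lamI
    · have h1 : D.Vs i \ (univ \ D.I).image τ = D.Vs i \ ((univ \ D.I).filter (fun x => D.part x = i)).image τ := by
        ext v
        simp only [mem_sdiff, mem_image, mem_filter]
        constructor
        · rintro ⟨h1, h2⟩
          exact ⟨h1, fun ⟨x, hx, h⟩ => h2 ⟨x, hx.1, h⟩⟩
        · rintro ⟨h1, h2⟩
          refine ⟨h1, fun ⟨x, hx, h⟩ => h2 ⟨x, ⟨hx, ?_⟩, h⟩⟩
          exact ok.part_eq (hg.mem x (mem_sdiff.2 hx)) (h ▸ h1)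
      have h2 : ((univ \ D.I).filter (fun x => D.part x = i)).image τ ⊆ D.Vs i := by
        intro v hv
        obtain ⟨x, hx, rfl⟩ := mem_image.1 hv
        rw [mem_filter] at hx
        exact hx.2 ▸ hg.mem x hx.1
      have h3 : (((univ \ D.I).filter (fun x => D.part x = i)).image τ).card =
          ((univ \ D.I).filter (fun x => D.part x = i)).card := by
        apply card_image_of_injOn
        intro x hx y hy h
        exact hg.inj (mem_filter.1 hx).1 (mem_filter.1 hy).1 h
      have h4 := card_sdiff_add_card_eq_card h2
      have h5 : ((univ : Finset W).filter (fun x => D.part x = i)).card =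
          ((univ \ D.I).filter (fun x => D.part x = i)).card + (D.I.filter (fun x => D.part x = i)).card := by
        rw [← card_union_of_disjoint]
        · congr 1
          ext z
          simp only [mem_union, mem_filter, mem_univ, true_and, mem_sdiff]
          tauto
        · rw [disjoint_left]
          intro z hz hz'
          simp only [mem_filter, mem_univ, true_and, mem_sdiff] at hz hz'
          tauto
      have h6 := ok.hcard i
      rw [h1]
      omega
    · intro x hx
      rw [mem_filter] at hx
      have h1 := ok.h2 x hx.1
      have hN : (NS D.H D.X ∪ D.F).card ≤ D.X.card * D.Δ + D.F.card := by
        have h1 := card_union_le (NS D.H D.X) D.F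
        have h2 := card_NS D.H D.Δ ok.hdeg D.X
        omega
      have h2 := card_filter_image (univ \ D.I) τ (D.R (D.part x)) (NS D.H D.X ∪ D.F) _ hN
        (fun z hz h => hR z hz _ h) _ (filter_subset (fun v => ∀ y, D.H.Adj x y → D.T1 v (D.τ0 y)) _)
      have h3 := card_le_card (show ((D.R (D.part x)).filter (fun v => ∀ y, D.H.Adj x y → D.T1 v (D.τ0 y)) \
          (univ \ D.I).image τ) ⊆ ((D.Vs i \ (univ \ D.I).image τ).filter
          (fun v => ∀ y, D.H.Adj x y → D.T1 v (D.τ0 y))) by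
        intro v hv
        rw [mem_sdiff, mem_filter] at hv
        rw [mem_filter, mem_sdiff]
        exact ⟨⟨hx.2 ▸ ok.hR _ hv.1.1, hv.2⟩, hv.1.2⟩)
      have h4 := ok.hn6
      have h5 : (D.t : ℝ) ≤ (((D.Vs i \ (univ \ D.I).image τ).filter
          (fun v => ∀ y, D.H.Adj x y → D.T1 v (D.τ0 y))).card : ℝ) + (D.X.card * D.Δ + D.F.card) := by
        exact_mod_cast (h1.trans h2).trans (Nat.add_le_add_right h3 _)
      have h6 : D.lamI ≤ (((D.Vs i \ (univ \ D.I).image τ).filter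
          (fun v => ∀ y, D.H.Adj x y → D.T1 v (D.τ0 y))).card : ℝ) := by linarith
      convert h6
    · intro v hv
      rw [mem_sdiff] at hv
      have h0 := ok.h5 i v hv.1
      have : v ∉ D.S0.image D.τ0 := ?_
      · convert h0 this
      intro h
      obtain ⟨w, hw, hwv⟩ := mem_image.1 h
      exact hv.2 (mem_image.2 ⟨w, hS0 hw, by rw [hτ w hw, hwv]⟩)
    · intro S hS U hU h1 h2
      exact ok.h6 i S hS U (hU.trans sdiff_subset) h1 h2
  choose f hf1 hf2 using key
  have hd : Disjoint (univ \ D.I) D.I := sdiff_disjoint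
  have hnI : ∀ z ∈ D.I, ∀ y, D.H.Adj z y → y ∈ D.S0 := by
    intro z hz y h
    have := ok.hNI z hz y h
    exact mem_union_right _ (mem_sdiff.2 this)
  have hcol : ∀ e ∈ D.Ecol, (∃ x ∈ e, x ∈ D.I) → False := by
    intro e he ⟨x, hx, hxL⟩
    obtain ⟨y, rfl⟩ := Sym2.mem_iff_exists.1 hx
    exact (ok.col_cases he).2.2.2.1 hxL
  obtain ⟨σ', hσ'⟩ := hg.extend_list D.T1_symm D.I hd (fun z => f (D.part z) z) (by
      intro x hx y hy h
      simp only at h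
      have h1 := (hf2 (D.part x) x (mem_filter.2 ⟨hx, rfl⟩)).1
      have h2 := (hf2 (D.part y) y (mem_filter.2 ⟨hy, rfl⟩)).1
      have h3 : D.part y = D.part x := ok.part_eq (mem_sdiff.1 h2).1 (h ▸ (mem_sdiff.1 h1).1)
      rw [h3] at h
      exact hf1 (D.part x) (mem_filter.2 ⟨hx, rfl⟩) (mem_filter.2 ⟨hy, h3⟩) h)
    (fun z hz => (mem_sdiff.1 (hf2 (D.part z) z (mem_filter.2 ⟨hz, rfl⟩)).1).1)
    (fun z hz y hy h => (mem_sdiff.1 (hf2 (D.part z) z (mem_filter.2 ⟨hz, rfl⟩)).1).2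
      (h ▸ mem_image_of_mem _ hy)) (by
      intro z hz y hy h
      have hadj : D.H.Adj z y := by simpa using ((mem_Efl _ _).1 h).1
      rw [hτ y (hnI z hz y hadj)]
      exact (hf2 (D.part z) z (mem_filter.2 ⟨hz, rfl⟩)).2 y hadj)
    (by
      intro z hz y hy h
      have hadj : D.H.Adj z y := by simpa using ((mem_Efl _ _).1 h).1
      exact absurd hy (ok.hNI z hz y hadj).2) ∅ (by simp) (by simp) ∅ (fun e he _ h => (hcol e he h).elim)
      (fun e he _ h => (hcol e he h).elim)
  have hU : univ \ D.I ∪ D.I = univ := by simp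
  rw [hU] at hσ'
  refine ⟨_, σ', hσ', ?_⟩
  intro z hz
  have : z ∉ D.I := disjoint_left.1 hd (hS0 hz)
  simp only [this, if_false]
  exact hτ z hz

theorem Ok.final (ok : D.Ok) [Nonempty C] [Nonempty V] : HasTransversal D.G D.H := by
  obtain ⟨τ, σ, hg, hτ⟩ := ok.phase3
  have hval : ∀ e ∈ D.EAf, ∀ c, (Val D.G τ c e ↔ Val D.G D.τ0 c e) := by
    intro e he c
    apply Val_congr
    intro x hx
    exact hτ x (mem_union_right _ (mem_sdiff.2 (ok.hEAQ e he x hx)))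
  apply assemble D.G D.H τ (fun x y h => hg.inj (by simp) (by simp) h) D.B D.Efl D.EA D.EAf D.Ecol
    (by
      intro e he
      rw [mem_Ecol]
      tauto) σ (fun e he e' he' h => hg.cinj ⟨he, by simp⟩ ⟨he', by simp⟩ h)
    (fun e he => hg.cval e he (by simp)) (by
      intro e he
      induction e using Sym2.ind with
      | _ x y =>
        have h1 := hg.fl x (by simp) y (by simp) he
        unfold T1 Thick at h1
        have h2 := ok.hfl1.trans h1
        simp only [Val_mk]
        exact_mod_cast h2) ok.hEA ok.hEAc ok.hEAfc D.lam ok.hfl2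
  · intro e he
    simp only [hval e he]
    exact ok.hA e he
  · intro c hc
    rw [filter_congr (fun e he => hval e he c)]
    exact ok.hB c hc
  · intro S hS K hK h1 h2
    obtain ⟨e, he, c, hc, h⟩ := ok.hole S hS K hK h1 h2
    exact ⟨e, he, c, hc, (hval e (hS he) c).2 h⟩

end Dat


/-- partial embeddings respecting parts -/
structure Pe {V W : Type*} (part : W → Bool) (Vs : Bool → Finset V) (S : Finset W) (τ : W → V) : Prop where
  inj : Set.InjOn τ S
  mem : ∀ z ∈ S, τ z ∈ Vs (part z)

lemma Pe.ext {V W : Type*} {part : W → Bool} {Vs : Bool → Finset V} {S : Finset W} {τ : W → V}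
    (h : Pe part Vs S τ) (L : Finset W) (hL : Disjoint S L) (ν : W → V) (hinj : Set.InjOn ν L)
    (hmem : ∀ z ∈ L, ν z ∈ Vs (part z)) (hnot : ∀ z ∈ L, ν z ∉ S.image τ) :
    ∃ τ' : W → V, Pe part Vs (S ∪ L) τ' ∧ (∀ z ∈ S, τ' z = τ z) ∧ (∀ z ∈ L, τ' z = ν z) := by
  have hd : ∀ z ∈ L, z ∉ S := fun z hz hs => disjoint_left.1 hL hs hz
  have e1 : ∀ z ∈ S, (if z ∈ S then τ z else ν z) = τ z := fun z hz => if_pos hz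
  have e2 : ∀ z ∈ L, (if z ∈ S then τ z else ν z) = ν z := fun z hz => if_neg (hd z hz)
  refine ⟨fun z => if z ∈ S then τ z else ν z, ⟨?_, ?_⟩, e1, e2⟩
  · intro x hx y hy hxy
    simp only [coe_union, Set.mem_union, mem_coe] at hx hy
    simp only at hxy
    rcases hx with hx | hx <;> rcases hy with hy | hy
    · rw [e1 x hx, e1 y hy] at hxy; exact h.inj hx hy hxy
    · rw [e1 x hx, e2 y hy] at hxy
      exact absurd (mem_image.2 ⟨x, hx, hxy⟩) (hnot y hy)
    · rw [e2 x hx, e1 y hy] at hxy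
      exact absurd (mem_image.2 ⟨y, hy, hxy.symm⟩) (hnot x hx)
    · rw [e2 x hx, e2 y hy] at hxy; exact hinj hx hy hxy
  · intro z hz
    rcases mem_union.1 hz with hz | hz
    · simp only [e1 z hz]; exact h.mem z hz
    · simp only [e2 z hz]; exact hmem z hz

lemma Pe.cover {V W : Type*} [Nonempty V] {part : W → Bool} {Vs : Bool → Finset V} {S : Finset W}
    {τ : W → V}
    (h : Pe part Vs S τ) (i : Bool) (Bad : Finset V) (hBad : Bad ⊆ Vs i) (P : Finset W)
    (hP : Disjoint S P) (hPi : ∀ z ∈ P, part z = i) (hc : Bad.card ≤ P.card) :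
    ∃ S' ⊆ P, ∃ τ' : W → V, Pe part Vs (S ∪ S') τ' ∧ (∀ z ∈ S, τ' z = τ z) ∧
      Bad ⊆ (S ∪ S').image τ' := by
  set B := Bad \ S.image τ with hB
  have hBc : B.card ≤ P.card := (card_le_card sdiff_subset).trans hc
  obtain ⟨S', hS', hcard⟩ := exists_subset_card_eq hBc
  obtain ⟨f⟩ : Nonempty (S' ≃ B) := ⟨Finset.equivOfCardEq hcard⟩
  set ν : W → V := fun z => if hz : z ∈ S' then (f ⟨z, hz⟩ : V) else Classical.arbitrary V with hν
  have eν : ∀ z (hz : z ∈ S'), ν z = f ⟨z, hz⟩ := fun z hz => dif_pos hz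
  have hνB : ∀ z ∈ S', ν z ∈ B := by
    intro z hz; rw [eν z hz]; exact (f ⟨z, hz⟩).2
  obtain ⟨τ', h1, h2, h3⟩ := h.ext S' (hP.mono_right hS') ν (by
      intro x hx y hy hxy
      rw [eν x hx, eν y hy] at hxy
      have := f.injective (Subtype.ext hxy)
      exact congrArg Subtype.val this)
    (fun z hz => by
      rw [hPi z (hS' hz)]
      exact hBad (mem_sdiff.1 (hνB z hz)).1)
    (fun z hz => (mem_sdiff.1 (hνB z hz)).2)
  refine ⟨S', hS', τ', h1, h2, ?_⟩
  intro v hv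
  by_cases hvS : v ∈ S.image τ
  · obtain ⟨x, hx, rfl⟩ := mem_image.1 hvS
    exact mem_image.2 ⟨x, mem_union_left _ hx, h2 x hx⟩
  · have hvB : v ∈ B := mem_sdiff.2 ⟨hv, hvS⟩
    obtain ⟨z, hz⟩ := f.surjective ⟨v, hvB⟩
    refine mem_image.2 ⟨z.1, mem_union_right _ z.2, ?_⟩
    rw [h3 z.1 z.2, eν z.1 z.2]
    simp [hz]

/-- Embedding the neighbourhoods of the set `I0` by the tuple lemma. -/
lemma tupleN {V W : Type*} [Nonempty V] [Fintype W] (H : SimpleGraph W) (T : V → V → Prop)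
    (P Q P0 Used : Finset V) (D : ℕ) (hΔ : 1 ≤ D) (hdeg : ∀ w, degOf H w ≤ D)
    (e q q1 : ℝ) (hq0 : 0 < q) (hq1 : q ≤ 1) (he : 0 < e) (hq10 : 0 ≤ q1) (hq11 : q1 ≤ 1)
    (hT : ∀ B ⊆ P, e ≤ (B.card : ℝ) →
      ((Q.filter (fun a => ((B.filter (fun b => T b a)).card : ℝ) < q * B.card)).card : ℝ) ≤ e)
    (heP : e ≤ q ^ D * P.card)
    (hP0 : ∀ v ∈ P0, q1 * Q.card ≤ ((Q.filter (fun a => T v a)).card : ℝ))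
    (hQ : 0 < Q.card) (I : Finset W) (hI : ∀ x ∈ I, ∀ x' ∈ I, ∀ y, H.Adj x y → H.Adj x' y → x = x')
    (ξ : ℝ)
    (hξ : D * (Used.card + D * I.card + D + e) ≤ ξ * Q.card) (hξ1 : ξ ≤ q1 ^ D / 2) (hξ2 : ξ ≤ 1 / 2)
    (t s1 : ℕ) (hη : 2 * D * e / Q.card ≤ 1)
    (hnum : (P0.card : ℝ) * (2 ^ t * (1 - q1 ^ D / 4) ^ I.card) +
      2 ^ (I.card + P.card) * (2 * D * e / Q.card) ^ s1 < 1) :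
    ∃ ν : W → V, Set.InjOn ν (NS H I) ∧ (∀ y ∈ NS H I, ν y ∈ Q ∧ ν y ∉ Used) ∧
      (∀ x ∈ I, ∃ Y ⊆ P, q ^ D * P.card ≤ (Y.card : ℝ) ∧ ∀ v ∈ Y, ∀ y, H.Adj x y → T v (ν y)) ∧
      (∀ v ∈ P0, ∃ J ⊆ I, t ≤ J.card ∧ ∀ x ∈ J, ∀ y, H.Adj x y → T v (ν y)) ∧
      (∀ S ⊆ I, ∀ B ⊆ P, s1 ≤ S.card → e ≤ q ^ D * B.card →
        ∃ x ∈ S, ∃ v ∈ B, ∀ y, H.Adj x y → T v (ν y)) := by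
  obtain ⟨g, g1, g2, g3, g4, g5⟩ := tuple (X := W) T P Q P0 Used D e q q1 hq0 hq1 he hq10 hq11 hT heP hP0 hQ
    I ξ hξ hξ1 hξ2 t s1 hη hnum
  have how : ∀ y, ∃ x, y ∈ NS H I → x ∈ I ∧ H.Adj x y := by
    intro y
    by_cases hy : y ∈ NS H I
    · obtain ⟨x, hx, hxy⟩ := (mem_NS H I y).1 hy
      exact ⟨x, fun _ => ⟨hx, hxy⟩⟩
    · exact ⟨y, fun h => absurd h hy⟩
  choose ow how using how
  have hidx : ∀ x, ∃ f : W → Fin D, Set.InjOn f ((univ : Finset W).filter (fun w => H.Adj x w)) := by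
    intro x
    have hc : ((univ : Finset W).filter (fun w => H.Adj x w)).card ≤ Fintype.card (Fin D) := by
      rw [Fintype.card_fin]; exact hdeg x
    haveI : Nonempty (Fin D) := ⟨⟨0, hΔ⟩⟩
    have : ∃ f : W → Fin D, Set.InjOn f (((univ : Finset W).filter (fun w => H.Adj x w)) : Finset W) ∧
        ∀ w ∈ (univ : Finset W).filter (fun w => H.Adj x w), f w ∈ (univ : Finset (Fin D)) :=
      list_choice _ (fun _ => (univ : Finset (Fin D))) (fun _ _ => by simpa using hc)
    exact ⟨this.choose, this.choose_spec.1⟩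
  choose idx hidx using hidx
  have eν : ∀ x ∈ I, ∀ y, H.Adj x y → g (ow y) (idx (ow y) y) = g x (idx x y) := by
    intro x hx y hxy
    have h := how y ((mem_NS H I y).2 ⟨x, hx, hxy⟩)
    have : ow y = x := hI _ h.1 x hx y h.2 hxy
    rw [this]
  refine ⟨fun y => g (ow y) (idx (ow y) y), ?_, ?_, ?_, ?_, ?_⟩
  · intro y hy y' hy' hyy
    have h := how y hy
    have h' := how y' hy'
    obtain ⟨e1, e2⟩ := g2 _ h.1 _ h'.1 _ _ hyy
    rw [e1] at e2
    apply hidx (ow y')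
    · simp only [coe_filter, mem_univ, true_and, Set.mem_setOf_eq]; rw [← e1]; exact h.2
    · simp only [coe_filter, mem_univ, true_and, Set.mem_setOf_eq]; exact h'.2
    · exact e2
  · intro y hy
    exact g1 _ (how y hy).1 _
  · intro x hx
    refine ⟨_, filter_subset _ _, g3 x hx, ?_⟩
    intro v hv y hxy
    simp only [eν x hx y hxy]
    exact (mem_filter.1 hv).2 _
  · intro v hv
    refine ⟨_, filter_subset _ _, g4 v hv, ?_⟩
    intro x hx y hxy
    simp only [eν x (mem_filter.1 hx).1 y hxy]
    exact (mem_filter.1 hx).2 _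
  · intro S hS B hB h1 h2
    obtain ⟨x, hx, v, hv, h⟩ := g5 S hS B hB h1 h2
    refine ⟨x, hx, v, hv, fun y hxy => ?_⟩
    simp only [eν x (hS hx) y hxy]
    exact h _


/-- ball of radius two -/
def Bl {W : Type*} (H : SimpleGraph W) (c w : W) : Prop := w = c ∨ H.Adj c w ∨ ∃ y, H.Adj c y ∧ H.Adj y w

/-- The data for the first half. -/
structure AD (V C W : Type*) where
  G : C → SimpleGraph V
  H : SimpleGraph W
  part : W → Bool
  Vs : Bool → Finset V
  X : Finset W
  Q : Finset W
  F : Finset W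
  GF : Finset W
  Γ : Finset W
  ty : W → ℕ
  nb : W → W
  lab : W → Finset W
  Δ : ℕ
  k : ℕ
  Mx : ℕ
  t : ℕ
  qR : ℕ
  t3 : ℕ
  s1 : ℕ
  s0 : ℕ
  L : ℕ
  n : ℕ
  q : ℝ
  α : ℝ
  κ : ℝ
  e : ℝ
  lamI : ℝ
  c0 : ℝ

namespace AD

set_option linter.unusedSectionVars false

variable {V C W : Type*} [Fintype C] [Fintype W]

/-- centres of type `j` -/
noncomputable def Cn (A : AD V C W) (j : ℕ) : Finset W := A.Γ.filter (fun c => A.ty c = j)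
/-- special vertex of a centre -/
def sp (A : AD V C W) (i : Bool) (c : W) : W := if i then A.nb c else c
/-- type for bad vertices -/
def jB (i : Bool) : ℕ := if i then 2 else 1
/-- type for the absorbing set -/
def jI (i : Bool) : ℕ := if i then 4 else 3
/-- absorbing set in part `i` -/
noncomputable def Ii (A : AD V C W) (i : Bool) : Finset W := (A.Cn (jI i)).image (A.sp i)
/-- absorbing set -/
noncomputable def I (A : AD V C W) : Finset W := A.Ii false ∪ A.Ii true
/-- ends of the edges used for absorbing colours -/
noncomputable def SA (A : AD V C W) : Finset W := A.Cn 0 ∪ (A.Cn 0).image A.nb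
/-- the thick graph -/
def T (A : AD V C W) : V → V → Prop := Thick A.G univ (A.α * Fintype.card C)
/-- reduced thick graph -/
def T1 (A : AD V C W) (B : Finset C) : V → V → Prop := Thick A.G B (A.q * B.card)
/-- owner relation -/
def O (A : AD V C W) (j : ℕ) (p : W) : Prop := ∃ c ∈ A.Γ, A.ty c = j ∧ Bl A.H c p

/-- Requirements. -/
structure Ok (A : AD V C W) : Prop where
  hbip : ∀ x y, A.H.Adj x y → A.part y = !(A.part x)
  hΔ : 1 ≤ A.Δ
  hdeg : ∀ w, degOf A.H w ≤ A.Δ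
  hVs : Disjoint (A.Vs false) (A.Vs true)
  hcard : ∀ i, ((univ : Finset W).filter (fun w => A.part w = i)).card = (A.Vs i).card
  hEH : (EH A.H).card = Fintype.card C
  he : 0 < A.e
  hq0 : 0 < A.q
  hq1 : A.q ≤ 1
  hTD : ∀ K : Finset C, A.k ≤ K.card → Typ (Thick A.G K (A.q * K.card)) A.Vs A.e A.q
  hXQ : Disjoint A.X A.Q
  hXF : Disjoint A.X A.F
  hQF : Disjoint A.Q A.F
  hQ : ∀ x ∈ A.Q, ∀ y, A.H.Adj x y → y ∈ A.Q ∨ y ∈ A.X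
  hF : ∀ x ∈ A.F, ∀ y, A.H.Adj x y → y ∈ A.F ∨ y ∈ A.X
  hlab : ∀ x y, A.H.Adj x y → x ∉ A.X → y ∉ A.X → A.lab x = A.lab y
  hMx : ∀ l, ((univ : Finset W).filter (fun w => w ∉ A.X ∧ A.lab w = l)).card ≤ A.Mx
  hGF : A.GF ⊆ A.F
  hGFc : A.GF.card = A.k
  hnbF : ∀ x ∈ A.GF, A.nb x ∈ A.F
  hnbadj : ∀ x ∈ A.GF, A.H.Adj x (A.nb x)
  hGFp : ∀ x ∈ A.GF, A.part x = false
  hGF1 : ∀ x ∈ A.GF, ∀ x' ∈ A.GF, A.H.Adj x (A.nb x') → x = x'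
  hGF2 : ∀ z, ∀ p ∈ A.GF ∪ A.GF.image A.nb, ∀ p' ∈ A.GF ∪ A.GF.image A.nb,
    A.H.Adj z p → A.H.Adj z p' → p = p'
  hGF3 : ∀ z, ∀ p ∈ A.GF ∪ A.GF.image A.nb, ∀ x ∈ A.X, A.H.Adj z p → ¬ A.H.Adj z x
  hn : ∀ i, A.n ≤ (A.Vs i).card
  hTdeg : ∀ i, ∀ v ∈ A.Vs i, A.q * A.n ≤ (((A.Vs (!i)).filter (fun u => A.T v u)).card : ℝ)
  hκ : ∀ c, A.κ * A.n ≤ (((A.Vs false).filter (fun u =>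
    A.κ * A.n ≤ (((A.Vs true).filter (fun w => (A.G c).Adj u w)).card : ℝ))).card : ℝ)
  hΓp : ∀ c ∈ A.Γ, A.part c = false
  hΓnb : ∀ c ∈ A.Γ, A.H.Adj c (A.nb c)
  hBQ : ∀ c ∈ A.Γ, ∀ p, Bl A.H c p → p ∈ A.Q
  hBX : ∀ c ∈ A.Γ, ∀ p, Bl A.H c p → ∀ x ∈ A.X, ¬ A.H.Adj p x ∧ ∀ z, A.H.Adj p z → ¬ A.H.Adj z x
  hfar : ∀ c ∈ A.Γ, ∀ c' ∈ A.Γ, ∀ p p', Bl A.H c p → Bl A.H c' p' →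
    (p = p' ∨ A.H.Adj p p' ∨ ∃ z, A.H.Adj z p ∧ A.H.Adj z p') → c = c'
  nQ : (A.X.card : ℝ) + 2 * A.Q.card + A.Δ * A.e < A.q ^ A.Δ * (A.q ^ A.Δ * A.n / 4)
  hα0 : 0 < A.α
  hα1 : A.α ≤ 1
  hαq : A.α ≤ A.q
  hL3 : 3 ≤ A.L
  hL : 4 / A.α ≤ (1 + (A.α / 4) ^ 2) ^ A.L
  ha : (A.Cn 0).card ≤ Fintype.card C
  ha4 : 4 ≤ A.α ^ A.L * (A.Cn 0).card
  hka : A.k ≤ A.α ^ A.L * (A.Cn 0).card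
  hBe : ∀ i, A.e ≤ (A.Cn (jB i)).card
  nξ : A.Δ * ((A.X.card : ℝ) + A.Q.card + A.Δ * A.Q.card + A.Δ + A.e) ≤ A.q ^ A.Δ / 2 * A.n
  nη : 2 * A.Δ * A.e ≤ A.q ^ A.Δ * A.n
  nnum : ∀ i, ((A.Vs i).card : ℝ) * (2 ^ A.t3 * (1 - A.q ^ A.Δ / 4) ^ (A.Cn (jI i)).card) +
      2 ^ ((A.Cn (jI i)).card + (A.Vs i).card) * (2 * A.Δ * A.e / (A.Vs (!i)).card) ^ A.s1 < 1
  nt3 : A.lamI ≤ A.t3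
  ns1 : A.s1 ≤ A.lamI
  nlam : A.e ≤ A.q ^ A.Δ * A.lamI
  hqR : 1 ≤ A.qR
  nR : (((3 + Fintype.card C) * Fintype.card W : ℕ) : ℝ) * A.qR * (2 ^ A.t * (1 - 1 / (2 * A.qR : ℝ)) ^ A.s0) < 1
  ns0 : (A.s0 : ℝ) + A.X.card + A.Q.card ≤ A.κ * A.n
  ns0' : (A.s0 : ℝ) + A.X.card + A.Q.card ≤ A.q ^ A.Δ * A.n / 2
  nRI : ∀ i, A.c0 + (A.Vs i).card / A.qR ≤ (A.Cn (jI i)).card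
  nT : (A.Q.card : ℝ) * (A.Δ + 1) ≤ A.α * Fintype.card C
  nfl : ((A.X.card : ℝ) + ((A.Cn 3).card + (A.Cn 4).card) * (1 + A.Δ) + A.F.card) * A.Δ ≤
    A.α / 4 * (A.α ^ A.L * (A.Cn 0).card)
  hc0 : 0 ≤ A.c0
  hn1 : A.c0 + A.X.card * A.Δ + 2 * A.k ≤ A.t
  hn2 : (A.Mx : ℝ) + A.Δ * A.e < A.q ^ A.Δ * A.c0
  hn3 : (A.F.card : ℝ) + A.Δ * A.e < A.q ^ A.Δ * A.c0
  hn4 : (A.Mx * A.Δ : ℝ) ≤ A.q * A.k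
  hn5 : A.X.card * A.Δ + A.k ≤ A.t
  hn6 : A.lamI + A.X.card * A.Δ + A.F.card ≤ A.t

variable {A : AD V C W}

lemma mem_Cn {j : ℕ} {c : W} : c ∈ A.Cn j ↔ c ∈ A.Γ ∧ A.ty c = j := mem_filter

lemma T_symm (A : AD V C W) (u v : V) (h : A.T u v) : A.T v u := Thick.symm h
lemma T1_symm (A : AD V C W) (B : Finset C) (u v : V) (h : A.T1 B u v) : A.T1 B v u := Thick.symm h

lemma Ok.q0 (ok : A.Ok) : 0 < A.q ^ A.Δ := pow_pos ok.hq0 _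
lemma Ok.q1 (ok : A.Ok) : A.q ^ A.Δ ≤ 1 := pow_le_one₀ ok.hq0.le ok.hq1

lemma Ok.qq (ok : A.Ok) : A.q ^ A.Δ ≤ A.q := by
  have := pow_le_pow_of_le_one ok.hq0.le ok.hq1 ok.hΔ
  simpa using this

lemma Ok.nQ' (ok : A.Ok) : (A.X.card : ℝ) + 2 * A.Q.card + A.Δ * A.e < A.q ^ A.Δ * A.n / 4 := by
  have h := ok.nQ
  have h1 := ok.q1
  have h2 : 0 ≤ A.q ^ A.Δ * A.n / 4 := by have := ok.q0; positivity
  nlinarith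

lemma Ok.Bl_sp (ok : A.Ok) (i : Bool) {c : W} (hc : c ∈ A.Γ) : Bl A.H c (A.sp i c) := by
  cases i
  · left; rfl
  · right; left; exact ok.hΓnb c hc

lemma Ok.part_sp (ok : A.Ok) (i : Bool) {c : W} (hc : c ∈ A.Γ) : A.part (A.sp i c) = i := by
  cases i
  · exact ok.hΓp c hc
  · have := ok.hbip _ _ (ok.hΓnb c hc)
    rw [ok.hΓp c hc] at this
    simpa [sp] using this

lemma Ok.Bl_nsp (ok : A.Ok) (i : Bool) {c y : W} (hc : c ∈ A.Γ) (h : A.H.Adj (A.sp i c) y) : Bl A.H c y := by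
  cases i
  · right; left; exact h
  · right; right; exact ⟨_, ok.hΓnb c hc, h⟩

lemma Ok.sp_inj (ok : A.Ok) (i : Bool) (j : ℕ) : Set.InjOn (A.sp i) (A.Cn j) := by
  intro x hx y hy hxy
  have hx' := (mem_Cn.1 hx).1
  have hy' := (mem_Cn.1 hy).1
  exact ok.hfar x hx' y hy' _ _ (ok.Bl_sp i hx') (ok.Bl_sp i hy') (Or.inl hxy)

lemma Ok.O_eq (ok : A.Ok) {j j' : ℕ} {p p' : W} (h : A.O j p) (h' : A.O j' p')
    (hp : p = p' ∨ A.H.Adj p p' ∨ ∃ z, A.H.Adj z p ∧ A.H.Adj z p') : j = j' := by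
  obtain ⟨c, hc, rfl, hb⟩ := h
  obtain ⟨c', hc', rfl, hb'⟩ := h'
  rw [ok.hfar c hc c' hc' p p' hb hb' hp]

lemma Ok.O_Q (ok : A.Ok) {j : ℕ} {p : W} (h : A.O j p) : p ∈ A.Q := by
  obtain ⟨c, hc, rfl, hb⟩ := h
  exact ok.hBQ c hc p hb

lemma Ok.O_X (ok : A.Ok) {j : ℕ} {p x : W} (h : A.O j p) (hx : x ∈ A.X) : ¬ A.H.Adj p x := by
  obtain ⟨c, hc, rfl, hb⟩ := h
  exact (ok.hBX c hc p hb x hx).1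

lemma Ok.O_XX (ok : A.Ok) {j : ℕ} {p x z : W} (h : A.O j p) (hx : x ∈ A.X) (hz : A.H.Adj p z) :
    ¬ A.H.Adj z x := by
  obtain ⟨c, hc, rfl, hb⟩ := h
  exact (ok.hBX c hc p hb x hx).2 z hz

lemma Ok.O_sp (ok : A.Ok) (i : Bool) {j : ℕ} {c : W} (hc : c ∈ A.Cn j) : A.O j (A.sp i c) :=
  ⟨c, (mem_Cn.1 hc).1, (mem_Cn.1 hc).2, ok.Bl_sp i (mem_Cn.1 hc).1⟩

lemma Ok.O_SA (ok : A.Ok) {p : W} (hp : p ∈ A.SA) : A.O 0 p := by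
  rcases mem_union.1 hp with h | h
  · exact ok.O_sp false h
  · obtain ⟨c, hc, rfl⟩ := mem_image.1 h
    exact ok.O_sp true hc

lemma Ok.O_Ii (ok : A.Ok) {i : Bool} {p : W} (hp : p ∈ A.Ii i) : A.O (jI i) p := by
  obtain ⟨c, hc, rfl⟩ := mem_image.1 hp
  exact ok.O_sp i hc

lemma Ok.part_Ii (ok : A.Ok) {i : Bool} {p : W} (hp : p ∈ A.Ii i) : A.part p = i := by
  obtain ⟨c, hc, rfl⟩ := mem_image.1 hp
  exact ok.part_sp i (mem_Cn.1 hc).1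

lemma Ok.O_NI (ok : A.Ok) {i : Bool} {p : W} (hp : p ∈ NS A.H (A.Ii i)) : A.O (jI i) p := by
  obtain ⟨x, hx, hxp⟩ := (mem_NS _ _ _).1 hp
  obtain ⟨c, hc, rfl⟩ := mem_image.1 hx
  exact ⟨c, (mem_Cn.1 hc).1, (mem_Cn.1 hc).2, ok.Bl_nsp i (mem_Cn.1 hc).1 hxp⟩

lemma Ok.part_NI (ok : A.Ok) {i : Bool} {p : W} (hp : p ∈ NS A.H (A.Ii i)) : A.part p = !i := by
  obtain ⟨x, hx, hxp⟩ := (mem_NS _ _ _).1 hp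
  rw [ok.hbip _ _ hxp, ok.part_Ii hx]

lemma jI_inj {i i' : Bool} (h : jI i = jI i') : i = i' := by
  cases i <;> cases i' <;> simp_all [jI]
lemma jB_inj {i i' : Bool} (h : jB i = jB i') : i = i' := by
  cases i <;> cases i' <;> simp_all [jB]
lemma jBI {i i' : Bool} (h : jB i = jI i') : False := by
  cases i <;> cases i' <;> simp_all [jI, jB]
lemma jB0 {i : Bool} (h : jB i = 0) : False := by cases i <;> simp_all [jB]
lemma jI0 {i : Bool} (h : jI i = 0) : False := by cases i <;> simp_all [jI]

lemma Ok.card_Ii (ok : A.Ok) (i : Bool) : (A.Ii i).card = (A.Cn (jI i)).card :=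
  card_image_of_injOn (ok.sp_inj i _)

/-- NI and I are disjoint -/
lemma Ok.NI_I (ok : A.Ok) {i i' : Bool} {p : W} (hp : p ∈ NS A.H (A.Ii i)) (h : p ∈ A.Ii i') : False := by
  have h1 := jI_inj (ok.O_eq (ok.O_NI hp) (ok.O_Ii h) (Or.inl rfl))
  have h2 := ok.part_NI hp
  have h3 := ok.part_Ii h
  rw [h3, h1] at h2
  cases i' <;> simp at h2

lemma Ok.part_eq (ok : A.Ok) {v : V} {i j : Bool} (hi : v ∈ A.Vs i) (hj : v ∈ A.Vs j) : i = j := by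
  have hd := ok.hVs
  rw [disjoint_left] at hd
  cases i <;> cases j
  · rfl
  · exact absurd hj (hd hi)
  · exact absurd hi (hd hj)
  · rfl

lemma Ok.typT (ok : A.Ok) : Typ A.T A.Vs A.e A.q := by
  have hk : A.k ≤ Fintype.card C := by
    have h1 := ok.hka
    have h2 : A.α ^ A.L ≤ 1 := pow_le_one₀ ok.hα0.le ok.hα1
    have h3 : (A.k : ℝ) ≤ (A.Cn 0).card := by
      have : (0:ℝ) ≤ (A.Cn 0).card := by positivity
      nlinarith
    have h4 : A.k ≤ (A.Cn 0).card := by exact_mod_cast h3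
    exact h4.trans ok.ha
  have h := ok.hTD univ (by simpa using hk)
  refine Typ.mono h ?_
  intro u v huv
  unfold T Thick at *
  refine le_trans ?_ huv
  rw [card_univ]
  exact mul_le_mul_of_nonneg_right ok.hαq (by positivity)

end AD


namespace AD

set_option linter.unusedSectionVars false

variable {V C W : Type*} [Fintype C] [Fintype W] {A : AD V C W}

lemma Ok.e_n (ok : A.Ok) : A.e ≤ A.q ^ A.Δ * A.n / 4 := by
  have h := ok.nQ'
  have h1 : (1:ℝ) ≤ A.Δ := by exact_mod_cast ok.hΔ
  have h2 := ok.he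
  have h3 : (0:ℝ) ≤ A.X.card := by positivity
  have h4 : (0:ℝ) ≤ A.Q.card := by positivity
  nlinarith

lemma Ok.n4 (ok : A.Ok) : A.q ^ A.Δ * A.n ≤ A.n := by
  have h1 := ok.q1
  have h2 : (0:ℝ) ≤ A.n := by positivity
  nlinarith

lemma Ok.SA_Q (ok : A.Ok) : A.SA ⊆ A.Q := fun p hp => ok.O_Q (ok.O_SA hp)

lemma Ok.stA (ok : A.Ok) [Nonempty V] : ∃ (τ : W → V) (A' : Finset W) (B : Finset C),
    Pe A.part A.Vs A.SA τ ∧ (∀ x ∈ A.SA, ∀ y ∈ A.SA, A.H.Adj x y → A.T (τ x) (τ y)) ∧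
    A' ⊆ A.Cn 0 ∧ A'.card = B.card ∧ A.α ^ A.L * (A.Cn 0).card ≤ (A'.card : ℝ) ∧
    (∀ x ∈ A', A.α / 2 * A'.card ≤ ((B.filter (fun c => (A.G c).Adj (τ x) (τ (A.nb x)))).card : ℝ)) ∧
    (∀ c ∈ B, A.α / 2 * A'.card ≤ ((A'.filter (fun x => (A.G c).Adj (τ x) (τ (A.nb x)))).card : ℝ)) ∧
    (∀ S ⊆ A', ∀ K ⊆ B, A.α / 4 * A'.card ≤ (S.card : ℝ) → A.α / 4 * A'.card ≤ (K.card : ℝ) →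
      ∃ x ∈ S, ∃ c ∈ K, (A.G c).Adj (τ x) (τ (A.nb x))) := by
  obtain ⟨τ, h1, h2, h3, h4⟩ := greedy A.H A.part ok.hbip A.Δ ok.hdeg ok.hΔ A.Vs A.T A.T_symm A.e A.q ok.he
    ok.hq0.le ok.hq1 ok.typT univ (fun z => A.Vs (A.part z)) (fun z _ => subset_rfl) A.n (by positivity)
    (fun z _ => by exact_mod_cast ok.hn _) A.SA (subset_univ _) (by
      have h := ok.nQ'
      have h1 : (A.SA.card : ℝ) ≤ A.Q.card := by exact_mod_cast card_le_card ok.SA_Q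
      have h2 : (0:ℝ) ≤ A.X.card := by positivity
      have h3 : (0:ℝ) ≤ A.Q.card := by positivity
      have h4 : 0 ≤ A.q ^ A.Δ * A.n := by have := ok.q0; positivity
      linarith)
  obtain ⟨A', hA', B, hB, e1, e2, e3, e4, e5⟩ := max_pair (fun x c => (A.G c).Adj (τ x) (τ (A.nb x)))
    (A.Cn 0) (univ : Finset C) A.α (A.α / 4) A.L ok.hα0 (by have := ok.hα0; positivity)
    (by have := ok.hα1; linarith) ok.hL3 (by
      have := ok.hL
      rwa [one_div_div]) (by simpa using ok.ha) (by
      intro x hx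
      have hx1 : x ∈ A.SA := mem_union_left _ hx
      have hx2 : A.nb x ∈ A.SA := mem_union_right _ (mem_image_of_mem _ hx)
      have := h3 x hx1 _ hx2 (ok.hΓnb x (mem_Cn.1 hx).1)
      unfold T Thick at this
      rw [card_univ]
      exact this) ok.ha4
  exact ⟨τ, A', B, ⟨h1, h2⟩, h3, hA', e1, e2, e3, e4, e5⟩

/-- the state after embedding everything that needs care -/
structure Mid (A : AD V C W) (B : Finset C) (A' S1 : Finset W) (τ : W → V) : Prop where
  pe : Pe A.part A.Vs ((S1 ∪ A.X) ∪ NS A.H (A.Ii false) ∪ NS A.H (A.Ii true)) τ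
  hSA1 : A.SA ⊆ S1
  hS1 : ∀ p ∈ S1, p ∈ A.SA ∨ ∃ i, ∃ c ∈ A.Cn (jB i), p = A.sp i c
  hA' : A' ⊆ A.Cn 0
  hBA : A'.card = B.card
  hs : A.α ^ A.L * (A.Cn 0).card ≤ (A'.card : ℝ)
  hA : ∀ x ∈ A', A.α / 2 * A'.card ≤ ((B.filter (fun c => (A.G c).Adj (τ x) (τ (A.nb x)))).card : ℝ)
  hB : ∀ c ∈ B, A.α / 2 * A'.card ≤ ((A'.filter (fun x => (A.G c).Adj (τ x) (τ (A.nb x)))).card : ℝ)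
  hole : ∀ S ⊆ A', ∀ K ⊆ B, A.α / 4 * A'.card ≤ (S.card : ℝ) → A.α / 4 * A'.card ≤ (K.card : ℝ) →
      ∃ x ∈ S, ∃ c ∈ K, (A.G c).Adj (τ x) (τ (A.nb x))
  hSA : ∀ x ∈ A.SA, ∀ y ∈ A.SA, A.H.Adj x y → A.T (τ x) (τ y)
  hX : ∀ x ∈ A.X, ∀ y ∈ A.X, A.H.Adj x y → A.T1 B (τ x) (τ y)
  hCX : ∀ z, ∃ Y ⊆ A.Vs (A.part z), A.q ^ A.Δ * A.n / 2 ≤ (Y.card : ℝ) ∧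
    ∀ v ∈ Y, ∀ x ∈ A.X, A.H.Adj z x → A.T1 B v (τ x)
  hbad : ∀ i, ∀ v ∈ A.Vs i, v ∉ S1.image τ →
    A.q * (A.Vs (!i)).card ≤ (((A.Vs (!i)).filter (fun u => A.T1 B v u)).card : ℝ)
  hI : ∀ i, ∀ x ∈ A.Ii i, ∃ Y ⊆ A.Vs i, A.q ^ A.Δ * A.n ≤ (Y.card : ℝ) ∧
    ∀ v ∈ Y, ∀ y, A.H.Adj x y → A.T1 B v (τ y)
  h5 : ∀ i, ∀ v ∈ A.Vs i, v ∉ S1.image τ → ∃ J ⊆ A.Ii i, A.t3 ≤ J.card ∧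
    ∀ x ∈ J, ∀ y, A.H.Adj x y → A.T1 B v (τ y)
  h6 : ∀ i, ∀ S ⊆ A.Ii i, ∀ U ⊆ A.Vs i, A.s1 ≤ S.card → A.e ≤ A.q ^ A.Δ * U.card →
    ∃ x ∈ S, ∃ v ∈ U, ∀ y, A.H.Adj x y → A.T1 B v (τ y)

/-- embedding the neighbourhood of one side of the absorbing set -/
lemma Ok.stN (ok : A.Ok) [Nonempty V] (B : Finset C) (hT1 : Typ (A.T1 B) A.Vs A.e A.q) (i : Bool)
    (S : Finset W) (τ : W → V) (hS : S ⊆ A.X ∪ A.Q) (hSN : Disjoint S (NS A.H (A.Ii i)))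
    (pe : Pe A.part A.Vs S τ) (P0 : Finset V) (hP0i : P0 ⊆ A.Vs i)
    (hP0 : ∀ v ∈ P0, A.q * (A.Vs (!i)).card ≤ (((A.Vs (!i)).filter (fun u => A.T1 B v u)).card : ℝ)) :
    ∃ τ' : W → V, Pe A.part A.Vs (S ∪ NS A.H (A.Ii i)) τ' ∧ (∀ z ∈ S, τ' z = τ z) ∧
      (∀ x ∈ A.Ii i, ∃ Y ⊆ A.Vs i, A.q ^ A.Δ * A.n ≤ (Y.card : ℝ) ∧
        ∀ v ∈ Y, ∀ y, A.H.Adj x y → A.T1 B v (τ' y)) ∧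
      (∀ v ∈ P0, ∃ J ⊆ A.Ii i, A.t3 ≤ J.card ∧
        ∀ x ∈ J, ∀ y, A.H.Adj x y → A.T1 B v (τ' y)) ∧
      (∀ S ⊆ A.Ii i, ∀ U ⊆ A.Vs i, A.s1 ≤ S.card → A.e ≤ A.q ^ A.Δ * U.card →
        ∃ x ∈ S, ∃ v ∈ U, ∀ y, A.H.Adj x y → A.T1 B v (τ' y)) := by
  have hni : (A.n : ℝ) ≤ (A.Vs i).card := by exact_mod_cast ok.hn i
  have hni' : (A.n : ℝ) ≤ (A.Vs (!i)).card := by exact_mod_cast ok.hn (!i)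
  have he := ok.he
  have hen := ok.e_n
  have hq0 := ok.q0
  have hq1 := ok.q1
  have hn4 := ok.n4
  have hΔ : (1:ℝ) ≤ A.Δ := by exact_mod_cast ok.hΔ
  have hn0 : (0:ℝ) < A.n := by
    by_contra hc
    have : (0:ℝ) ≤ A.n := by positivity
    have h0 : (A.n:ℝ) = 0 := by linarith
    rw [h0] at hen; linarith
  have hNpos : (0:ℝ) < (A.Vs (!i)).card := by linarith
  have hUsed : ((S.image τ).card : ℝ) ≤ A.X.card + A.Q.card := by
    exact_mod_cast card_image_le.trans ((card_le_card hS).trans (card_union_le _ _))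
  have hIQ : ((A.Ii i).card : ℝ) ≤ A.Q.card := by
    exact_mod_cast card_le_card (fun p hp => ok.O_Q (ok.O_Ii hp))
  have hqn : A.q ^ A.Δ * A.n ≤ A.q ^ A.Δ * (A.Vs i).card := mul_le_mul_of_nonneg_left hni hq0.le
  obtain ⟨ν, f1, f2, f3, f4, f5⟩ := tupleN A.H (A.T1 B) (A.Vs i) (A.Vs (!i)) P0 (S.image τ) A.Δ ok.hΔ ok.hdeg
    A.e A.q A.q ok.hq0 ok.hq1 ok.he ok.hq0.le ok.hq1 (by
      intro Bs hBs heB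
      have := hT1 (!i) Bs (by simpa using hBs) heB
      refine le_trans (le_of_eq ?_) this.le
      congr 2
      ext a
      simp only [mem_filter]
      have : (Bs.filter (fun b => A.T1 B b a)) = (Bs.filter (fun b => A.T1 B a b)) := by
        ext b
        simp only [mem_filter]
        exact ⟨fun h => ⟨h.1, A.T1_symm B _ _ h.2⟩, fun h => ⟨h.1, A.T1_symm B _ _ h.2⟩⟩
      rw [this])
    (by linarith) hP0 (by exact_mod_cast hNpos) (A.Ii i) (by
      intro x hx x' hx' y hxy hxy'
      obtain ⟨c, hc, rfl⟩ := mem_image.1 hx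
      obtain ⟨c', hc', rfl⟩ := mem_image.1 hx'
      rw [ok.hfar c (mem_Cn.1 hc).1 c' (mem_Cn.1 hc').1 _ _ (ok.Bl_sp i (mem_Cn.1 hc).1)
        (ok.Bl_sp i (mem_Cn.1 hc').1) (Or.inr (Or.inr ⟨y, hxy.symm, hxy'.symm⟩))])
    (A.q ^ A.Δ / 2) (by
      have h := ok.nξ
      have h1 : A.q ^ A.Δ / 2 * A.n ≤ A.q ^ A.Δ / 2 * (A.Vs (!i)).card :=
        mul_le_mul_of_nonneg_left hni' (by positivity)
      refine le_trans ?_ (h.trans h1)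
      apply mul_le_mul_of_nonneg_left _ (by positivity)
      have : (A.Δ : ℝ) * (A.Ii i).card ≤ A.Δ * A.Q.card := mul_le_mul_of_nonneg_left hIQ (by positivity)
      linarith) le_rfl (by linarith) A.t3 A.s1
    (by
      rw [div_le_one hNpos]
      have := ok.nη
      linarith)
    (by
      have h := ok.nnum i
      rw [ok.card_Ii]
      refine lt_of_le_of_lt ?_ h
      apply add_le_add _ le_rfl
      apply mul_le_mul_of_nonneg_right
      · exact_mod_cast card_le_card hP0i
      · have : 0 ≤ 1 - A.q ^ A.Δ / 4 := by linarith
        positivity)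
  obtain ⟨τ', p1, p2, p3⟩ := pe.ext (NS A.H (A.Ii i)) hSN ν f1 (fun z hz => by
    rw [ok.part_NI hz]; exact (f2 z hz).1) (fun z hz => (f2 z hz).2)
  have key : ∀ x ∈ A.Ii i, ∀ y, A.H.Adj x y → τ' y = ν y := fun x hx y hxy =>
    p3 y ((mem_NS _ _ _).2 ⟨x, hx, hxy⟩)
  refine ⟨τ', p1, p2, ?_, ?_, ?_⟩
  · intro x hx
    obtain ⟨Y, hY, hc, h⟩ := f3 x hx
    refine ⟨Y, hY, hqn.trans hc, fun v hv y hxy => ?_⟩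
    rw [key x hx y hxy]; exact h v hv y hxy
  · intro v hv
    obtain ⟨J, hJ, hc, h⟩ := f4 v hv
    refine ⟨J, hJ, hc, fun x hx y hxy => ?_⟩
    rw [key x (hJ hx) y hxy]; exact h x hx y hxy
  · intro S hS U hU h1 h2
    obtain ⟨x, hx, v, hv, h⟩ := f5 S hS U hU h1 h2
    refine ⟨x, hx, v, hv, fun y hxy => ?_⟩
    rw [key x (hS hx) y hxy]; exact h y hxy

end AD


namespace AD

set_option linter.unusedSectionVars false

variable {V C W : Type*} [Fintype C] [Fintype W] {A : AD V C W}

lemma Ok.S1_O (ok : A.Ok) {p : W} (h : p ∈ A.SA ∨ ∃ i, ∃ c ∈ A.Cn (jB i), p = A.sp i c) :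
    A.O 0 p ∨ ∃ i, A.O (jB i) p := by
  rcases h with h | ⟨i, c, hc, rfl⟩
  · exact Or.inl (ok.O_SA h)
  · exact Or.inr ⟨i, ok.O_sp i hc⟩

lemma Ok.S1_NI (ok : A.Ok) {p : W} (h : p ∈ A.SA ∨ ∃ i, ∃ c ∈ A.Cn (jB i), p = A.sp i c) {i : Bool}
    (hj : A.O (jI i) p) : False := by
  rcases ok.S1_O h with h | ⟨i', h⟩
  · exact jI0 (ok.O_eq hj h (Or.inl rfl))
  · exact jBI (ok.O_eq h hj (Or.inl rfl))

lemma Ok.S1_Q (ok : A.Ok) {p : W} (h : p ∈ A.SA ∨ ∃ i, ∃ c ∈ A.Cn (jB i), p = A.sp i c) : p ∈ A.Q := by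
  rcases ok.S1_O h with h | ⟨i', h⟩
  · exact ok.O_Q h
  · exact ok.O_Q h

set_option maxHeartbeats 1000000 in
lemma Ok.mid (ok : A.Ok) [Nonempty V] : ∃ (B : Finset C) (A' S1 : Finset W) (τ : W → V), A.Mid B A' S1 τ := by
  obtain ⟨τ1, A', B, pe1, hSA, hA', hBA, hs, hA, hB, hole⟩ := ok.stA
  have hT1 : Typ (A.T1 B) A.Vs A.e A.q := by
    apply ok.hTD B
    have h1 := ok.hka
    rw [← hBA]
    exact_mod_cast h1.trans hs
  have hbadc : ∀ i, (((A.Vs i).filter (fun v =>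
      (((A.Vs (!i)).filter (fun u => A.T1 B v u)).card : ℝ) < A.q * (A.Vs (!i)).card)).card : ℝ) < A.e := by
    intro i
    apply hT1 i (A.Vs (!i)) subset_rfl
    have h1 : (A.n : ℝ) ≤ (A.Vs (!i)).card := by exact_mod_cast ok.hn (!i)
    have := ok.e_n
    have := ok.n4
    linarith [(Nat.cast_nonneg A.n : (0:ℝ) ≤ A.n)]
  obtain ⟨Bad, hBadd⟩ : ∃ Bad : Bool → Finset V, ∀ i, Bad i = ((A.Vs i).filter (fun v =>
      (((A.Vs (!i)).filter (fun u => A.T1 B v u)).card : ℝ) < A.q * (A.Vs (!i)).card)) := ⟨_, fun _ => rfl⟩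
  have hBc : ∀ i, (Bad i).card ≤ ((A.Cn (jB i)).image (A.sp i)).card := by
    intro i
    rw [card_image_of_injOn (ok.sp_inj i _)]
    have h1 := hbadc i
    have h2 := ok.hBe i
    rw [← hBadd i] at h1
    have h3 : ((Bad i).card : ℝ) ≤ (A.Cn (jB i)).card := by linarith
    exact_mod_cast h3
  have hBsub : ∀ i, Bad i ⊆ A.Vs i := by
    intro i; rw [hBadd i]; exact filter_subset _ _
  have hpool : ∀ i, ∀ z ∈ (A.Cn (jB i)).image (A.sp i), A.O (jB i) z ∧ A.part z = i := by
    intro i z hz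
    obtain ⟨c, hc, rfl⟩ := mem_image.1 hz
    exact ⟨ok.O_sp i hc, ok.part_sp i (mem_Cn.1 hc).1⟩
  -- covering bad vertices
  obtain ⟨S2, hS2, τ2, pe2, ag2, cov2⟩ := pe1.cover false (Bad false) (hBsub _)
    ((A.Cn (jB false)).image (A.sp false))
    (by
      rw [disjoint_left]
      intro z hz hz'
      exact jB0 (ok.O_eq (hpool _ z hz').1 (ok.O_SA hz) (Or.inl rfl)))
    (fun z hz => (hpool _ z hz).2) (hBc _)
  obtain ⟨S3, hS3, τ3, pe3, ag3, cov3⟩ := pe2.cover true (Bad true) (hBsub _)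
    ((A.Cn (jB true)).image (A.sp true))
    (by
      rw [disjoint_left]
      intro z hz hz'
      rcases mem_union.1 hz with hz | hz
      · exact jB0 (ok.O_eq (hpool _ z hz').1 (ok.O_SA hz) (Or.inl rfl))
      · have := jB_inj (ok.O_eq (hpool _ z hz').1 (hpool _ z (hS2 hz)).1 (Or.inl rfl))
        simp at this)
    (fun z hz => (hpool _ z hz).2) (hBc _)
  obtain ⟨S1, hS1d⟩ : ∃ S1, S1 = A.SA ∪ S2 ∪ S3 := ⟨_, rfl⟩
  rw [← hS1d] at pe3 cov3
  have hSA1 : A.SA ⊆ S1 := by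
    rw [hS1d]; exact subset_union_left.trans subset_union_left
  have hS1 : ∀ p ∈ S1, p ∈ A.SA ∨ ∃ i, ∃ c ∈ A.Cn (jB i), p = A.sp i c := by
    intro p hp
    rw [hS1d] at hp
    rcases mem_union.1 hp with hp | hp
    · rcases mem_union.1 hp with hp | hp
      · exact Or.inl hp
      · obtain ⟨c, hc, h⟩ := mem_image.1 (hS2 hp)
        exact Or.inr ⟨false, c, hc, h.symm⟩
    · obtain ⟨c, hc, h⟩ := mem_image.1 (hS3 hp)
      exact Or.inr ⟨true, c, hc, h.symm⟩
  have cov : ∀ i, Bad i ⊆ S1.image τ3 := by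
    intro i
    cases i
    · intro v hv
      obtain ⟨x, hx, rfl⟩ := mem_image.1 (cov2 hv)
      refine mem_image.2 ⟨x, ?_, ag3 x hx⟩
      rw [hS1d]; exact mem_union_left _ hx
    · exact cov3
  have ag13 : ∀ z ∈ A.SA, τ3 z = τ1 z := fun z hz => by
    rw [ag3 z (mem_union_left _ hz), ag2 z hz]
  -- embedding X
  have hS1Q : S1 ⊆ A.Q := fun p hp => ok.S1_Q (hS1 p hp)
  have hS1c : ((S1.image τ3).card : ℝ) ≤ A.Q.card := by
    exact_mod_cast card_image_le.trans (card_le_card hS1Q)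
  have hQ' := ok.nQ'
  have hX0 : (0:ℝ) ≤ A.X.card := by positivity
  have hQ0 : (0:ℝ) ≤ A.Q.card := by positivity
  have hn0 : (0:ℝ) ≤ A.n := by positivity
  have hΔe : 0 ≤ A.Δ * A.e := by have := ok.he; positivity
  have hn4 := ok.n4
  obtain ⟨νX, x1, x2, x3, x4⟩ := greedy A.H A.part ok.hbip A.Δ ok.hdeg ok.hΔ A.Vs (A.T1 B) (A.T1_symm B) A.e A.q
    ok.he ok.hq0.le ok.hq1 hT1 univ (fun z => A.Vs (A.part z) \ S1.image τ3) (fun z _ => sdiff_subset)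
    (A.n / 2) (by positivity) (by
      intro z _
      have h1 : (A.n : ℝ) ≤ (A.Vs (A.part z)).card := by exact_mod_cast ok.hn _
      have h2 := le_card_sdiff (S1.image τ3) (A.Vs (A.part z))
      have h3 : ((A.Vs (A.part z)).card : ℝ) ≤ (A.Vs (A.part z) \ S1.image τ3).card + (S1.image τ3).card := by
        exact_mod_cast (by omega :
          (A.Vs (A.part z)).card ≤ (A.Vs (A.part z) \ S1.image τ3).card + (S1.image τ3).card)
      linarith) A.X (subset_univ _) (by linarith)
  obtain ⟨τ4, pe4, ag4, agX⟩ := pe3.ext A.X (disjoint_left.2 fun z hz hx =>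
      disjoint_left.1 ok.hXQ hx (hS1Q hz)) νX x1 (fun z hz => (mem_sdiff.1 (x2 z hz)).1)
      (fun z hz => (mem_sdiff.1 (x2 z hz)).2)
  -- nonbad
  have hnb : ∀ i, ∀ v ∈ A.Vs i, v ∉ S1.image τ3 →
      A.q * (A.Vs (!i)).card ≤ (((A.Vs (!i)).filter (fun u => A.T1 B v u)).card : ℝ) := by
    intro i v hv hvS
    by_contra hc
    push Not at hc
    apply hvS
    apply cov i
    rw [hBadd i, mem_filter]
    exact ⟨hv, hc⟩
  have hXN : ∀ i, Disjoint A.X (NS A.H (A.Ii i)) := fun i => disjoint_left.2 fun z hz hn =>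
    disjoint_left.1 ok.hXQ hz (ok.O_Q (ok.O_NI hn))
  have hSN : ∀ i, Disjoint S1 (NS A.H (A.Ii i)) := fun i => disjoint_left.2 fun z hz hn =>
    ok.S1_NI (hS1 z hz) (ok.O_NI hn)
  have hNsub : ∀ i, NS A.H (A.Ii i) ⊆ A.X ∪ A.Q := fun i z hz => mem_union_right _ (ok.O_Q (ok.O_NI hz))
  have hSX : S1 ∪ A.X ⊆ A.X ∪ A.Q := union_subset (hS1Q.trans subset_union_right) subset_union_left
  obtain ⟨τ5, pe5, ag5, i1, i2, i3⟩ := ok.stN B hT1 false (S1 ∪ A.X) τ4 hSX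
    (disjoint_union_left.2 ⟨hSN _, hXN _⟩) pe4 (A.Vs false \ S1.image τ3) sdiff_subset
    (fun v hv => hnb false v (mem_sdiff.1 hv).1 (mem_sdiff.1 hv).2)
  obtain ⟨τ6, pe6, ag6, j1, j2, j3⟩ := ok.stN B hT1 true (S1 ∪ A.X ∪ NS A.H (A.Ii false)) τ5
    (union_subset hSX (hNsub _))
    (disjoint_union_left.2 ⟨disjoint_union_left.2 ⟨hSN _, hXN _⟩, disjoint_left.2 fun z hz hz' => by
      have := jI_inj (ok.O_eq (ok.O_NI hz) (ok.O_NI hz') (Or.inl rfl))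
      simp at this⟩) pe5 (A.Vs true \ S1.image τ3) sdiff_subset
    (fun v hv => hnb true v (mem_sdiff.1 hv).1 (mem_sdiff.1 hv).2)
  have agS : ∀ z ∈ S1, τ6 z = τ3 z := fun z hz => by
    rw [ag6 z (mem_union_left _ (mem_union_left _ hz)), ag5 z (mem_union_left _ hz), ag4 z hz]
  have agSA : ∀ z ∈ A.SA, τ6 z = τ1 z := fun z hz => by rw [agS z (hSA1 hz), ag13 z hz]
  have agXX : ∀ z ∈ A.X, τ6 z = νX z := fun z hz => by
    rw [ag6 z (mem_union_left _ (mem_union_right _ hz)), ag5 z (mem_union_right _ hz), agX z hz]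
  have agN : ∀ x ∈ A.Ii false, ∀ y, A.H.Adj x y → τ6 y = τ5 y := fun x hx y hxy =>
    ag6 y (mem_union_right _ ((mem_NS _ _ _).2 ⟨x, hx, hxy⟩))
  have him : S1.image τ6 = S1.image τ3 := image_congr fun z hz => agS z hz
  have hA0 : ∀ x ∈ A', τ6 x = τ1 x ∧ τ6 (A.nb x) = τ1 (A.nb x) := fun x hx =>
    ⟨agSA x (mem_union_left _ (hA' hx)), agSA _ (mem_union_right _ (mem_image_of_mem _ (hA' hx)))⟩
  refine ⟨B, A', S1, τ6, ⟨pe6, hSA1, hS1, hA', hBA, hs, ?_, ?_, ?_, ?_, ?_, ?_, ?_, ?_, ?_, ?_⟩⟩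
  · intro x hx
    rw [(hA0 x hx).1, (hA0 x hx).2]; exact hA x hx
  · intro c hc
    have : A'.filter (fun x => (A.G c).Adj (τ6 x) (τ6 (A.nb x))) =
        A'.filter (fun x => (A.G c).Adj (τ1 x) (τ1 (A.nb x))) := by
      apply filter_congr
      intro x hx
      rw [(hA0 x hx).1, (hA0 x hx).2]
    rw [this]; exact hB c hc
  · intro S hS K hK h1 h2
    obtain ⟨x, hx, c, hc, h⟩ := hole S hS K hK h1 h2
    refine ⟨x, hx, c, hc, ?_⟩
    rw [(hA0 x (hS hx)).1, (hA0 x (hS hx)).2]; exact h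
  · intro x hx y hy hxy
    rw [agSA x hx, agSA y hy]; exact hSA x hx y hy hxy
  · intro x hx y hy hxy
    rw [agXX x hx, agXX y hy]; exact x3 x hx y hy hxy
  · intro z
    refine ⟨_, (filter_subset _ _).trans sdiff_subset, le_trans (by linarith) (x4 z (mem_univ z)), ?_⟩
    intro v hv x hx hzx
    rw [agXX x hx]
    exact (mem_filter.1 hv).2 x hx hzx
  · intro i v hv hvS
    rw [him] at hvS
    exact hnb i v hv hvS
  · intro i
    cases i
    · intro x hx
      obtain ⟨Y, hY, hc, h⟩ := i1 x hx
      refine ⟨Y, hY, hc, fun v hv y hxy => ?_⟩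
      rw [agN x hx y hxy]; exact h v hv y hxy
    · exact j1
  · intro i v hv hvS
    rw [him] at hvS
    cases i
    · obtain ⟨J, hJ, hc, h⟩ := i2 v (mem_sdiff.2 ⟨hv, hvS⟩)
      refine ⟨J, hJ, hc, fun x hx y hxy => ?_⟩
      rw [agN x (hJ hx) y hxy]; exact h x hx y hxy
    · exact j2 v (mem_sdiff.2 ⟨hv, hvS⟩)
  · intro i
    cases i
    · intro S hS U hU h1 h2
      obtain ⟨x, hx, v, hv, h⟩ := i3 S hS U hU h1 h2
      refine ⟨x, hx, v, hv, fun y hxy => ?_⟩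
      rw [agN x (hS hx) y hxy]; exact h y hxy
    · exact j3

end AD


namespace AD

set_option linter.unusedSectionVars false

variable {V C W : Type*} [Fintype C] [Fintype W] {A : AD V C W}

/-- domain of the middle state -/
noncomputable def SN (A : AD V C W) (S1 : Finset W) : Finset W :=
  (S1 ∪ A.X) ∪ NS A.H (A.Ii false) ∪ NS A.H (A.Ii true)

lemma Ok.SN_sub (ok : A.Ok) {B : Finset C} {A' S1 : Finset W} {τ : W → V} (m : A.Mid B A' S1 τ) :
    A.SN S1 ⊆ A.X ∪ A.Q := by
  intro z hz
  unfold SN at hz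
  simp only [mem_union] at hz ⊢
  rcases hz with ((h | h) | h) | h
  · exact Or.inr (ok.S1_Q (m.hS1 z h))
  · exact Or.inl h
  · exact Or.inr (ok.O_Q (ok.O_NI h))
  · exact Or.inr (ok.O_Q (ok.O_NI h))

lemma Ok.resI (ok : A.Ok) {B : Finset C} {A' S1 : Finset W} {τ : W → V} (m : A.Mid B A' S1 τ) (i : Bool)
    (extra : Finset (Finset V)) (hex : extra.card ≤ Fintype.card C * Fintype.card W)
    (hexi : ∀ S ∈ extra, S ⊆ A.Vs i ∧ A.κ * A.n ≤ (S.card : ℝ)) :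
    ∃ R ⊆ A.Vs i \ (A.SN S1).image τ, R.card * A.qR ≤ (A.Vs i).card ∧
      (∀ z, A.part z = i → ∃ Y ⊆ R, A.t ≤ Y.card ∧ ∀ v ∈ Y, ∀ x ∈ A.X, A.H.Adj z x → A.T1 B v (τ x)) ∧
      (∀ z ∈ A.Ii i, ∃ Y ⊆ R, A.t ≤ Y.card ∧ ∀ v ∈ Y, ∀ y, A.H.Adj z y → A.T1 B v (τ y)) ∧
      (∀ v ∈ A.Vs (!i), v ∉ S1.image τ → A.t ≤ (R.filter (fun u => A.T1 B v u)).card) ∧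
      (∀ S ∈ extra, A.t ≤ (S ∩ R).card) := by
  have hused : (((A.SN S1).image τ).card : ℝ) ≤ A.X.card + A.Q.card := by
    exact_mod_cast card_image_le.trans ((card_le_card (ok.SN_sub m)).trans (card_union_le _ _))
  have hbig : ∀ S ⊆ A.Vs i, (A.s0 : ℝ) + A.X.card + A.Q.card ≤ S.card →
      A.s0 ≤ (S ∩ (A.Vs i \ (A.SN S1).image τ)).card := by
    intro S hS hc
    have h1 : S \ (A.SN S1).image τ ⊆ S ∩ (A.Vs i \ (A.SN S1).image τ) := by
      intro v hv
      rw [mem_sdiff] at hv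
      exact mem_inter.2 ⟨hv.1, mem_sdiff.2 ⟨hS hv.1, hv.2⟩⟩
    refine le_trans ?_ (card_le_card h1)
    have h2 := le_card_sdiff ((A.SN S1).image τ) S
    have h3 : (S.card : ℝ) ≤ (S \ (A.SN S1).image τ).card + ((A.SN S1).image τ).card := by
      exact_mod_cast (by omega : S.card ≤ (S \ (A.SN S1).image τ).card + ((A.SN S1).image τ).card)
    have h4 : (A.s0 : ℝ) ≤ (S \ (A.SN S1).image τ).card := by linarith
    exact_mod_cast h4
  choose CX hCX using m.hCX
  have hI : ∀ x, ∃ Y : Finset V, x ∈ A.Ii i → Y ⊆ A.Vs i ∧ A.q ^ A.Δ * A.n ≤ (Y.card : ℝ) ∧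
    ∀ v ∈ Y, ∀ y, A.H.Adj x y → A.T1 B v (τ y) := by
    intro x
    by_cases hx : x ∈ A.Ii i
    · obtain ⟨Y, h⟩ := m.hI i x hx
      exact ⟨Y, fun _ => h⟩
    · exact ⟨∅, fun h => absurd h hx⟩
  choose YI hYI using hI
  obtain ⟨J, hJ⟩ : ∃ J, J = ((univ : Finset W).filter (fun z => A.part z = i)).image CX ∪ (A.Ii i).image YI ∪
    ((A.Vs (!i)).filter (fun v => v ∉ S1.image τ)).image
      (fun v => (A.Vs i).filter (fun u => A.T1 B v u)) ∪ extra := ⟨_, rfl⟩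
  have hq0 := ok.q0
  have hs0' := ok.ns0'
  have hJs : ∀ S ∈ J, A.s0 ≤ (S ∩ (A.Vs i \ (A.SN S1).image τ)).card := by
    intro S hS
    rw [hJ] at hS
    simp only [mem_union, mem_image, mem_filter, mem_univ, true_and] at hS
    rcases hS with ((⟨z, hz, rfl⟩ | ⟨x, hx, rfl⟩) | ⟨v, hv, rfl⟩) | hS
    · apply hbig _ (hz ▸ (hCX z).1)
      linarith [(hCX z).2.1]
    · apply hbig _ (hYI x hx).1
      have := (hYI x hx).2.1
      have h0 : 0 ≤ A.q ^ A.Δ * A.n := by positivity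
      linarith
    · apply hbig _ (filter_subset _ _)
      have h1 := m.hbad (!i) v hv.1 (by simpa using hv.2)
      rw [Bool.not_not] at h1
      have h2 : (A.n : ℝ) ≤ (A.Vs i).card := by exact_mod_cast ok.hn i
      have h3 := ok.qq
      have h4 := ok.hq0
      have h5 : A.q ^ A.Δ * A.n ≤ A.q * (A.Vs i).card := by
        apply mul_le_mul h3 h2 (by positivity) h4.le
      have h0 : 0 ≤ A.q ^ A.Δ * A.n := by positivity
      linarith
    · apply hbig _ (hexi S hS).1
      linarith [(hexi S hS).2, ok.ns0]
  have hJc : J.card ≤ (3 + Fintype.card C) * Fintype.card W := by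
    rw [hJ]
    have e1 : (((univ : Finset W).filter (fun z => A.part z = i)).image CX).card ≤ Fintype.card W :=
      card_image_le.trans (card_le_univ _)
    have e2 : ((A.Ii i).image YI).card ≤ Fintype.card W := card_image_le.trans (card_le_univ _)
    have e3 : (((A.Vs (!i)).filter (fun v => v ∉ S1.image τ)).image
      (fun v => (A.Vs i).filter (fun u => A.T1 B v u))).card ≤ Fintype.card W := by
      refine card_image_le.trans ((card_le_card (filter_subset _ _)).trans ?_)
      rw [← ok.hcard (!i)]
      exact card_le_univ _
    refine (card_union_le _ _).trans ?_
    have := card_union_le (((univ : Finset W).filter (fun z => A.part z = i)).image CX ∪ (A.Ii i).image YI)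
      (((A.Vs (!i)).filter (fun v => v ∉ S1.image τ)).image
      (fun v => (A.Vs i).filter (fun u => A.T1 B v u)))
    have := card_union_le (((univ : Finset W).filter (fun z => A.part z = i)).image CX) ((A.Ii i).image YI)
    rw [add_mul]
    omega
  obtain ⟨R, hR, hRc, hRJ⟩ := reserve (A.Vs i \ (A.SN S1).image τ) A.qR ok.hqR J A.s0 A.t hJs (by
    refine lt_of_le_of_lt ?_ ok.nR
    have hqR : (1:ℝ) ≤ A.qR := by exact_mod_cast ok.hqR
    have h0 : 0 ≤ 1 - 1 / (2 * A.qR : ℝ) := by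
      rw [sub_nonneg, div_le_one (by positivity)]; linarith
    apply mul_le_mul_of_nonneg_right _ (by positivity)
    apply mul_le_mul_of_nonneg_right _ (by positivity)
    exact_mod_cast hJc)
  have hRV : R ⊆ A.Vs i := hR.trans sdiff_subset
  refine ⟨R, hR, hRc.trans (card_le_card sdiff_subset), ?_, ?_, ?_, ?_⟩
  · intro z hz
    refine ⟨CX z ∩ R, inter_subset_right, hRJ _ ?_, ?_⟩
    · rw [hJ]
      simp only [mem_union]
      left; left; left
      exact mem_image_of_mem _ (by simp [hz])
    · intro v hv x hx hzx
      exact (hCX z).2.2 v (mem_inter.1 hv).1 x hx hzx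
  · intro z hz
    refine ⟨YI z ∩ R, inter_subset_right, hRJ _ ?_, ?_⟩
    · rw [hJ]
      simp only [mem_union]
      left; left; right
      exact mem_image_of_mem _ hz
    · intro v hv y hzx
      exact (hYI z hz).2.2 v (mem_inter.1 hv).1 y hzx
  · intro v hv hvS
    have h := hRJ ((A.Vs i).filter (fun u => A.T1 B v u)) (by
      rw [hJ]
      simp only [mem_union]
      left; right
      exact mem_image.2 ⟨v, mem_filter.2 ⟨hv, hvS⟩, rfl⟩)
    refine h.trans (card_le_card ?_)
    intro u hu
    rw [mem_inter, mem_filter] at hu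
    exact mem_filter.2 ⟨hu.2, hu.1.2⟩
  · intro S hS
    apply hRJ
    rw [hJ]
    exact mem_union_right _ hS

lemma Ok.res (ok : A.Ok) {B : Finset C} {A' S1 : Finset W} {τ : W → V} (m : A.Mid B A' S1 τ) :
    ∃ R : Bool → Finset V, (∀ i, R i ⊆ A.Vs i \ (A.SN S1).image τ) ∧
      (∀ i, (R i).card * A.qR ≤ (A.Vs i).card) ∧
      (∀ z, ∃ Y ⊆ R (A.part z), A.t ≤ Y.card ∧ ∀ v ∈ Y, ∀ x ∈ A.X, A.H.Adj z x → A.T1 B v (τ x)) ∧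
      (∀ i, ∀ z ∈ A.Ii i, ∃ Y ⊆ R i, A.t ≤ Y.card ∧ ∀ v ∈ Y, ∀ y, A.H.Adj z y → A.T1 B v (τ y)) ∧
      (∀ i, ∀ v ∈ A.Vs i, v ∉ S1.image τ → A.t ≤ ((R (!i)).filter (fun u => A.T1 B v u)).card) ∧
      (∀ c, A.t ≤ ((R false).filter (fun u => A.t ≤ ((R true).filter (fun w => (A.G c).Adj u w)).card)).card) := by
  have hW : 0 < Fintype.card W := by
    by_contra hc
    have h0 : Fintype.card W = 0 := by omega
    have h1 := ok.hcard false
    have h2 : ((univ : Finset W).filter (fun w => A.part w = false)).card ≤ 0 := by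
      rw [← h0]; exact card_le_univ _
    have h3 := ok.hn false
    have h4 : A.n = 0 := by omega
    have h5 := ok.nQ'
    rw [h4] at h5
    have h6 : 0 ≤ A.Δ * A.e := by have := ok.he; positivity
    have h7 : (0:ℝ) ≤ A.X.card := by positivity
    have h8 : (0:ℝ) ≤ A.Q.card := by positivity
    norm_num at h5
    linarith
  obtain ⟨R1, a1, a2, a3, a4, a5, a6⟩ := ok.resI m true
    ((((univ : Finset C) ×ˢ (A.Vs false)).filter (fun p =>
      A.κ * A.n ≤ (((A.Vs true).filter (fun w => (A.G p.1).Adj p.2 w)).card : ℝ))).image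
      (fun p => (A.Vs true).filter (fun w => (A.G p.1).Adj p.2 w)))
    (by
      refine card_image_le.trans ((card_le_card (filter_subset _ _)).trans ?_)
      rw [card_product, card_univ]
      apply Nat.mul_le_mul_left
      rw [← ok.hcard false]
      exact card_le_univ _)
    (by
      intro S hS
      obtain ⟨p, hp, rfl⟩ := mem_image.1 hS
      exact ⟨filter_subset _ _, (mem_filter.1 hp).2⟩)
  have a7 : ∀ c, ∀ u ∈ A.Vs false, A.κ * A.n ≤ (((A.Vs true).filter (fun w => (A.G c).Adj u w)).card : ℝ) →
      A.t ≤ (R1.filter (fun w => (A.G c).Adj u w)).card := by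
    intro c u hu hc
    have h := a6 ((A.Vs true).filter (fun w => (A.G c).Adj u w)) (mem_image.2 ⟨(c, u), by
      simp [hu]; exact hc, rfl⟩)
    refine h.trans (card_le_card ?_)
    intro w hw
    rw [mem_inter, mem_filter] at hw
    exact mem_filter.2 ⟨hw.2, hw.1.2⟩
  obtain ⟨R0, b1, b2, b3, b4, b5, b6⟩ := ok.resI m false
    ((univ : Finset C).image (fun c => (A.Vs false).filter (fun u =>
      A.t ≤ (R1.filter (fun w => (A.G c).Adj u w)).card)))
    (by
      refine card_image_le.trans ?_
      rw [card_univ]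
      exact Nat.le_mul_of_pos_right _ hW)
    (by
      intro S hS
      obtain ⟨c, _, rfl⟩ := mem_image.1 hS
      refine ⟨filter_subset _ _, (ok.hκ c).trans ?_⟩
      apply Nat.cast_le.2
      apply card_le_card
      intro u hu
      rw [mem_filter] at hu ⊢
      exact ⟨hu.1, a7 c u hu.1 hu.2⟩)
  refine ⟨fun i => if i then R1 else R0, ?_, ?_, ?_, ?_, ?_, ?_⟩
  · intro i; cases i
    · simpa using b1
    · simpa using a1
  · intro i; cases i
    · simpa using b2
    · simpa using a2
  · intro z
    cases hz : A.part z
    · simpa using b3 z hz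
    · simpa using a3 z hz
  · intro i; cases i
    · simpa using b4
    · simpa using a4
  · intro i; cases i
    · simpa using a5
    · simpa using b5
  · intro c
    have h := b6 _ (mem_image_of_mem _ (mem_univ c))
    refine h.trans (card_le_card ?_)
    intro u hu
    rw [mem_inter, mem_filter] at hu
    simp only [Bool.false_eq_true, if_false, if_true, mem_filter]
    exact ⟨hu.2, hu.1.2⟩

end AD


namespace AD

set_option linter.unusedSectionVars false

variable {V C W : Type*} [Fintype C] [Fintype W] {A : AD V C W}

lemma Ok.R_card (ok : A.Ok) (i : Bool) (R : Finset V) (h : R.card * A.qR ≤ (A.Vs i).card) :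
    A.c0 + R.card ≤ ((A.Ii i).card : ℝ) := by
  have h1 := ok.nRI i
  rw [ok.card_Ii]
  have hq : (0:ℝ) < A.qR := by exact_mod_cast ok.hqR
  have h2 : (R.card : ℝ) ≤ (A.Vs i).card / A.qR := by
    rw [le_div_iff₀ hq]; exact_mod_cast h
  linarith

/-- The remaining vertices of `Q` -/
noncomputable def Lr (A : AD V C W) (S1 : Finset W) : Finset W := (A.Q \ A.I) \ A.SN S1

/-- every vertex has a good candidate set -/
lemma Ok.cand (ok : A.Ok) {B : Finset C} {A' S1 : Finset W} {τ : W → V} (m : A.Mid B A' S1 τ) (z : W) :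
    ∃ Y ⊆ A.Vs (A.part z), A.q ^ A.Δ * A.n / 2 ≤ (Y.card : ℝ) ∧
      (∀ v ∈ Y, ∀ x ∈ A.X, A.H.Adj z x → A.T1 B v (τ x)) ∧
      (∀ v ∈ Y, ∀ p ∈ S1, A.H.Adj z p → A.T v (τ p)) ∧
      (∀ v ∈ Y, ∀ i, ∀ y ∈ NS A.H (A.Ii i), A.H.Adj z y → A.T1 B v (τ y)) := by
  have h0 : 0 ≤ A.q ^ A.Δ * A.n := by have := ok.q0; positivity
  have nX : ∀ j p, A.O j p → A.H.Adj z p → ∀ x ∈ A.X, ¬ A.H.Adj z x := fun j p hp hzp x hx =>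
    ok.O_XX hp hx hzp.symm
  by_cases hX : ∃ x ∈ A.X, A.H.Adj z x
  · obtain ⟨x, hx, hzx⟩ := hX
    obtain ⟨Y, hY, hc, h⟩ := m.hCX z
    refine ⟨Y, hY, hc, h, ?_, ?_⟩
    · intro v hv p hp hzp
      exfalso
      rcases ok.S1_O (m.hS1 p hp) with h | ⟨i, h⟩
      · exact nX _ _ h hzp x hx hzx
      · exact nX _ _ h hzp x hx hzx
    · intro v hv i y hy hzy
      exact absurd hzx (nX _ _ (ok.O_NI hy) hzy x hx)
  push Not at hX
  by_cases hS : ∃ p ∈ S1, A.H.Adj z p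
  · obtain ⟨p, hp, hzp⟩ := hS
    have hpV : τ p ∈ A.Vs (A.part p) := m.pe.mem p (by simp [hp])
    have hpart : A.Vs (!(A.part p)) = A.Vs (A.part z) := by rw [ok.hbip _ _ hzp]; simp
    have hd := ok.hTdeg _ _ hpV
    rw [hpart] at hd
    refine ⟨(A.Vs (A.part z)).filter (fun u => A.T (τ p) u), filter_subset _ _, ?_, ?_, ?_, ?_⟩
    · have h3 := ok.qq
      have : A.q ^ A.Δ * A.n ≤ A.q * A.n := mul_le_mul_of_nonneg_right h3 (by positivity)
      linarith
    · intro v _ x hx hzx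
      exact absurd hzx (hX x hx)
    · intro v hv p' hp' hzp'
      have : p' = p := by
        have hpp : A.part p' = A.part p := by
          have h1 := ok.hbip _ _ hzp
          have h2 := ok.hbip _ _ hzp'
          rw [h1, h2]
        have c1 := m.hS1 p hp
        have c2 := m.hS1 p' hp'
        -- both are special vertices of centres
        have form : ∀ r, (r ∈ A.SA ∨ ∃ i, ∃ c ∈ A.Cn (jB i), r = A.sp i c) →
            ∃ c ∈ A.Γ, r = A.sp (A.part r) c := by
          intro r hr
          have aux : ∀ i j, ∀ c ∈ A.Cn j, r = A.sp i c → ∃ c ∈ A.Γ, r = A.sp (A.part r) c := by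
            intro i j c hc hrc
            refine ⟨c, (mem_Cn.1 hc).1, ?_⟩
            have : A.part r = i := by rw [hrc]; exact ok.part_sp i (mem_Cn.1 hc).1
            rw [this]; exact hrc
          rcases hr with hr | ⟨i, c, hc, hrc⟩
          · rcases mem_union.1 hr with hr | hr
            · exact aux false 0 r hr rfl
            · obtain ⟨c, hc, hrc⟩ := mem_image.1 hr
              exact aux true 0 c hc hrc.symm
          · exact aux i _ c hc hrc
        obtain ⟨c, hc, e1⟩ := form p c1
        obtain ⟨c', hc', e2⟩ := form p' c2
        have b1 := ok.Bl_sp (A.part p) hc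
        have b2 := ok.Bl_sp (A.part p') hc'
        rw [← e1] at b1
        rw [← e2] at b2
        have := ok.hfar c hc c' hc' p p' b1 b2 (Or.inr (Or.inr ⟨z, hzp, hzp'⟩))
        rw [e1, e2, hpp, this]
      rw [this]
      exact A.T_symm _ _ (mem_filter.1 hv).2
    · intro v hv i y hy hzy
      exfalso
      rcases ok.S1_O (m.hS1 p hp) with h | ⟨i', h⟩
      · exact jI0 (ok.O_eq (ok.O_NI hy) h (Or.inr (Or.inr ⟨z, hzy, hzp⟩)))
      · exact jBI (ok.O_eq h (ok.O_NI hy) (Or.inr (Or.inr ⟨z, hzp, hzy⟩)))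
  push Not at hS
  by_cases hN : ∃ i, ∃ y ∈ NS A.H (A.Ii i), A.H.Adj z y
  · obtain ⟨i, y, hy, hzy⟩ := hN
    obtain ⟨x, hx, hxy⟩ := (mem_NS _ _ _).1 hy
    obtain ⟨Y, hY, hc, h⟩ := m.hI i x hx
    have hpz : A.part z = i := by
      have h1 := ok.part_NI hy
      have h2 := ok.hbip _ _ hzy
      rw [h1] at h2
      cases i <;> cases hp : A.part z <;> simp_all
    refine ⟨Y, by rw [hpz]; exact hY, by linarith, ?_, ?_, ?_⟩
    · intro v _ x hx hzx
      exact absurd hzx (hX x hx)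
    · intro v _ x hx hzx
      exact absurd hzx (hS x hx)
    · intro v hv i' y' hy' hzy'
      have hii : i = i' := jI_inj (ok.O_eq (ok.O_NI hy) (ok.O_NI hy') (Or.inr (Or.inr ⟨z, hzy, hzy'⟩)))
      subst hii
      obtain ⟨x', hx', hxy'⟩ := (mem_NS _ _ _).1 hy'
      have hxx : x' = x := by
        obtain ⟨c, hc, rfl⟩ := mem_image.1 hx
        obtain ⟨c', hc', rfl⟩ := mem_image.1 hx'
        have g1 := (mem_Cn.1 hc).1
        have g2 := (mem_Cn.1 hc').1
        rw [ok.hfar c g1 c' g2 y y' (ok.Bl_nsp i g1 hxy) (ok.Bl_nsp i g2 hxy')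
          (Or.inr (Or.inr ⟨z, hzy, hzy'⟩))]
      rw [hxx] at hxy'
      exact h v hv y' hxy'
  push Not at hN
  refine ⟨A.Vs (A.part z), subset_rfl, ?_, ?_, ?_, ?_⟩
  · have h1 : (A.n : ℝ) ≤ (A.Vs (A.part z)).card := by exact_mod_cast ok.hn _
    have := ok.n4
    linarith
  · intro v _ x hx hzx
    exact absurd hzx (hX x hx)
  · intro v _ x hx hzx
    exact absurd hzx (hS x hx)
  · intro v _ i x hx hzx
    exact absurd hzx (hN i x hx)

lemma Ok.rest (ok : A.Ok) [Nonempty V] {B : Finset C} {A' S1 : Finset W} {τ : W → V} (m : A.Mid B A' S1 τ)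
    (R : Bool → Finset V) (hRc : ∀ i, (R i).card * A.qR ≤ (A.Vs i).card) :
    ∃ τ' : W → V, Pe A.part A.Vs (A.SN S1 ∪ A.Lr S1) τ' ∧ (∀ z ∈ A.SN S1, τ' z = τ z) ∧
      (∀ z ∈ A.Lr S1, τ' z ∉ R (A.part z)) ∧
      (∀ x ∈ A.Lr S1, ∀ y ∈ A.Lr S1, A.H.Adj x y → A.T (τ' x) (τ' y)) ∧
      (∀ z ∈ A.Lr S1, ∀ x ∈ A.X, A.H.Adj z x → A.T1 B (τ' z) (τ' x)) ∧
      (∀ z ∈ A.Lr S1, ∀ p ∈ S1, A.H.Adj z p → A.T (τ' z) (τ' p)) ∧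
      (∀ z ∈ A.Lr S1, ∀ i, ∀ y ∈ NS A.H (A.Ii i), A.H.Adj z y → A.T1 B (τ' z) (τ' y)) := by
  choose Y hY hYc hY1 hY2 hY3 using ok.cand m
  have hused : (((A.SN S1).image τ).card : ℝ) ≤ A.X.card + A.Q.card := by
    exact_mod_cast card_image_le.trans ((card_le_card (ok.SN_sub m)).trans (card_union_le _ _))
  have hR : ∀ i, ((R i).card : ℝ) ≤ A.Q.card := by
    intro i
    have h1 := ok.R_card i (R i) (hRc i)
    have h2 : ((A.Ii i).card : ℝ) ≤ A.Q.card := by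
      exact_mod_cast card_le_card (fun p hp => ok.O_Q (ok.O_Ii hp))
    have := ok.hc0
    linarith
  have hQ' := ok.nQ'
  have hΔe : 0 ≤ A.Δ * A.e := by have := ok.he; positivity
  have hX0 : (0:ℝ) ≤ A.X.card := by positivity
  have hQ0 : (0:ℝ) ≤ A.Q.card := by positivity
  have hL : ((A.Lr S1).card : ℝ) ≤ A.Q.card := by
    exact_mod_cast card_le_card (sdiff_subset.trans sdiff_subset)
  obtain ⟨ν, n1, n2, n3, _⟩ := greedy A.H A.part ok.hbip A.Δ ok.hdeg ok.hΔ A.Vs A.T A.T_symm A.e A.q ok.he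
    ok.hq0.le ok.hq1 ok.typT univ (fun z => (Y z \ (A.SN S1).image τ) \ R (A.part z))
    (fun z _ => (sdiff_subset.trans sdiff_subset).trans (hY z)) (A.q ^ A.Δ * A.n / 4)
    (by have := ok.q0; positivity) (by
      intro z _
      have h2 := le_card_sdiff ((A.SN S1).image τ) (Y z)
      have h3 := le_card_sdiff (R (A.part z)) (Y z \ (A.SN S1).image τ)
      have h4 : ((Y z).card : ℝ) ≤ ((Y z \ (A.SN S1).image τ) \ R (A.part z)).card +
          ((A.SN S1).image τ).card + (R (A.part z)).card := by
        exact_mod_cast (by omega : (Y z).card ≤ ((Y z \ (A.SN S1).image τ) \ R (A.part z)).card +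
          ((A.SN S1).image τ).card + (R (A.part z)).card)
      have h5 := hYc z
      have h6 := hR (A.part z)
      linarith) (A.Lr S1) (subset_univ _) (by
      have := ok.nQ
      linarith)
  obtain ⟨τ', p1, p2, p3⟩ := Pe.ext (S := A.SN S1) m.pe (A.Lr S1) disjoint_sdiff ν n1
    (fun z hz => hY z (mem_sdiff.1 (mem_sdiff.1 (n2 z hz)).1).1)
    (fun z hz => (mem_sdiff.1 (mem_sdiff.1 (n2 z hz)).1).2)
  have nY : ∀ z ∈ A.Lr S1, τ' z ∈ Y z := fun z hz => by
    rw [p3 z hz]; exact (mem_sdiff.1 (mem_sdiff.1 (n2 z hz)).1).1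
  refine ⟨τ', p1, p2, ?_, ?_, ?_, ?_, ?_⟩
  · intro z hz
    rw [p3 z hz]
    exact (mem_sdiff.1 (n2 z hz)).2
  · intro x hx y hy hxy
    rw [p3 x hx, p3 y hy]
    exact n3 x hx y hy hxy
  · intro z hz x hx hzx
    rw [p2 x (by unfold SN; simp [hx])]
    exact hY1 z _ (nY z hz) x hx hzx
  · intro z hz x hx hzx
    rw [p2 x (by unfold SN; simp [hx])]
    exact hY2 z _ (nY z hz) x hx hzx
  · intro z hz i x hx hzx
    rw [p2 x (by unfold SN; cases i <;> simp [hx])]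
    exact hY3 z _ (nY z hz) i x hx hzx

end AD


namespace AD

set_option linter.unusedSectionVars false

variable {V C W : Type*} [Fintype C] [Fintype W] {A : AD V C W}

/-- data for the second half -/
noncomputable def mkD (A : AD V C W) (B : Finset C) (A' : Finset W) (τ : W → V) (R : Bool → Finset V)
    (EA : Finset (Sym2 W)) : Dat V C W where
  G := A.G
  H := A.H
  part := A.part
  Vs := A.Vs
  B := B
  X := A.X
  Q := A.Q
  F := A.F
  I := A.I
  GF := A.GF
  EA := EA
  EAf := A'.image (fun x => s(x, A.nb x))
  nb := A.nb
  lab := A.lab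
  τ0 := τ
  R := R
  Δ := A.Δ
  k := A.k
  Mx := A.Mx
  t := A.t
  θ1 := A.q * B.card
  e := A.e
  q := A.q
  c0 := A.c0
  lamI := A.lamI
  lam := A.α / 4 * A'.card

lemma mem_I {x : W} : x ∈ A.I ↔ ∃ i, x ∈ A.Ii i := by
  unfold I
  rw [mem_union]
  constructor
  · rintro (h | h)
    · exact ⟨_, h⟩
    · exact ⟨_, h⟩
  · rintro ⟨i, h⟩
    cases i
    · exact Or.inl h
    · exact Or.inr h

lemma mem_NSI {x : W} : x ∈ NS A.H A.I ↔ ∃ i, x ∈ NS A.H (A.Ii i) := by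
  simp only [mem_NS, mem_I]
  constructor
  · rintro ⟨y, ⟨i, hi⟩, h⟩
    exact ⟨i, y, hi, h⟩
  · rintro ⟨i, y, hi, h⟩
    exact ⟨y, ⟨i, hi⟩, h⟩

lemma Ok.filterI (ok : A.Ok) (i : Bool) : A.I.filter (fun x => A.part x = i) = A.Ii i := by
  ext x
  rw [mem_filter, mem_I]
  constructor
  · rintro ⟨⟨j, hj⟩, hp⟩
    have := ok.part_Ii hj
    rw [hp] at this
    rwa [this]
  · intro h
    exact ⟨⟨i, h⟩, ok.part_Ii h⟩

lemma mem_SN {S1 : Finset W} {z : W} : z ∈ A.SN S1 ↔ z ∈ S1 ∨ z ∈ A.X ∨ ∃ i, z ∈ NS A.H (A.Ii i) := by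
  unfold SN
  simp only [mem_union, Bool.exists_bool]
  tauto

lemma Ok.S0_iff (ok : A.Ok) {B : Finset C} {A' S1 : Finset W} {τ : W → V} (m : A.Mid B A' S1 τ) {z : W} :
    z ∈ A.X ∪ (A.Q \ A.I) ↔ z ∈ A.SN S1 ∪ A.Lr S1 := by
  constructor
  · intro hz
    by_cases hs : z ∈ A.SN S1
    · exact mem_union_left _ hs
    · rcases mem_union.1 hz with h | h
      · exact mem_union_left _ (mem_SN.2 (Or.inr (Or.inl h)))
      · exact mem_union_right _ (mem_sdiff.2 ⟨h, hs⟩)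
  · intro hz
    rcases mem_union.1 hz with h | h
    · rcases mem_SN.1 h with h | h | ⟨i, h⟩
      · have hQ := ok.S1_Q (m.hS1 z h)
        refine mem_union_right _ (mem_sdiff.2 ⟨hQ, fun hI => ?_⟩)
        obtain ⟨j, hj⟩ := mem_I.1 hI
        exact ok.S1_NI (m.hS1 z h) (ok.O_Ii hj)
      · exact mem_union_left _ h
      · refine mem_union_right _ (mem_sdiff.2 ⟨ok.O_Q (ok.O_NI h), fun hI => ?_⟩)
        obtain ⟨j, hj⟩ := mem_I.1 hI
        exact ok.NI_I h hj
    · exact mem_union_right _ (mem_sdiff.1 h).1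

lemma Ok.edge_inj (ok : A.Ok) {x y : W} (hx : x ∈ A.Γ) (hy : y ∈ A.Γ) (h : s(x, A.nb x) = s(y, A.nb y)) :
    x = y := by
  rw [Sym2.eq_iff] at h
  rcases h with h | h
  · exact h.1
  · have h1 := ok.hΓp x hx
    have h2 := ok.part_sp true hy
    have h3 : A.sp true y = A.nb y := rfl
    rw [h3, ← h.1, h1] at h2
    simp at h2

lemma Ok.flCard (ok : A.Ok) (B : Finset C) (A' : Finset W) (τ : W → V) (R : Bool → Finset V)
    (EA : Finset (Sym2 W)) (hs : A.α ^ A.L * (A.Cn 0).card ≤ (A'.card : ℝ)) :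
    (((A.mkD B A' τ R EA).Efl.card : ℕ) : ℝ) ≤ A.α / 4 * A'.card := by
  have h1 : (A.mkD B A' τ R EA).Efl ⊆
      (EH A.H).filter (fun e => ∃ x ∈ e, x ∈ (A.X ∪ A.I ∪ NS A.H A.I) ∪ A.F) := by
    intro e he
    rw [Dat.mem_Efl] at he
    rw [mem_filter, mem_EH]
    refine ⟨he.1, ?_⟩
    rcases he.2 with ⟨x, hx, h⟩ | ⟨h, _⟩
    · refine ⟨x, hx, ?_⟩
      simp only [mem_union]
      rcases h with h | h | h
      · exact Or.inl (Or.inl (Or.inl h))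
      · exact Or.inl (Or.inl (Or.inr h))
      · exact Or.inl (Or.inr h)
    · induction e using Sym2.ind with
      | _ x y => exact ⟨x, by simp, mem_union_right _ (h x (by simp))⟩
  have h2 := (card_le_card h1).trans (card_touch A.H A.Δ ok.hdeg _)
  have h3 := card_union_le (A.X ∪ A.I ∪ NS A.H A.I) A.F
  have h4 := card_union_le (A.X ∪ A.I) (NS A.H A.I)
  have h5 := card_union_le A.X A.I
  have h6 := card_NS A.H A.Δ ok.hdeg A.I
  have h7 : A.I.card ≤ (A.Cn 3).card + (A.Cn 4).card := by
    have := card_union_le (A.Ii false) (A.Ii true)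
    rw [ok.card_Ii, ok.card_Ii] at this
    exact this
  have h8 : ((A.X ∪ A.I ∪ NS A.H A.I) ∪ A.F).card ≤ A.X.card + ((A.Cn 3).card + (A.Cn 4).card) * (1 + A.Δ)
      + A.F.card := by
    have h9 : A.I.card * A.Δ ≤ ((A.Cn 3).card + (A.Cn 4).card) * A.Δ := Nat.mul_le_mul_right _ h7
    have h10 : ((A.Cn 3).card + (A.Cn 4).card) * (1 + A.Δ) = ((A.Cn 3).card + (A.Cn 4).card) +
      ((A.Cn 3).card + (A.Cn 4).card) * A.Δ := by ring
    omega
  have h11 := h2.trans (Nat.mul_le_mul_right A.Δ h8)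
  have h12 : (((A.mkD B A' τ R EA).Efl.card : ℕ) : ℝ) ≤ ((A.X.card : ℝ) + ((A.Cn 3).card + (A.Cn 4).card) * (1 + A.Δ)
      + A.F.card) * A.Δ := by exact_mod_cast h11
  refine h12.trans (ok.nfl.trans ?_)
  apply mul_le_mul_of_nonneg_left hs
  have := ok.hα0
  positivity

set_option maxHeartbeats 2000000 in
theorem Ok.final (ok : A.Ok) [Nonempty V] [Nonempty C] : HasTransversal A.G A.H := by
  obtain ⟨B, A', S1, τ, m⟩ := ok.mid
  obtain ⟨R, R1, R2, R3, R4, R5, R6⟩ := ok.res m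
  obtain ⟨τ', pe, ag, l1, l2, l3, l4, l5⟩ := ok.rest m R R2
  have agX : ∀ x ∈ A.X, τ' x = τ x := fun x hx => ag x (mem_SN.2 (Or.inr (Or.inl hx)))
  have agS : ∀ x ∈ S1, τ' x = τ x := fun x hx => ag x (mem_SN.2 (Or.inl hx))
  have agN : ∀ i, ∀ x ∈ NS A.H (A.Ii i), τ' x = τ x := fun i x hx => ag x (mem_SN.2 (Or.inr (Or.inr ⟨i, hx⟩)))
  have agI : ∀ i, ∀ x ∈ A.Ii i, ∀ y, A.H.Adj x y → τ' y = τ y := fun i x hx y hxy =>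
    agN i y ((mem_NS _ _ _).2 ⟨x, hx, hxy⟩)
  have hAS : ∀ x ∈ A', x ∈ A.SA ∧ A.nb x ∈ A.SA := fun x hx =>
    ⟨mem_union_left _ (m.hA' hx), mem_union_right _ (mem_image_of_mem _ (m.hA' hx))⟩
  have agA : ∀ x ∈ A', τ' x = τ x ∧ τ' (A.nb x) = τ (A.nb x) := fun x hx =>
    ⟨agS x (m.hSA1 (hAS x hx).1), agS _ (m.hSA1 (hAS x hx).2)⟩
  have hAΓ : ∀ x ∈ A', x ∈ A.Γ := fun x hx => (mem_Cn.1 (m.hA' hx)).1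
  have hinj : Set.InjOn (fun x => s(x, A.nb x)) (A' : Set W) := fun x hx y hy h =>
    ok.edge_inj (hAΓ x hx) (hAΓ y hy) h
  have hEAc : (A'.image (fun x => s(x, A.nb x))).card = B.card := by
    rw [card_image_of_injOn hinj, m.hBA]
  have hfl := ok.flCard B A' τ' R ∅ m.hs
  have hα0 := ok.hα0
  have hα1 := ok.hα1
  have hA'0 : (0:ℝ) ≤ A'.card := by positivity
  have hflB : (A.mkD B A' τ' R ∅).Efl.card ≤ B.card := by
    rw [← m.hBA]
    have : ((A.mkD B A' τ' R ∅).Efl.card : ℝ) ≤ A'.card := by nlinarith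
    exact_mod_cast this
  obtain ⟨EA, hEA, hEAcard⟩ := exists_subset_card_eq (s := A'.image (fun x => s(x, A.nb x)))
    (n := B.card - (A.mkD B A' τ' R ∅).Efl.card) (by rw [hEAc]; omega)
  have hT1 : Typ (A.T1 B) A.Vs A.e A.q := by
    apply ok.hTD B
    have h1 := ok.hka
    rw [← m.hBA]
    exact_mod_cast h1.trans m.hs
  have notO : ∀ x, A.O 0 x → x ∉ A.X ∧ x ∉ A.I ∧ x ∉ NS A.H A.I ∧ x ∉ A.F := by
    intro x hx
    refine ⟨fun h => disjoint_left.1 ok.hXQ h (ok.O_Q hx), fun h => ?_, fun h => ?_,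
      fun h => disjoint_left.1 ok.hQF (ok.O_Q hx) h⟩
    · obtain ⟨i, hi⟩ := mem_I.1 h
      exact jI0 (ok.O_eq (ok.O_Ii hi) hx (Or.inl rfl))
    · obtain ⟨i, hi⟩ := mem_NSI.1 h
      exact jI0 (ok.O_eq (ok.O_NI hi) hx (Or.inl rfl))
  have hS0 : ∀ z, z ∈ (A.mkD B A' τ' R EA).S0 ↔ z ∈ A.SN S1 ∪ A.Lr S1 := fun z => ok.S0_iff m
  have hS0S : ∀ v, v ∉ (A.mkD B A' τ' R EA).S0.image τ' → v ∉ S1.image τ := by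
    intro v hv h
    apply hv
    obtain ⟨x, hx, rfl⟩ := mem_image.1 h
    exact mem_image.2 ⟨x, (hS0 x).2 (mem_union_left _ (mem_SN.2 (Or.inl hx))), agS x hx⟩
  -- flexible edges
  have flX : ∀ x ∈ A.X, ∀ y ∈ A.SN S1 ∪ A.Lr S1, A.H.Adj x y → A.T1 B (τ' x) (τ' y) := by
    intro x hx y hy hxy
    rcases mem_union.1 hy with hy | hy
    · rcases mem_SN.1 hy with hy | hy | ⟨i, hy⟩
      · exfalso
        rcases ok.S1_O (m.hS1 y hy) with h | ⟨i, h⟩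
        · exact ok.O_X h hx hxy.symm
        · exact ok.O_X h hx hxy.symm
      · rw [agX x hx, agX y hy]; exact m.hX x hx y hy hxy
      · exact absurd hxy.symm (ok.O_X (ok.O_NI hy) hx)
    · exact A.T1_symm B _ _ (l3 y hy x hx hxy.symm)
  have flN : ∀ i, ∀ x ∈ NS A.H (A.Ii i), ∀ y ∈ A.SN S1 ∪ A.Lr S1, A.H.Adj x y → A.T1 B (τ' x) (τ' y) := by
    intro i x hx y hy hxy
    rcases mem_union.1 hy with hy | hy
    · exfalso
      rcases mem_SN.1 hy with hy | hy | ⟨i', hy⟩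
      · rcases ok.S1_O (m.hS1 y hy) with h | ⟨i', h⟩
        · exact jI0 (ok.O_eq (ok.O_NI hx) h (Or.inr (Or.inl hxy)))
        · exact jBI (ok.O_eq h (ok.O_NI hx) (Or.inr (Or.inl hxy.symm)))
      · exact ok.O_X (ok.O_NI hx) hy hxy
      · have h1 := jI_inj (ok.O_eq (ok.O_NI hx) (ok.O_NI hy) (Or.inr (Or.inl hxy)))
        have h2 := ok.hbip _ _ hxy
        rw [ok.part_NI hx, ok.part_NI hy, h1] at h2
        cases i' <;> simp at h2
    · exact A.T1_symm B _ _ (l5 y hy i x hx hxy.symm)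
  -- coloured edges
  have colT : ∀ x ∈ A.SN S1 ∪ A.Lr S1, ∀ y ∈ A.SN S1 ∪ A.Lr S1, A.H.Adj x y →
      x ∉ A.X → y ∉ A.X → x ∉ NS A.H A.I → y ∉ NS A.H A.I → A.T (τ' x) (τ' y) := by
    intro x hx y hy hxy hxX hyX hxN hyN
    have cs : ∀ z ∈ A.SN S1 ∪ A.Lr S1, z ∉ A.X → z ∉ NS A.H A.I → z ∈ S1 ∨ z ∈ A.Lr S1 := by
      intro z hz h1 h2
      rcases mem_union.1 hz with hz | hz
      · rcases mem_SN.1 hz with hz | hz | hz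
        · exact Or.inl hz
        · exact absurd hz h1
        · exact absurd (mem_NSI.2 hz) h2
      · exact Or.inr hz
    rcases cs x hx hxX hxN with hx | hx <;> rcases cs y hy hyX hyN with hy | hy
    · rw [agS x hx, agS y hy]
      rcases m.hS1 x hx with h | ⟨i, c, hc, h⟩
      · rcases m.hS1 y hy with h' | ⟨i, c, hc, h'⟩
        · exact m.hSA x h y h' hxy
        · rw [h'] at hxy
          exact absurd (ok.O_eq (ok.O_sp i hc) (ok.O_SA h) (Or.inr (Or.inl hxy.symm))) jB0
      · exfalso
        rcases m.hS1 y hy with h' | ⟨i', c', hc', h'⟩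
        · rw [h] at hxy
          exact jB0 (ok.O_eq (ok.O_sp i hc) (ok.O_SA h') (Or.inr (Or.inl hxy)))
        · rw [h, h'] at hxy
          have hi := jB_inj (ok.O_eq (ok.O_sp i hc) (ok.O_sp i' hc') (Or.inr (Or.inl hxy)))
          have h2 := ok.hbip _ _ hxy
          rw [ok.part_sp i (mem_Cn.1 hc).1, ok.part_sp i' (mem_Cn.1 hc').1, hi] at h2
          cases i' <;> simp at h2
    · exact A.T_symm _ _ (l4 y hy x hx hxy.symm)
    · exact l4 x hx y hy hxy
    · exact l2 x hx y hy hxy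
  have hBQ : B.card ≤ A.Q.card := by
    rw [← m.hBA]
    exact card_le_card fun x hx => ok.SA_Q (hAS x hx).1
  have main : (A.mkD B A' τ' R EA).Ok :=
    { hbip := ok.hbip
      hΔ := ok.hΔ
      hdeg := ok.hdeg
      hVs := ok.hVs
      hcard := ok.hcard
      hEH := ok.hEH
      he := ok.he
      hq0 := ok.hq0.le
      hq1 := ok.hq1
      hT1 := hT1
      hTD := ok.hTD
      hXQ := ok.hXQ
      hXF := ok.hXF
      hQF := ok.hQF
      hQ := ok.hQ
      hF := ok.hF
      hIQ := by
        intro x hx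
        obtain ⟨i, hi⟩ := mem_I.1 hx
        exact ok.O_Q (ok.O_Ii hi)
      hNI := by
        intro x hx y hxy
        obtain ⟨i, hi⟩ := mem_I.1 hx
        have hy : y ∈ NS A.H (A.Ii i) := (mem_NS _ _ _).2 ⟨x, hi, hxy⟩
        refine ⟨ok.O_Q (ok.O_NI hy), fun h => ?_⟩
        obtain ⟨j, hj⟩ := mem_I.1 h
        exact ok.NI_I hy hj
      hlab := ok.hlab
      hMx := ok.hMx
      hGF := ok.hGF
      hGFc := ok.hGFc
      hnbF := ok.hnbF
      hnbadj := ok.hnbadj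
      hGFp := ok.hGFp
      hGF1 := ok.hGF1
      hGF2 := ok.hGF2
      hGF3 := ok.hGF3
      hEAf := by
        intro e he
        obtain ⟨x, hx, rfl⟩ := mem_image.1 he
        exact (mem_EH_mk _ _ _).2 (ok.hΓnb x (hAΓ x hx))
      hEAQ := by
        intro e he z hz
        obtain ⟨x, hx, rfl⟩ := mem_image.1 he
        have : z ∈ A.SA := by
          rcases Sym2.mem_iff.1 hz with rfl | rfl
          · exact (hAS _ hx).1
          · exact (hAS _ hx).2
        exact ⟨ok.SA_Q this, (notO z (ok.O_SA this)).2.1⟩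
      hEAfl := by
        rw [disjoint_left]
        intro e he hf
        obtain ⟨x, hx, rfl⟩ := mem_image.1 he
        have hz : ∀ z ∈ s(x, A.nb x), z ∈ A.SA := by
          intro z hz
          rcases Sym2.mem_iff.1 hz with rfl | rfl
          · exact (hAS _ hx).1
          · exact (hAS _ hx).2
        rw [Dat.mem_Efl] at hf
        rcases hf.2 with ⟨z, hz', h⟩ | ⟨h, _⟩
        · have := notO z (ok.O_SA (hz z hz'))
          rcases h with h | h | h
          · exact this.1 h
          · exact this.2.1 h
          · exact this.2.2.1 h
        · exact (notO x (ok.O_SA (hz x (by simp)))).2.2.2 (h x (by simp))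
      hEA := hEA
      hEAc := by
        change EA.card + (A.mkD B A' τ' R ∅).Efl.card = B.card
        omega
      hEAfc := hEAc
      hτinj := by
        intro x hx y hy hxy
        exact pe.inj ((hS0 x).1 hx) ((hS0 y).1 hy) hxy
      hτmem := fun z hz => pe.mem z ((hS0 z).1 hz)
      hτfl := by
        intro x hx y hy hf
        rw [Dat.mem_Efl] at hf
        have hadj : A.H.Adj x y := (SimpleGraph.mem_edgeSet A.H).1 hf.1
        have hx' := (hS0 x).1 hx
        have hy' := (hS0 y).1 hy
        have symm : ∀ u v, A.T1 B u v → A.T1 B v u := A.T1_symm B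
        have nI : ∀ z ∈ A.SN S1 ∪ A.Lr S1, z ∉ A.I := by
          intro z hz hI
          have := (ok.S0_iff m).2 hz
          rcases mem_union.1 this with h | h
          · obtain ⟨i, hi⟩ := mem_I.1 hI
            exact disjoint_left.1 ok.hXQ h (ok.O_Q (ok.O_Ii hi))
          · exact (mem_sdiff.1 h).2 hI
        rcases hf.2 with ⟨z, hz', h⟩ | ⟨h, _⟩
        · rcases Sym2.mem_iff.1 hz' with rfl | rfl
          · rcases h with h | h | h
            · exact flX _ h y hy' hadj
            · exact absurd h (nI _ hx')
            · obtain ⟨i, hi⟩ := mem_NSI.1 h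
              exact flN i _ hi y hy' hadj
          · rcases h with h | h | h
            · exact symm _ _ (flX _ h x hx' hadj.symm)
            · exact absurd h (nI _ hy')
            · obtain ⟨i, hi⟩ := mem_NSI.1 h
              exact symm _ _ (flN i _ hi x hx' hadj.symm)
        · exfalso
          have hF := h x (by simp)
          have := (ok.S0_iff m).2 hx'
          rcases mem_union.1 this with h | h
          · exact disjoint_left.1 ok.hXF h hF
          · exact disjoint_left.1 ok.hQF (mem_sdiff.1 h).1 hF
      hτcol := by
        intro e he hS
        induction e using Sym2.ind with
        | _ x y =>
        rw [Dat.mem_Ecol, Dat.mem_Efl] at he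
        obtain ⟨h1, h2, h3⟩ := he
        have hadj : A.H.Adj x y := (SimpleGraph.mem_edgeSet A.H).1 h1
        push Not at h2
        have h2 := (h2 h1).1
        have hT := colT x ((hS0 x).1 (hS x (by simp))) y ((hS0 y).1 (hS y (by simp))) hadj
          (h2 x (by simp)).1 (h2 y (by simp)).1 (h2 x (by simp)).2.2 (h2 y (by simp)).2.2
        have hsub : (univ : Finset C).filter (fun c => (A.G c).Adj (τ' x) (τ' y)) ⊆
            (Bᶜ.filter (fun c => Val A.G τ' c s(x, y))) ∪ B := by
          intro c hc
          rw [mem_filter] at hc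
          rw [mem_union, mem_filter, mem_compl, Val_mk]
          by_cases hcB : c ∈ B
          · exact Or.inr hcB
          · exact Or.inl ⟨hcB, hc.2⟩
        have h5 := (card_le_card hsub).trans (card_union_le _ _)
        have h6 : A.α * Fintype.card C ≤
          (((univ : Finset C).filter (fun c => (A.G c).Adj (τ' x) (τ' y))).card : ℝ) := hT
        have h7 := ok.nT
        have h8 : ((A.Q.card * (A.Δ + 1) : ℕ) : ℝ) ≤
            (((Bᶜ.filter (fun c => Val A.G τ' c s(x, y))).card + B.card : ℕ) : ℝ) := by
          have : (((univ : Finset C).filter (fun c => (A.G c).Adj (τ' x) (τ' y))).card : ℝ) ≤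
            (((Bᶜ.filter (fun c => Val A.G τ' c s(x, y))).card + B.card : ℕ) : ℝ) := by exact_mod_cast h5
          push_cast at *
          linarith
        have h9 : A.Q.card * (A.Δ + 1) ≤ (Bᶜ.filter (fun c => Val A.G τ' c s(x, y))).card + B.card := by
          exact_mod_cast h8
        change A.Q.card * A.Δ ≤ (Bᶜ.filter (fun c => Val A.G τ' c s(x, y))).card
        rw [mul_add, mul_one] at h9
        omega
      hR := fun i => (R1 i).trans sdiff_subset
      hRτ := by
        intro z hz i hzR
        have hzR' : τ' z ∈ R i := hzR
        rcases mem_union.1 ((hS0 z).1 hz) with h | h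
        · have := (mem_sdiff.1 (R1 i hzR')).2
          rw [ag z h] at this
          exact this (mem_image_of_mem _ h)
        · have h1 := (mem_sdiff.1 (R1 i hzR')).1
          have h2 := pe.mem z (mem_union_right _ h)
          have h3 := ok.part_eq h1 h2
          rw [h3] at hzR'
          exact l1 z h hzR'
      hRI := by
        intro i
        change A.c0 + (R i).card ≤ ((A.I.filter (fun x => A.part x = i)).card : ℝ)
        rw [ok.filterI]
        exact ok.R_card i _ (R2 i)
      h1 := by
        intro z _
        obtain ⟨Y, hY, hc, h⟩ := R3 z
        refine hc.trans (card_le_card fun v hv => ?_)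
        rw [mem_filter]
        refine ⟨hY hv, fun x hx hzx => ?_⟩
        change A.T1 B v (τ' x)
        rw [agX x hx]
        exact h v hv x hx hzx
      h2 := by
        intro z hz
        obtain ⟨i, hi⟩ := mem_I.1 hz
        obtain ⟨Y, hY, hc, h⟩ := R4 i z hi
        refine hc.trans (card_le_card fun v hv => ?_)
        rw [mem_filter]
        refine ⟨?_, fun y hzy => ?_⟩
        · change v ∈ R (A.part z)
          rw [ok.part_Ii hi]; exact hY hv
        · change A.T1 B v (τ' y)
          rw [agI i z hi y hzy]
          exact h v hv y hzy
      h3 := by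
        intro i v hv hvS
        exact R5 i v hv (hS0S v hvS)
      h4 := R6
      h5 := by
        intro i v hv hvS
        obtain ⟨J, hJ, hc, h⟩ := m.h5 i v hv (hS0S v hvS)
        refine ok.nt3.trans ?_
        refine le_trans (Nat.cast_le.2 hc) (Nat.cast_le.2 (card_le_card fun x hx => ?_))
        rw [mem_filter]
        refine ⟨?_, fun y hxy => ?_⟩
        · change x ∈ A.I.filter (fun x => A.part x = i)
          rw [ok.filterI]; exact hJ hx
        · change A.T1 B v (τ' y)
          rw [agI i x (hJ hx) y hxy]
          exact h x hx y hxy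
      h6 := by
        intro i S hS U hU h1 h2
        change S ⊆ A.I.filter (fun x => A.part x = i) at hS
        rw [ok.filterI] at hS
        obtain ⟨x, hx, v, hv, h⟩ := m.h6 i S hS U hU (by
            have : (A.s1 : ℝ) ≤ S.card := ok.ns1.trans h1
            exact_mod_cast this) (ok.nlam.trans (mul_le_mul_of_nonneg_left h2 ok.q0.le))
        refine ⟨x, hx, v, hv, fun y hxy => ?_⟩
        change A.T1 B v (τ' y)
        rw [agI i x (hS hx) y hxy]
        exact h y hxy
      hc0 := ok.hc0
      hn1 := ok.hn1
      hn2 := ok.hn2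
      hn3 := ok.hn3
      hn4 := ok.hn4
      hn5 := ok.hn5
      hn6 := ok.hn6
      hfl1 := by
        change ((A.mkD B A' τ' R ∅).Efl.card : ℝ) ≤ A.q * B.card
        refine hfl.trans ?_
        rw [← m.hBA]
        apply mul_le_mul_of_nonneg_right _ hA'0
        have := ok.hαq
        linarith
      hfl2 := hfl
      hA := by
        intro e he
        obtain ⟨x, hx, rfl⟩ := mem_image.1 he
        have h := m.hA x hx
        have e1 : 2 * (A.α / 4 * (A'.card : ℝ)) = A.α / 2 * A'.card := by ring
        change 2 * (A.α / 4 * (A'.card : ℝ)) ≤ _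
        rw [e1]
        refine h.trans (Nat.cast_le.2 (card_le_card fun c hc => ?_))
        rw [mem_filter] at hc ⊢
        refine ⟨hc.1, (Val_mk _ _ _ _ _).2 ?_⟩
        change (A.G c).Adj (τ' x) (τ' (A.nb x))
        rw [(agA x hx).1, (agA x hx).2]
        exact hc.2
      hB := by
        intro c hc
        have h := m.hB c hc
        have e1 : 2 * (A.α / 4 * (A'.card : ℝ)) = A.α / 2 * A'.card := by ring
        change 2 * (A.α / 4 * (A'.card : ℝ)) ≤ _
        rw [e1]
        refine h.trans (Nat.cast_le.2 ?_)
        rw [← card_image_of_injOn (hinj.mono (coe_subset.2 (filter_subset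
          (fun x => (A.G c).Adj (τ x) (τ (A.nb x))) A')))]
        apply card_le_card
        intro e he
        obtain ⟨x, hx, rfl⟩ := mem_image.1 he
        rw [mem_filter] at hx ⊢
        refine ⟨mem_image_of_mem _ hx.1, (Val_mk _ _ _ _ _).2 ?_⟩
        change (A.G c).Adj (τ' x) (τ' (A.nb x))
        rw [(agA x hx.1).1, (agA x hx.1).2]
        exact hx.2
      hole := by
        intro S hS K hK h1 h2
        change S ⊆ A'.image (fun x => s(x, A.nb x)) at hS
        obtain ⟨x, hx, c, hc, h⟩ := m.hole (A'.filter (fun x => s(x, A.nb x) ∈ S)) (filter_subset _ _) K hK (by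
          refine le_trans (show A.α / 4 * (A'.card : ℝ) ≤ (S.card : ℝ) from h1) (Nat.cast_le.2 ?_)
          refine le_trans (card_le_card ?_) (card_image_le (f := fun x => s(x, A.nb x)))
          intro e he
          obtain ⟨x, hx, rfl⟩ := mem_image.1 (hS he)
          exact mem_image.2 ⟨x, mem_filter.2 ⟨hx, he⟩, rfl⟩) h2
        rw [mem_filter] at hx
        refine ⟨_, hx.2, c, hc, (Val_mk _ _ _ _ _).2 ?_⟩
        change (A.G c).Adj (τ' x) (τ' (A.nb x))
        rw [(agA x hx.1).1, (agA x hx.1).2]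
        exact h }
  exact main.final

end AD


/-- at distance at most `r` -/
def Nr {W : Type*} (H : SimpleGraph W) (r : ℕ) (v w : W) : Prop := ∃ p : H.Walk v w, p.length ≤ r

lemma Nr.refl {W : Type*} (H : SimpleGraph W) (v : W) : Nr H 0 v v := ⟨SimpleGraph.Walk.nil, by simp⟩

lemma Nr.symm {W : Type*} {H : SimpleGraph W} {r : ℕ} {v w : W} (h : Nr H r v w) : Nr H r w v := by
  obtain ⟨p, hp⟩ := h
  exact ⟨p.reverse, by simpa using hp⟩

lemma Nr.trans {W : Type*} {H : SimpleGraph W} {r s : ℕ} {u v w : W} (h : Nr H r u v) (h' : Nr H s v w) :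
    Nr H (r + s) u w := by
  obtain ⟨p, hp⟩ := h
  obtain ⟨p', hp'⟩ := h'
  exact ⟨p.append p', by rw [SimpleGraph.Walk.length_append]; omega⟩

lemma Nr.mono {W : Type*} {H : SimpleGraph W} {r s : ℕ} {u v : W} (h : Nr H r u v) (hrs : r ≤ s) :
    Nr H s u v := by
  obtain ⟨p, hp⟩ := h
  exact ⟨p, by omega⟩

lemma Nr.of_adj {W : Type*} {H : SimpleGraph W} {u v : W} (h : H.Adj u v) : Nr H 1 u v :=
  ⟨h.toWalk, by simp⟩

lemma Nr.of_Bl {W : Type*} {H : SimpleGraph W} {c p : W} (h : Bl H c p) : Nr H 2 c p := by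
  rcases h with rfl | h | ⟨y, h1, h2⟩
  · exact (Nr.refl H _).mono (by omega)
  · exact (Nr.of_adj h).mono (by omega)
  · exact (Nr.of_adj h1).trans (Nr.of_adj h2)

lemma Nr.succ {W : Type*} {H : SimpleGraph W} {r : ℕ} {v w : W} (h : Nr H (r + 1) v w) :
    Nr H r v w ∨ ∃ u, Nr H r v u ∧ H.Adj u w := by
  obtain ⟨p, hp⟩ := h.symm
  cases p with
  | nil => exact Or.inl ((Nr.refl H _).mono (by omega))
  | cons hadj p' =>
    right
    refine ⟨_, Nr.symm ⟨p', ?_⟩, hadj.symm⟩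
    simpa using hp

lemma card_Nr {W : Type*} [Fintype W] (H : SimpleGraph W) (Δ : ℕ) (hdeg : ∀ w, degOf H w ≤ Δ)
    (S : Finset W) (r : ℕ) :
    ((univ : Finset W).filter (fun w => ∃ x ∈ S, Nr H r x w)).card ≤ S.card * (Δ + 1) ^ r := by
  induction r with
  | zero =>
    rw [pow_zero, mul_one]
    apply card_le_card
    intro w hw
    obtain ⟨x, hx, p, hp⟩ := (mem_filter.1 hw).2
    have := SimpleGraph.Walk.eq_of_length_eq_zero (Nat.le_zero.1 hp)
    rwa [← this]
  | succ r ih =>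
    set A := (univ : Finset W).filter (fun w => ∃ x ∈ S, Nr H r x w)
    have hsub : (univ : Finset W).filter (fun w => ∃ x ∈ S, Nr H (r + 1) x w) ⊆ A ∪ NS H A := by
      intro w hw
      obtain ⟨x, hx, h⟩ := (mem_filter.1 hw).2
      rcases h.succ with h | ⟨u, hu, hadj⟩
      · exact mem_union_left _ (mem_filter.2 ⟨mem_univ _, x, hx, h⟩)
      · refine mem_union_right _ ((mem_NS _ _ _).2 ⟨u, mem_filter.2 ⟨mem_univ _, x, hx, hu⟩, hadj⟩)
    calc _ ≤ (A ∪ NS H A).card := card_le_card hsub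
      _ ≤ A.card + (NS H A).card := card_union_le _ _
      _ ≤ A.card + A.card * Δ := by have := card_NS H Δ hdeg A; omega
      _ = A.card * (Δ + 1) := by ring
      _ ≤ (S.card * (Δ + 1) ^ r) * (Δ + 1) := Nat.mul_le_mul_right _ ih
      _ = _ := by ring

lemma far_sel {W : Type*} [Fintype W] (H : SimpleGraph W) (Δ : ℕ) (hdeg : ∀ w, degOf H w ≤ Δ)
    (S : Finset W) (r : ℕ) :
    ∃ S' ⊆ S, (∀ x ∈ S', ∀ y ∈ S', Nr H r x y → x = y) ∧ S.card ≤ S'.card * (Δ + 1) ^ r := by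
  have hne : (S.powerset.filter (fun S' => ∀ x ∈ S', ∀ y ∈ S', Nr H r x y → x = y)).Nonempty :=
    ⟨∅, by simp⟩
  obtain ⟨S', hS', hmax⟩ := exists_max_image _ (fun S' => S'.card) hne
  rw [mem_filter, mem_powerset] at hS'
  refine ⟨S', hS'.1, hS'.2, ?_⟩
  refine le_trans (card_le_card ?_) (card_Nr H Δ hdeg S' r)
  intro z hz
  rw [mem_filter]
  refine ⟨mem_univ _, ?_⟩
  by_contra hno
  push Not at hno
  have hzS : z ∉ S' := fun h => hno z h ((Nr.refl H z).mono (by omega))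
  have := hmax (insert z S') (by
    rw [mem_filter, mem_powerset]
    refine ⟨insert_subset hz hS'.1, ?_⟩
    intro x hx y hy hxy
    rcases mem_insert.1 hx with hx1 | hx1
    · rcases mem_insert.1 hy with hy1 | hy1
      · rw [hx1, hy1]
      · rw [hx1] at hxy
        exact absurd hxy.symm (hno y hy1)
    · rcases mem_insert.1 hy with hy1 | hy1
      · rw [hy1] at hxy
        exact absurd hxy (hno x hx1)
      · exact hS'.2 x hx1 y hy1 hxy)
  rw [card_insert_of_notMem hzS] at this
  omega

lemma pick_items {ι : Type*} (J : Finset ι) (s e : ι → ℝ) (S E M t : ℝ) (hs0 : ∀ j ∈ J, 0 ≤ s j)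
    (hS : 0 < S) (hE : 0 ≤ E) (ht : 0 ≤ t)
    (hsS : ∑ j ∈ J, s j ≤ S) (heE : E ≤ ∑ j ∈ J, e j) (hM : ∀ j ∈ J, s j ≤ M) (hMt : M ≤ t / 2)
    (htS : t ≤ 2 * S) :
    ∃ J' ⊆ J, ∑ j ∈ J', s j ≤ t ∧ E * t / (4 * S) ≤ ∑ j ∈ J', e j := by
  set D := J.filter (fun j => E / (2 * S) * s j ≤ e j)
  have hDJ : D ⊆ J := filter_subset _ _
  have hD : E / 2 ≤ ∑ j ∈ D, e j := by
    have h1 := sum_filter_add_sum_filter_not J (fun j => E / (2 * S) * s j ≤ e j) e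
    have h2 : ∑ j ∈ J.filter (fun j => ¬ E / (2 * S) * s j ≤ e j), e j ≤ E / 2 := by
      calc _ ≤ ∑ j ∈ J.filter (fun j => ¬ E / (2 * S) * s j ≤ e j), E / (2 * S) * s j := by
            apply sum_le_sum
            intro j hj
            exact (not_le.1 (mem_filter.1 hj).2).le
        _ ≤ ∑ j ∈ J, E / (2 * S) * s j := by
            apply sum_le_sum_of_subset_of_nonneg (filter_subset _ _)
            intro j hj _
            have := hs0 j hj
            positivity
        _ = E / (2 * S) * ∑ j ∈ J, s j := by rw [mul_sum]
        _ ≤ E / (2 * S) * S := by gcongr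
        _ = E / 2 := by field_simp
    change ∑ j ∈ D, e j + _ = _ at h1
    linarith
  have hne : (D.powerset.filter (fun J' => ∑ j ∈ J', s j ≤ t)).Nonempty := ⟨∅, by simp [ht]⟩
  obtain ⟨J', hJ', hmax⟩ := exists_max_image _ (fun J' => J'.card) hne
  rw [mem_filter, mem_powerset] at hJ'
  refine ⟨J', hJ'.1.trans hDJ, hJ'.2, ?_⟩
  by_cases hall : J' = D
  · rw [hall]
    refine le_trans ?_ hD
    rw [div_le_div_iff₀ (by positivity) (by norm_num)]
    nlinarith
  · obtain ⟨j, hjD, hjJ⟩ := exists_of_ssubset (lt_of_le_of_ne hJ'.1 hall)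
    have hgt : t < s j + ∑ i ∈ J', s i := by
      by_contra hle
      push Not at hle
      have := hmax (insert j J') (by
        rw [mem_filter, mem_powerset]
        exact ⟨insert_subset hjD hJ'.1, by rwa [sum_insert hjJ]⟩)
      rw [card_insert_of_notMem hjJ] at this
      omega
    have := hM j (hDJ hjD)
    calc E * t / (4 * S) = E / (2 * S) * (t / 2) := by field_simp; ring
      _ ≤ E / (2 * S) * ∑ i ∈ J', s i := by
          gcongr
          linarith
      _ = ∑ i ∈ J', E / (2 * S) * s i := by rw [mul_sum]
      _ ≤ _ := by
          apply sum_le_sum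
          intro i hi
          exact (mem_filter.1 (hJ'.1 hi)).2

lemma pick_W {W : Type*} [Fintype W] (lab : W → Finset W) (P Act : Finset W) (S E M t : ℝ)
    (hS : 0 < S) (hE : 0 ≤ E) (ht : 0 ≤ t) (hW : (Fintype.card W : ℝ) ≤ S)
    (hEA : E ≤ ((Act \ P).card : ℝ))
    (hM : ∀ l, ((((univ : Finset W) \ P).filter (fun w => lab w = l)).card : ℝ) ≤ M)
    (hMt : M ≤ t / 2) (htS : t ≤ 2 * S) :
    ∃ Q : Finset W, Disjoint P Q ∧ (∀ x ∈ Q, ∀ y, y ∉ P → lab y = lab x → y ∈ Q) ∧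
      (Q.card : ℝ) ≤ t ∧ E * t / (4 * S) ≤ ((Q ∩ Act).card : ℝ) := by
  have key : ∀ (J : Finset (Finset W)) (U : Finset W),
      ((U.filter (fun w => lab w ∈ J)).card : ℝ) = ∑ l ∈ J, ((U.filter (fun w => lab w = l)).card : ℝ) := by
    intro J U
    rw [← Nat.cast_sum, Nat.cast_inj]
    rw [card_eq_sum_card_fiberwise (s := U.filter (fun w => lab w ∈ J)) (t := J) (f := lab)
      (by intro w hw; exact (mem_filter.1 hw).2)]
    apply sum_congr rfl
    intro l hl
    congr 1
    ext w
    simp only [mem_filter]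
    constructor
    · rintro ⟨⟨a, b⟩, c⟩; exact ⟨a, c⟩
    · rintro ⟨a, c⟩; exact ⟨⟨a, c ▸ hl⟩, c⟩
  obtain ⟨J, hJ, h1, h2⟩ := pick_items (univ : Finset (Finset W))
    (fun l => ((((univ : Finset W) \ P).filter (fun w => lab w = l)).card : ℝ))
    (fun l => (((Act \ P).filter (fun w => lab w = l)).card : ℝ)) S E M t
    (fun j _ => by positivity) hS hE ht
    (by rw [← key]; exact le_trans (by exact_mod_cast card_le_univ _) hW)
    (by rw [← key]; simpa using hEA) (fun l _ => hM l) hMt htS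
  rw [← key] at h1 h2
  refine ⟨((univ : Finset W) \ P).filter (fun w => lab w ∈ J), ?_, ?_, h1, ?_⟩
  · rw [disjoint_left]
    intro x hx hx'
    exact (mem_sdiff.1 (mem_filter.1 hx').1).2 hx
  · intro x hx y hy hl
    rw [mem_filter, mem_sdiff] at hx ⊢
    exact ⟨⟨mem_univ _, hy⟩, hl ▸ hx.2⟩
  · refine le_trans h2 ?_
    apply Nat.cast_le.2
    apply card_le_card
    intro w hw
    simp only [mem_filter, mem_sdiff, mem_inter] at hw ⊢
    exact ⟨⟨⟨mem_univ _, hw.1.2⟩, hw.2⟩, hw.1.1⟩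

lemma exists_ty {W : Type*} (S : Finset W) (f : ℕ → ℕ) (r : ℕ) (h : ∑ j ∈ range r, f j ≤ S.card) :
    ∃ ty : W → ℕ, ∀ j < r, (S.filter (fun c => ty c = j)).card = f j := by
  induction r with
  | zero => exact ⟨fun _ => 0, by simp⟩
  | succ r ih =>
    rw [sum_range_succ] at h
    obtain ⟨ty, hty⟩ := ih (by omega)
    have h1 : (S.filter (fun c => ty c < r)).card = ∑ j ∈ range r, f j := by
      rw [card_eq_sum_card_fiberwise (s := S.filter (fun c => ty c < r)) (t := range r) (f := ty)
        (by intro w hw; exact mem_coe.2 (mem_range.2 (mem_filter.1 hw).2))]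
      apply sum_congr rfl
      intro j hj
      rw [← hty j (mem_range.1 hj)]
      congr 1
      ext w
      simp only [mem_filter]
      have := mem_range.1 hj
      constructor
      · rintro ⟨⟨a, b⟩, c⟩; exact ⟨a, c⟩
      · rintro ⟨a, c⟩; exact ⟨⟨a, by omega⟩, c⟩
    have h2 := card_filter_add_card_filter_not (s := S) (fun c => ty c < r)
    obtain ⟨U, hU, hUc⟩ := exists_subset_card_eq
      (show f r ≤ (S.filter (fun c => ¬ ty c < r)).card by omega)
    refine ⟨fun w => if w ∈ U then r else if ty w < r then ty w else r + 1, ?_⟩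
    intro j hj
    by_cases hjr : j = r
    · subst hjr
      rw [← hUc]
      congr 1
      ext w
      simp only [mem_filter]
      constructor
      · rintro ⟨a, b⟩
        split_ifs at b
        · assumption
        · omega
        · omega
      · intro hw
        exact ⟨(mem_filter.1 (hU hw)).1, by simp [hw]⟩
    · rw [← hty j (by omega)]
      congr 1
      ext w
      simp only [mem_filter]
      constructor
      · rintro ⟨a, b⟩
        split_ifs at b
        · omega
        · exact ⟨a, b⟩
        · omega
      · rintro ⟨a, b⟩
        have : w ∉ U := fun hw => (mem_filter.1 (hU hw)).2 (by omega)
        refine ⟨a, ?_⟩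
        rw [if_neg this, if_pos (by omega), b]

lemma sep_lab {W : Type*} [Fintype W] (H : SimpleGraph W) (μ : ℝ) (h : Separable H μ) :
    ∃ (X : Finset W) (lab : W → Finset W), (X.card : ℝ) ≤ μ * Fintype.card W ∧
      (∀ x y, H.Adj x y → x ∉ X → y ∉ X → lab x = lab y) ∧
      ∀ l, (((univ : Finset W).filter (fun w => w ∉ X ∧ lab w = l)).card : ℝ) ≤ μ * Fintype.card W := by
  obtain ⟨X, hX, hK⟩ := h
  set H' := SimpleGraph.induce ((↑X : Set W)ᶜ) H with hH'
  have mem : ∀ w, w ∉ X → w ∈ ((↑X : Set W)ᶜ) := fun w hw => by simpa using hw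
  set lab : W → Finset W := fun w => if hw : w ∉ X then
    ((H'.connectedComponentMk ⟨w, mem w hw⟩).supp.toFinset).image (Subtype.val) else ∅ with hlab
  refine ⟨X, lab, hX, ?_, ?_⟩
  · intro x y hadj hx hy
    simp only [hlab, dif_pos hx, dif_pos hy]
    have : H'.connectedComponentMk ⟨x, mem x hx⟩ = H'.connectedComponentMk ⟨y, mem y hy⟩ := by
      apply SimpleGraph.ConnectedComponent.sound
      apply SimpleGraph.Adj.reachable
      simpa [hH'] using hadj
    rw [this]
  · intro l
    by_cases hne : ((univ : Finset W).filter (fun w => w ∉ X ∧ lab w = l)).Nonempty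
    · obtain ⟨w0, hw0⟩ := hne
      obtain ⟨hw0X, hl⟩ := (mem_filter.1 hw0).2
      refine le_trans ?_ (hK (H'.connectedComponentMk ⟨w0, mem w0 hw0X⟩))
      apply Nat.cast_le.2
      have hsub : (univ : Finset W).filter (fun w => w ∉ X ∧ lab w = l) ⊆ lab w0 := by
        intro w hw
        obtain ⟨hwX, hwl⟩ := (mem_filter.1 hw).2
        rw [hl, ← hwl]
        simp only [hlab, dif_pos hwX]
        rw [mem_image]
        exact ⟨⟨w, mem w hwX⟩, by simp, rfl⟩
      refine le_trans (card_le_card hsub) ?_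
      simp only [hlab, dif_pos hw0X]
      refine le_trans card_image_le ?_
      rw [Set.ncard_eq_toFinset_card']
    · rw [not_nonempty_iff_eq_empty] at hne
      rw [hne, card_empty, Nat.cast_zero]
      exact le_trans (Nat.cast_nonneg _) hX

lemma act_count {W : Type*} [Fintype W] (H : SimpleGraph W) (Δ : ℕ) (hdeg : ∀ w, degOf H w ≤ Δ)
    (part : W → Bool) (hbip : ∀ x y, H.Adj x y → part y = !(part x)) (X : Finset W) :
    (EH H).card ≤ (((univ : Finset W).filter (fun w => part w = false ∧ (∃ y, H.Adj w y) ∧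
      ∀ x ∈ X, ¬ Nr H 4 x w)).card + X.card * (Δ + 1) ^ 4) * Δ := by
  set Act := (univ : Finset W).filter (fun w => part w = false ∧ (∃ y, H.Adj w y) ∧
      ∀ x ∈ X, ¬ Nr H 4 x w)
  set B := (univ : Finset W).filter (fun w => ∃ x ∈ X, Nr H 4 x w)
  have hB : B.card ≤ X.card * (Δ + 1) ^ 4 := card_Nr H Δ hdeg X 4
  have h1 := card_touch H Δ hdeg (Act ∪ B)
  have h2 : (EH H) ⊆ (EH H).filter (fun e => ∃ x ∈ e, x ∈ Act ∪ B) := by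
    intro e he
    rw [mem_filter]
    refine ⟨he, ?_⟩
    induction e using Sym2.ind with
    | _ x y =>
    rw [mem_EH_mk] at he
    have : ∀ u v, H.Adj u v → part u = false → u ∈ Act ∪ B := by
      intro u v huv hu
      by_cases h : ∃ x ∈ X, Nr H 4 x u
      · exact mem_union_right _ (mem_filter.2 ⟨mem_univ _, h⟩)
      · push Not at h
        exact mem_union_left _ (mem_filter.2 ⟨mem_univ _, hu, ⟨v, huv⟩, h⟩)
    cases hx : part x with
    | false => exact ⟨x, by simp, this x y he hx⟩
    | true => exact ⟨y, by simp, this y x he.symm (by rw [hbip x y he, hx]; rfl)⟩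
  refine le_trans (card_le_card h2) (le_trans h1 (Nat.mul_le_mul_right _ ?_))
  exact le_trans (card_union_le _ _) (by omega)


set_option maxHeartbeats 1000000 in
lemma hstruct {W : Type*} [Fintype W] (H : SimpleGraph W) (Δ : ℕ) (hΔ : 1 ≤ Δ) (hdeg : ∀ w, degOf H w ≤ Δ)
    (part : W → Bool) (hbip : ∀ x y, H.Adj x y → part y = !(part x)) (X : Finset W)
    (lab : W → Finset W) (hlab : ∀ x y, H.Adj x y → x ∉ X → y ∉ X → lab x = lab y)
    (xr S E tQ tF : ℝ) (f : ℕ → ℕ) (k : ℕ) (hX : (X.card : ℝ) ≤ xr)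
    (hcl : ∀ l, (((univ : Finset W).filter (fun w => w ∉ X ∧ lab w = l)).card : ℝ) ≤ xr)
    (hS : 0 < S) (hW : (Fintype.card W : ℝ) ≤ S)
    (hE : (E + xr * (Δ + 1) ^ 4) * Δ ≤ (EH H).card)
    (hE0 : tQ ≤ E) (htQ : 2 * xr ≤ tQ) (htF : 2 * xr ≤ tF) (htQS : tQ ≤ 2 * S) (htFS : tF ≤ 2 * S)
    (hf : (∑ j ∈ range 5, (f j : ℝ)) * (Δ + 1) ^ 6 ≤ E * tQ / (4 * S))
    (hk : (k : ℝ) * (Δ + 1) ^ 6 ≤ (E - tQ) * tF / (4 * S)) :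
    ∃ (Q F GF Γ : Finset W) (ty : W → ℕ) (nb : W → W),
      (Q.card : ℝ) ≤ tQ ∧ (F.card : ℝ) ≤ tF ∧
      Disjoint X Q ∧ Disjoint X F ∧ Disjoint Q F ∧
      (∀ x ∈ Q, ∀ y, H.Adj x y → y ∈ Q ∨ y ∈ X) ∧
      (∀ x ∈ F, ∀ y, H.Adj x y → y ∈ F ∨ y ∈ X) ∧
      GF ⊆ F ∧ GF.card = k ∧ (∀ x ∈ GF, nb x ∈ F) ∧ (∀ x ∈ GF, H.Adj x (nb x)) ∧
      (∀ x ∈ GF, part x = false) ∧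
      (∀ x ∈ GF, ∀ x' ∈ GF, H.Adj x (nb x') → x = x') ∧
      (∀ z, ∀ p ∈ GF ∪ GF.image nb, ∀ p' ∈ GF ∪ GF.image nb, H.Adj z p → H.Adj z p' → p = p') ∧
      (∀ z, ∀ p ∈ GF ∪ GF.image nb, ∀ x ∈ X, H.Adj z p → ¬ H.Adj z x) ∧
      (∀ c ∈ Γ, part c = false) ∧ (∀ c ∈ Γ, H.Adj c (nb c)) ∧
      (∀ c ∈ Γ, ∀ p, Bl H c p → p ∈ Q) ∧
      (∀ c ∈ Γ, ∀ p, Bl H c p → ∀ x ∈ X, ¬ H.Adj p x ∧ ∀ z, H.Adj p z → ¬ H.Adj z x) ∧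
      (∀ c ∈ Γ, ∀ c' ∈ Γ, ∀ p p', Bl H c p → Bl H c' p' →
        (p = p' ∨ H.Adj p p' ∨ ∃ z, H.Adj z p ∧ H.Adj z p') → c = c') ∧
      (∀ j < 5, (Γ.filter (fun c => ty c = j)).card = f j) := by
  have hx0 : 0 ≤ xr := le_trans (Nat.cast_nonneg _) hX
  set Act := (univ : Finset W).filter (fun w => part w = false ∧ (∃ y, H.Adj w y) ∧
      ∀ x ∈ X, ¬ Nr H 4 x w) with hAct
  have hΔ0 : (0 : ℝ) < Δ := by exact_mod_cast hΔ
  have hActE : E ≤ (Act.card : ℝ) := by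
    have h1 := act_count H Δ hdeg part hbip X
    have h2 : ((EH H).card : ℝ) ≤ ((Act.card : ℝ) + X.card * (Δ + 1) ^ 4) * Δ := by exact_mod_cast h1
    have h3 := le_of_mul_le_mul_right (hE.trans h2) hΔ0
    have : (X.card : ℝ) * (Δ + 1) ^ 4 ≤ xr * (Δ + 1) ^ 4 := by gcongr
    linarith
  have hActX : ∀ w ∈ Act, w ∉ X := by
    intro w hw hwX
    exact (mem_filter.1 hw).2.2.2 w hwX ((Nr.refl H w).mono (by omega))
  have hcl' : ∀ (P : Finset W), X ⊆ P → ∀ l,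
      ((((univ : Finset W) \ P).filter (fun w => lab w = l)).card : ℝ) ≤ xr := by
    intro P hP l
    refine le_trans ?_ (hcl l)
    apply Nat.cast_le.2
    apply card_le_card
    intro w hw
    simp only [mem_filter, mem_sdiff] at hw ⊢
    exact ⟨mem_univ _, fun h => hw.1.2 (hP h), hw.2⟩
  obtain ⟨Q, hXQ, hQc, hQt, hQA⟩ := pick_W lab X Act S E xr tQ hS (by linarith) (by linarith) hW
    (by
      rw [sdiff_eq_self_of_disjoint (disjoint_left.2 hActX)]
      exact hActE) (hcl' X subset_rfl) (by linarith) htQS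
  have hQcl : ∀ x ∈ Q, ∀ y, H.Adj x y → y ∈ Q ∨ y ∈ X := by
    intro x hx y hxy
    by_cases hy : y ∈ X
    · exact Or.inr hy
    · exact Or.inl (hQc x hx y hy (hlab x y hxy (fun h => disjoint_left.1 hXQ h hx) hy).symm)
  obtain ⟨F, hPF, hFc, hFt, hFA⟩ := pick_W lab (X ∪ Q) Act S (E - tQ) xr tF hS (by linarith) (by linarith) hW
    (by
      have : Act \ (X ∪ Q) = Act \ Q := by
        ext w
        simp only [mem_sdiff, mem_union]
        constructor
        · rintro ⟨a, b⟩; exact ⟨a, fun h => b (Or.inr h)⟩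
        · rintro ⟨a, b⟩; exact ⟨a, fun h => h.elim (hActX w a) b⟩
      rw [this]
      have h1 := le_card_sdiff Q Act
      have h2 : (Act.card : ℝ) - Q.card ≤ ((Act \ Q).card : ℝ) := by
        have : Act.card ≤ (Act \ Q).card + Q.card := by omega
        have : (Act.card : ℝ) ≤ (Act \ Q).card + Q.card := by exact_mod_cast this
        linarith
      linarith) (hcl' _ subset_union_left) (by linarith) htFS
  have hXF : Disjoint X F := disjoint_of_subset_left subset_union_left hPF
  have hQF : Disjoint Q F := disjoint_of_subset_left subset_union_right hPF
  have hFcl : ∀ x ∈ F, ∀ y, H.Adj x y → y ∈ F ∨ y ∈ X := by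
    intro x hx y hxy
    have hxX : x ∉ X := fun h => disjoint_left.1 hXF h hx
    have hxQ : x ∉ Q := fun h => disjoint_left.1 hQF h hx
    by_cases hy : y ∈ X
    · exact Or.inr hy
    · left
      have hyQ : y ∉ Q := by
        intro h
        rcases hQcl y h x hxy.symm with h' | h'
        · exact hxQ h'
        · exact hxX h'
      exact hFc x hx y (by simp [hy, hyQ]) (hlab x y hxy hxX hy).symm
  have D0 : (0 : ℝ) < (Δ + 1) ^ 6 := by positivity
  obtain ⟨Γ, hΓs, hΓfar, hΓc⟩ := far_sel H Δ hdeg (Q ∩ Act) 6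
  obtain ⟨G0, hG0s, hG0far, hG0c⟩ := far_sel H Δ hdeg (F ∩ Act) 6
  have hΓc' : ∑ j ∈ range 5, f j ≤ Γ.card := by
    have h1 : ((Q ∩ Act).card : ℝ) ≤ Γ.card * (Δ + 1) ^ 6 := by exact_mod_cast hΓc
    have := le_of_mul_le_mul_right (hf.trans (hQA.trans h1)) D0
    exact_mod_cast this
  have hG0c' : k ≤ G0.card := by
    have h1 : ((F ∩ Act).card : ℝ) ≤ G0.card * (Δ + 1) ^ 6 := by exact_mod_cast hG0c
    have := le_of_mul_le_mul_right (hk.trans (hFA.trans h1)) D0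
    exact_mod_cast this
  obtain ⟨ty, hty⟩ := exists_ty Γ f 5 hΓc'
  obtain ⟨GF, hGFs, hGFc⟩ := exists_subset_card_eq hG0c'
  have hnb : ∀ w, ∃ y, w ∈ Act → H.Adj w y := by
    intro w
    by_cases hw : w ∈ Act
    · obtain ⟨y, hy⟩ := (mem_filter.1 hw).2.2.1
      exact ⟨y, fun _ => hy⟩
    · exact ⟨w, fun h => absurd h hw⟩
  choose nb hnb using hnb
  have gA : ∀ x ∈ GF, x ∈ Act := fun x hx => (mem_inter.1 (hG0s (hGFs hx))).2
  have gF : ∀ x ∈ GF, x ∈ F := fun x hx => (mem_inter.1 (hG0s (hGFs hx))).1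
  have gfar : ∀ x ∈ GF, ∀ y ∈ GF, Nr H 6 x y → x = y := fun x hx y hy h =>
    hG0far x (hGFs hx) y (hGFs hy) h
  have cA : ∀ x ∈ Γ, x ∈ Act := fun x hx => (mem_inter.1 (hΓs hx)).2
  have cQ : ∀ x ∈ Γ, x ∈ Q := fun x hx => (mem_inter.1 (hΓs hx)).1
  have aX : ∀ w ∈ Act, ∀ x ∈ X, ¬ Nr H 4 x w := fun w hw => (mem_filter.1 hw).2.2.2
  have ap : ∀ w ∈ Act, part w = false := fun w hw => (mem_filter.1 hw).2.1
  have own : ∀ p ∈ GF ∪ GF.image nb, ∃ x ∈ GF, Nr H 1 x p ∧ (p = x ∨ p = nb x) := by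
    intro p hp
    rcases mem_union.1 hp with h | h
    · exact ⟨p, h, (Nr.refl H p).mono (by omega), Or.inl rfl⟩
    · obtain ⟨x, hx, rfl⟩ := mem_image.1 h
      exact ⟨x, hx, Nr.of_adj (hnb x (gA x hx)), Or.inr rfl⟩
  refine ⟨Q, F, GF, Γ, ty, nb, hQt, hFt, hXQ, hXF, hQF, hQcl, hFcl, gF, hGFc, ?_,
    fun x hx => hnb x (gA x hx), fun x hx => ap x (gA x hx), ?_, ?_, ?_, fun c hc => ap c (cA c hc),
    fun c hc => hnb c (cA c hc), ?_, ?_, ?_, hty⟩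
  · intro x hx
    rcases hFcl x (gF x hx) _ (hnb x (gA x hx)) with h | h
    · exact h
    · exact absurd ((Nr.of_adj (hnb x (gA x hx))).symm.mono (by omega)) (aX x (gA x hx) _ h)
  · intro x hx x' hx' hadj
    exact gfar x hx x' hx' (((Nr.of_adj hadj).trans (Nr.of_adj (hnb x' (gA x' hx'))).symm).mono (by omega))
  · intro z p hp p' hp' hz hz'
    obtain ⟨x, hx, hn, hor⟩ := own p hp
    obtain ⟨x', hx', hn', hor'⟩ := own p' hp'
    have hxx : x = x' := gfar x hx x' hx' (((hn.trans (Nr.of_adj hz).symm).trans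
      ((Nr.of_adj hz').trans hn'.symm)).mono (by omega))
    subst hxx
    have b1 := hbip _ _ hz
    have b2 := hbip _ _ hz'
    have b3 := hbip _ _ (hnb x (gA x hx))
    rcases hor with h | h <;> rcases hor' with h' | h' <;> subst h <;> rw [h'] at b2 ⊢
    · rw [b2, b1] at b3
      cases hpz : part z <;> simp [hpz] at b3
    · rw [b1, b2] at b3
      cases hpz : part z <;> simp [hpz] at b3
  · intro z p hp x hx hz hzx
    obtain ⟨y, hy, hn, _⟩ := own p hp
    refine aX y (gA y hy) x hx ?_
    exact (((Nr.of_adj hzx).symm.trans (Nr.of_adj hz)).trans hn.symm).mono (by omega)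
  · have step : ∀ c ∈ Γ, ∀ r, r ≤ 3 → ∀ p ∈ Q, Nr H r c p → ∀ y, H.Adj p y → y ∈ Q := by
      intro c hc r hr p hp hn y hy
      rcases hQcl p hp y hy with h | h
      · exact h
      · exact absurd ((hn.trans (Nr.of_adj hy)).symm.mono (by omega)) (aX c (cA c hc) y h)
    intro c hc p hp
    rcases hp with rfl | h | ⟨y, h1, h2⟩
    · exact cQ _ hc
    · exact step c hc 0 (by omega) c (cQ c hc) (Nr.refl H c) p h
    · exact step c hc 1 (by omega) y (step c hc 0 (by omega) c (cQ c hc) (Nr.refl H c) y h1) (Nr.of_adj h1) p h2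
  · intro c hc p hp x hx
    have hn := Nr.of_Bl hp
    refine ⟨fun h => aX c (cA c hc) x hx ((hn.trans (Nr.of_adj h)).symm.mono (by omega)), fun z hz hzx => ?_⟩
    exact aX c (cA c hc) x hx (((hn.trans (Nr.of_adj hz)).trans (Nr.of_adj hzx)).symm.mono (by omega))
  · intro c hc c' hc' p p' hp hp' hor
    have h1 := Nr.of_Bl hp
    have h2 := (Nr.of_Bl hp').symm
    apply hΓfar c hc c' hc'
    rcases hor with rfl | h | ⟨z, hz, hz'⟩
    · exact (h1.trans h2).mono (by omega)
    · exact ((h1.trans (Nr.of_adj h)).trans h2).mono (by omega)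
    · exact ((h1.trans ((Nr.of_adj hz).symm.trans (Nr.of_adj hz'))).trans h2).mono (by omega)


/-- degree in the thick graph from the sum of degrees -/
lemma tdeg_aux {V C : Type*} [Fintype V] [Fintype C] (G : C → SimpleGraph V) (Vs : Bool → Finset V)
    (hb : ∀ c x y, (G c).Adj x y → ∀ i, x ∈ Vs i → y ∈ Vs (!i))
    (d δ : ℝ) (n : ℕ) (hd : 0 < d) (hδ : 0 < δ)
    (hC : 0 < Fintype.card C) (hV : ∀ i, ((Vs i).card : ℝ) ≤ n / δ)
    (hdeg : ∀ i, ∀ v ∈ Vs i, d * (Fintype.card C : ℝ) * (n : ℝ) ≤ ∑ c : C, (degOf (G c) v : ℝ))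
    (i : Bool) (v : V) (hv : v ∈ Vs i) :
    d / 2 * n ≤ (((Vs (!i)).filter (fun u => Thick G univ (d * δ / 2 * Fintype.card C) v u)).card : ℝ) := by
  have hm : (0 : ℝ) < Fintype.card C := by exact_mod_cast hC
  have h1 := coldeg_le G univ (d * δ / 2 * Fintype.card C) v (by positivity) (Vs (!i))
  have h2 := hdeg i v hv
  have h3 : ∀ c, degOf (G c) v = ((Vs (!i)).filter (fun b => (G c).Adj v b)).card := by
    intro c
    unfold degOf
    congr 1
    ext w
    simp only [mem_filter, mem_univ, true_and]
    exact ⟨fun h => ⟨hb c v w h i hv, h⟩, fun h => h.2⟩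
  simp only [h3] at h2
  have h4 := h2.trans h1
  rw [card_univ] at h4
  have h5 : ((Vs (!i)).card : ℝ) * (d * δ / 2 * Fintype.card C) ≤ d / 2 * n * Fintype.card C := by
    calc _ ≤ (n / δ) * (d * δ / 2 * Fintype.card C) := by
          apply mul_le_mul_of_nonneg_right (hV _); positivity
      _ = _ := by field_simp
  refine le_of_mul_le_mul_right (a := (Fintype.card C : ℝ)) ?_ hm
  linarith

/-- number of edges as a pair count -/
lemma edge_pair {V : Type*} [Fintype V] (G : SimpleGraph V) (V₁ V₂ : Finset V)
    (hb : ∀ x y, G.Adj x y → (x ∈ V₁ ∧ y ∈ V₂) ∨ (x ∈ V₂ ∧ y ∈ V₁)) :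
    edgeCnt G ≤ pairCount G V₁ V₂ := by
  unfold edgeCnt pairCount
  have hsub : (univ : Finset (Sym2 V)).filter (fun e => e ∈ G.edgeSet) ⊆
      ((V₁ ×ˢ V₂).filter (fun p => G.Adj p.1 p.2)).image (fun p => s(p.1, p.2)) := by
    intro e he
    induction e using Sym2.ind with
    | _ x y =>
    have hadj : G.Adj x y := by simpa using he
    rw [mem_image]
    rcases hb x y hadj with ⟨h1, h2⟩ | ⟨h1, h2⟩
    · exact ⟨(x, y), by simp [h1, h2, hadj], rfl⟩
    · exact ⟨(y, x), by simp [h1, h2, hadj.symm], Sym2.eq_swap⟩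
  exact (card_le_card hsub).trans card_image_le

lemma kappa_aux {V : Type*} [Fintype V] (G : SimpleGraph V) (V₁ V₂ : Finset V)
    (hb : ∀ x y, G.Adj x y → (x ∈ V₁ ∧ y ∈ V₂) ∨ (x ∈ V₂ ∧ y ∈ V₁))
    (d δ : ℝ) (n : ℕ) (hd : 0 < d) (hδ : 0 < δ) (hn : 0 < n) (h1 : (V₁.card : ℝ) ≤ n / δ)
    (h2 : (V₂.card : ℝ) ≤ n / δ) (hG : d * (n : ℝ) ^ 2 ≤ edgeCnt G) :
    d * δ / 2 * n ≤ ((V₁.filter (fun u => d * δ / 2 * n ≤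
      ((V₂.filter (fun w => G.Adj u w)).card : ℝ))).card : ℝ) := by
  set P := fun u => d * δ / 2 * n ≤ ((V₂.filter (fun w => G.Adj u w)).card : ℝ) with hP
  have hn0 : (0 : ℝ) < n := by exact_mod_cast hn
  have e1 : d * (n : ℝ) ^ 2 ≤ ∑ a ∈ V₁, ((V₂.filter (fun w => G.Adj a w)).card : ℝ) := by
    have := edge_pair G V₁ V₂ hb
    rw [pairCount_eq] at this
    refine hG.trans ?_
    exact_mod_cast this
  rw [← sum_filter_add_sum_filter_not V₁ P] at e1
  have e2 : ∑ a ∈ V₁.filter P, ((V₂.filter (fun w => G.Adj a w)).card : ℝ) ≤ (V₁.filter P).card * (n / δ) := by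
    rw [← nsmul_eq_mul]
    apply sum_le_card_nsmul
    intro a _
    refine le_trans ?_ h2
    exact_mod_cast card_filter_le _ _
  have e3 : ∑ a ∈ V₁.filter (fun u => ¬ P u), ((V₂.filter (fun w => G.Adj a w)).card : ℝ) ≤
      d / 2 * n ^ 2 := by
    calc _ ≤ (V₁.filter (fun u => ¬ P u)).card * (d * δ / 2 * n) := by
          rw [← nsmul_eq_mul]
          apply sum_le_card_nsmul
          intro a ha
          exact (not_le.1 (mem_filter.1 ha).2).le
      _ ≤ (n / δ) * (d * δ / 2 * n) := by
          apply mul_le_mul_of_nonneg_right _ (by positivity)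
          exact le_trans (by exact_mod_cast card_filter_le _ _) h1
      _ = _ := by field_simp
  have e4 : d / 2 * (n : ℝ) ^ 2 ≤ (V₁.filter P).card * (n / δ) := by linarith
  have hnd : 0 < (n : ℝ) / δ := by positivity
  refine le_of_mul_le_mul_right (le_trans (le_of_eq ?_) e4) hnd
  field_simp

/-- typicality for large colour sets -/
lemma typ_aux {V C : Type*} [Fintype C] (G : C → SimpleGraph V) (Vs : Bool → Finset V)
    (d ε e : ℝ) (k : ℕ) (hd : 0 < d) (he : 0 < e) (hk : 0 < k)
    (hεe : ∀ i, ε * ((Vs i).card : ℝ) ≤ e) (hεk : ε * Fintype.card C ≤ k)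
    (ha : ∀ A ⊆ Vs false, ∀ B ⊆ Vs true, ∀ C' : Finset C,
        ε * ((Vs false).card : ℝ) ≤ (A.card : ℝ) → ε * ((Vs true).card : ℝ) ≤ (B.card : ℝ) →
        ε * (Fintype.card C : ℝ) ≤ (C'.card : ℝ) →
        d * (C'.card : ℝ) * (A.card : ℝ) * (B.card : ℝ) ≤ ∑ c ∈ C', (pairCount (G c) A B : ℝ))
    (K : Finset C) (hK : k ≤ K.card) : Typ (Thick G K (d / 2 * K.card)) Vs e (d / 2) := by
  have hK' : (k : ℝ) ≤ K.card := by exact_mod_cast hK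
  apply typ_thick G K Vs d e hd he (by omega)
  intro i A hA B hB heA heB
  cases i with
  | false => exact ha A hA B hB K ((hεe _).trans heA) ((hεe _).trans heB) (hεk.trans hK')
  | true =>
    have := ha B hB A hA K ((hεe _).trans heB) ((hεe _).trans heA) (hεk.trans hK')
    simp only [pairCount_comm _ A B]
    linarith

lemma floor_half (c : ℝ) (n : ℕ) (hc : 0 < c) (h : 2 ≤ c * n) : c * n / 2 ≤ (⌊c * n⌋₊ : ℝ) := by
  have := Nat.lt_floor_add_one (c * n)
  linarith

lemma floor_le' (c : ℝ) (n : ℕ) (hc : 0 < c) : (⌊c * n⌋₊ : ℝ) ≤ c * n :=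
  Nat.floor_le (by positivity)

lemma exp_small (r K : ℝ) (hr0 : 0 ≤ r) (hr : r < 1) (hK : 0 < K) :
    ∃ N : ℕ, ∀ n : ℕ, N ≤ n → K * (n : ℝ) ^ 2 * r ^ n < 1 / 4 := by
  have h := tendsto_pow_const_mul_const_pow_of_lt_one 2 hr0 hr
  have h2 := h.const_mul K
  rw [mul_zero] at h2
  obtain ⟨N, hN⟩ := Filter.eventually_atTop.1 (h2.eventually (gt_mem_nhds (show (0 : ℝ) < 1 / 4 by norm_num)))
  exact ⟨N, fun n hn => by have := hN n hn; rw [← mul_assoc] at this; exact this⟩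

/-- make `2 ^ t * b ^ s` exponentially small -/
lemma exists_t (b s : ℝ) (hb0 : 0 < b) (hb1 : b < 1) (hs : 0 < s) :
    ∃ t : ℝ, 0 < t ∧ (2 : ℝ) ^ t * b ^ s < 1 := by
  have h1 : b ^ s < 1 := Real.rpow_lt_one hb0.le hb1 hs
  have hc : Filter.Tendsto (fun t : ℝ => (2 : ℝ) ^ t * b ^ s) (nhds 0) (nhds ((2 : ℝ) ^ (0 : ℝ) * b ^ s)) := by
    apply Filter.Tendsto.mul_const
    exact (Real.continuous_const_rpow (by norm_num)).tendsto 0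
  rw [Real.rpow_zero, one_mul] at hc
  have hev := hc.eventually (gt_mem_nhds h1)
  rw [Metric.eventually_nhds_iff] at hev
  obtain ⟨η, hη, h⟩ := hev
  exact ⟨η / 2, by positivity, h (by rw [dist_zero_right, Real.norm_eq_abs, abs_of_pos (by positivity)]; linarith)⟩

/-- passing from reals to floors -/
lemma two_pow_floor (t b s : ℝ) (n t0 s0 : ℕ) (hb0 : 0 < b) (hb1 : b < 1)
    (ht : (t0 : ℝ) ≤ t * n) (hs : s * n ≤ s0) :
    (2 : ℝ) ^ t0 * b ^ s0 ≤ ((2 : ℝ) ^ t * b ^ s) ^ n := by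
  rw [mul_pow, ← Real.rpow_natCast 2 t0, ← Real.rpow_natCast b s0, ← Real.rpow_natCast (2 ^ t) n,
    ← Real.rpow_natCast (b ^ s) n, ← Real.rpow_mul (by norm_num), ← Real.rpow_mul hb0.le]
  apply mul_le_mul
  · exact Real.rpow_le_rpow_of_exponent_le (by norm_num) ht
  · exact Real.rpow_le_rpow_of_exponent_ge hb0 hb1.le hs
  · positivity
  · positivity


/-- numeric parameters -/
structure Par (Δ : ℕ) (δ q α : ℝ) where
  Q0 : ℝ
  D : ℝ
  σ : ℝ
  ρ : ℝ
  γ : ℝ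
  β : ℝ
  ι : ℝ
  t : ℝ
  lam : ℝ
  c : ℝ
  φ : ℝ
  k : ℝ
  eh : ℝ
  x : ℝ
  L : ℕ
  qR : ℕ
  hQ0 : Q0 = q ^ Δ
  hD : D = (Δ + 1) ^ 6
  σ0 : 0 < σ
  σ1 : σ ≤ α
  σ2 : σ ≤ Q0 / 2
  ρ0 : 0 < ρ
  ρ1 : 16 * ρ ≤ Q0 ^ 2
  ρ2 : 4 * ρ ≤ σ
  ρ3 : ρ * (Δ + 1) ≤ α * δ
  ρ4 : 4 * Δ * ρ ≤ δ
  ρ5 : Δ * (Δ + 1) * ρ ≤ Q0 / 8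
  ρ6 : ρ ≤ 1
  hγ : γ * (16 * Δ * D) = ρ * δ ^ 2
  γ0 : 0 < γ
  γ1 : γ ≤ δ
  hL3 : 3 ≤ L
  hL : 4 / α ≤ (1 + (α / 4) ^ 2) ^ L
  hβ : β = α ^ L * γ / 16
  β0 : 0 < β
  ι0 : 0 < ι
  ι1 : ι ≤ γ / 8
  ι2 : 2 * ι * (1 + Δ) * Δ ≤ α * β / 12
  qR1 : 1 ≤ qR
  qR2 : 1 / δ / qR ≤ ι / 4
  t0 : 0 < t
  t1 : (2 : ℝ) ^ t * (1 - 1 / (2 * (qR : ℝ))) ^ (σ / 4) < 1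
  lam0 : 0 < lam
  lam1 : 8 * lam ≤ t
  lam2 : (2 : ℝ) ^ lam * (1 - Q0 / 4) ^ (ι / 2) < 1
  c0 : 0 < c
  c1 : 4 * c ≤ ι
  c2 : 8 * c ≤ t
  φ0 : 0 < φ
  φ1 : φ * Δ ≤ α * β / 12
  φ2 : 4 * φ ≤ Q0 * c
  φ3 : 8 * φ ≤ t
  φ4 : φ ≤ 1
  φ5 : φ ≤ β
  hk : k * (32 * Δ * D) = φ * δ ^ 2
  k0 : 0 < k
  k1 : k ≤ φ
  eh0 : 0 < eh
  eh1 : 32 * (Δ * eh) ≤ Q0 ^ 2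
  eh2 : eh ≤ γ / 16
  eh3 : 16 * (Δ * eh) ≤ Q0
  eh4 : 4 * (Δ * eh) ≤ Q0 * c
  eh5 : eh ≤ Q0 * lam / 2
  eh6 : (2 : ℝ) ^ (ι + 1 / δ) * (2 * Δ * eh) ^ (lam / 2) ≤ 1 / 8
  x0 : 0 < x
  x1 : 16 * x ≤ Q0 ^ 2
  x2 : 16 * (Δ * x) ≤ Q0
  x3 : 4 * x ≤ σ
  x4 : x * Δ ≤ α * β / 12
  x5 : 8 * (x * Δ) ≤ t
  x6 : 4 * x ≤ Q0 * c
  x7 : x * Δ ≤ q * k / 2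
  x8 : x * D * Δ ≤ δ / 2
  x9 : 2 * x ≤ ρ
  x10 : 2 * x ≤ φ

lemma exists_small (l : List (ℝ × ℝ)) (h : ∀ p ∈ l, 0 < p.2) :
    ∃ x : ℝ, 0 < x ∧ x ≤ 1 ∧ ∀ p ∈ l, p.1 * x ≤ p.2 := by
  induction l with
  | nil => exact ⟨1, by norm_num, le_rfl, by simp⟩
  | cons p l ih =>
    obtain ⟨x, hx, hx1, hx2⟩ := ih (fun p hp => h p (by simp [hp]))
    have hp := h p (by simp)
    set y := min x (p.2 / (|p.1| + 1)) with hy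
    have hpos : 0 < |p.1| + 1 := by positivity
    have hy0 : 0 < y := lt_min hx (by positivity)
    refine ⟨y, hy0, (min_le_left _ _).trans hx1, ?_⟩
    intro r hr
    rcases List.mem_cons.1 hr with rfl | hr
    · have h1 : y ≤ r.2 / (|r.1| + 1) := min_le_right _ _
      rw [le_div_iff₀ hpos] at h1
      have := le_abs_self r.1
      nlinarith
    · have h1 := hx2 r hr
      have h2 : y ≤ x := min_le_left _ _
      have h3 := h r (by simp [hr])
      by_cases hs : 0 ≤ r.1
      · nlinarith
      · push Not at hs
        nlinarith

set_option maxHeartbeats 1000000 in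
lemma exists_par (Δ : ℕ) (hΔ : 1 ≤ Δ) (δ q α : ℝ) (hδ : 0 < δ) (hδ1 : δ ≤ 1) (hq : 0 < q) (hq1 : q ≤ 1)
    (hα : 0 < α) (hα1 : α ≤ 1) : Nonempty (Par Δ δ q α) := by
  have hΔ1 : (1 : ℝ) ≤ Δ := by exact_mod_cast hΔ
  have hΔ0 : (0 : ℝ) < Δ := by linarith
  obtain ⟨Q0, hQ0⟩ : ∃ Q0, Q0 = q ^ Δ := ⟨_, rfl⟩
  obtain ⟨D, hD⟩ : ∃ D : ℝ, D = (Δ + 1) ^ 6 := ⟨_, rfl⟩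
  have Q00 : 0 < Q0 := by rw [hQ0]; positivity
  have Q01 : Q0 ≤ 1 := by rw [hQ0]; exact pow_le_one₀ hq.le hq1
  have D1 : 1 ≤ D := by rw [hD]; exact one_le_pow₀ (by linarith)
  have D0 : 0 < D := by linarith
  obtain ⟨σ, σ0, -, hσ⟩ := exists_small [(1, α), (2, Q0)] (by simp [hα, Q00])
  simp only [List.mem_cons, List.not_mem_nil, or_false, forall_eq_or_imp, forall_eq] at hσ
  obtain ⟨ρ, ρ0, ρ6, hρ⟩ := exists_small [(16, Q0 ^ 2), (4, σ), (Δ + 1, α * δ), (4 * Δ, δ), (Δ * (Δ + 1), Q0 / 8)]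
    (by
      simp only [List.mem_cons, List.not_mem_nil, or_false, forall_eq_or_imp, forall_eq]
      refine ⟨by positivity, by positivity, by positivity, by positivity, by positivity⟩)
  simp only [List.mem_cons, List.not_mem_nil, or_false, forall_eq_or_imp, forall_eq] at hρ
  obtain ⟨γ, hγ⟩ : ∃ γ, γ = ρ * δ ^ 2 / (16 * Δ * D) := ⟨_, rfl⟩
  have γ0 : 0 < γ := by rw [hγ]; positivity
  have ΔD : 1 ≤ Δ * D := by nlinarith
  have γ1 : γ ≤ δ := by
    rw [hγ, div_le_iff₀ (by positivity)]
    have h1 : ρ * δ ^ 2 ≤ 1 * δ ^ 2 := by gcongr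
    nlinarith [mul_le_mul_of_nonneg_left ΔD hδ.le]
  obtain ⟨L0, hL0⟩ := pow_unbounded_of_one_lt (4 / α) (show (1 : ℝ) < 1 + (α / 4) ^ 2 by
    have : 0 < (α / 4) ^ 2 := by positivity
    linarith)
  obtain ⟨L, hLd⟩ : ∃ L, L = L0 + 3 := ⟨_, rfl⟩
  have hL : 4 / α ≤ (1 + (α / 4) ^ 2) ^ L := by
    refine hL0.le.trans (pow_le_pow_right₀ ?_ (by omega))
    have : 0 < (α / 4) ^ 2 := by positivity
    linarith
  obtain ⟨β, hβ⟩ : ∃ β, β = α ^ L * γ / 16 := ⟨_, rfl⟩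
  have β0 : 0 < β := by rw [hβ]; positivity
  obtain ⟨ι, ι0, -, hι⟩ := exists_small [(1, γ / 8), (2 * (1 + Δ) * Δ, α * β / 12)] (by
      simp only [List.mem_cons, List.not_mem_nil, or_false, forall_eq_or_imp, forall_eq]
      refine ⟨by positivity, by positivity⟩)
  simp only [List.mem_cons, List.not_mem_nil, or_false, forall_eq_or_imp, forall_eq] at hι
  obtain ⟨q1, hq1'⟩ := exists_nat_ge (4 / (δ * ι))
  obtain ⟨qR, hqR⟩ : ∃ qR, qR = q1 + 1 := ⟨_, rfl⟩
  have qR0 : (0 : ℝ) < qR := by rw [hqR]; positivity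
  have qR1 : (1 : ℝ) ≤ qR := by rw [hqR]; push_cast; linarith [(Nat.cast_nonneg q1 : (0 : ℝ) ≤ q1)]
  have qR2 : 1 / δ / (qR : ℝ) ≤ ι / 4 := by
    have : 4 / (δ * ι) ≤ (qR : ℝ) := by rw [hqR]; push_cast; linarith
    rw [div_le_iff₀ (by positivity)] at this
    rw [div_div, div_le_iff₀ (by positivity)]
    nlinarith
  obtain ⟨t, t0, t1⟩ := exists_t (1 - 1 / (2 * (qR : ℝ))) (σ / 4) (by
      have : 1 / (2 * (qR : ℝ)) < 1 := by rw [div_lt_one (by positivity)]; linarith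
      linarith) (by
      have : 0 < 1 / (2 * (qR : ℝ)) := by positivity
      linarith) (by positivity)
  obtain ⟨l1, l10, l11⟩ := exists_t (1 - Q0 / 4) (ι / 2) (by linarith) (by linarith) (by positivity)
  obtain ⟨lam, lam0, -, hlam⟩ := exists_small [(8, t), (1, l1)] (by simp [t0, l10])
  simp only [List.mem_cons, List.not_mem_nil, or_false, forall_eq_or_imp, forall_eq] at hlam
  have lam2 : (2 : ℝ) ^ lam * (1 - Q0 / 4) ^ (ι / 2) < 1 := by
    refine lt_of_le_of_lt (mul_le_mul_of_nonneg_right ?_ ?_) l11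
    · exact Real.rpow_le_rpow_of_exponent_le (by norm_num) (by linarith [hlam.2])
    · exact Real.rpow_nonneg (by linarith) _
  obtain ⟨c, c0, -, hc⟩ := exists_small [(4, ι), (8, t)] (by simp [t0, ι0])
  simp only [List.mem_cons, List.not_mem_nil, or_false, forall_eq_or_imp, forall_eq] at hc
  obtain ⟨φ, φ0, φ4, hφ⟩ := exists_small [((Δ : ℝ), α * β / 12), (4, Q0 * c), (8, t), (1, β)] (by
      simp only [List.mem_cons, List.not_mem_nil, or_false, forall_eq_or_imp, forall_eq]
      refine ⟨by positivity, by positivity, by positivity, by positivity⟩)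
  simp only [List.mem_cons, List.not_mem_nil, or_false, forall_eq_or_imp, forall_eq] at hφ
  obtain ⟨k, hk⟩ : ∃ k, k = φ * δ ^ 2 / (32 * Δ * D) := ⟨_, rfl⟩
  have k0 : 0 < k := by rw [hk]; positivity
  have k1 : k ≤ φ := by
    rw [hk, div_le_iff₀ (by positivity)]
    have h1 : δ ^ 2 ≤ 1 := pow_le_one₀ hδ.le hδ1
    nlinarith [mul_le_mul_of_nonneg_left ΔD φ0.le, mul_le_mul_of_nonneg_left h1 φ0.le]
  obtain ⟨z, hz⟩ : ∃ z : ℝ, z = (1 / (8 * (2 : ℝ) ^ (ι + 1 / δ))) ^ (2 / lam) := ⟨_, rfl⟩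
  have h2p : (0 : ℝ) < (2 : ℝ) ^ (ι + 1 / δ) := by positivity
  have z0 : 0 < z := by rw [hz]; positivity
  obtain ⟨eh, eh0, -, heh⟩ := exists_small [(32 * (Δ : ℝ), Q0 ^ 2), (1, γ / 16), (16 * Δ, Q0), (4 * Δ, Q0 * c),
    (1, Q0 * lam / 2), (2 * Δ, z)] (by
      simp only [List.mem_cons, List.not_mem_nil, or_false, forall_eq_or_imp, forall_eq]
      refine ⟨by positivity, by positivity, by positivity, by positivity, by positivity, z0⟩)
  simp only [List.mem_cons, List.not_mem_nil, or_false, forall_eq_or_imp, forall_eq] at heh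
  have eh6 : (2 : ℝ) ^ (ι + 1 / δ) * (2 * Δ * eh) ^ (lam / 2) ≤ 1 / 8 := by
    have h1 : (2 * Δ * eh) ^ (lam / 2) ≤ z ^ (lam / 2) :=
      Real.rpow_le_rpow (by positivity) heh.2.2.2.2.2 (by positivity)
    have h2 : z ^ (lam / 2) = 1 / (8 * (2 : ℝ) ^ (ι + 1 / δ)) := by
      rw [hz, ← Real.rpow_mul (by positivity)]
      have : 2 / lam * (lam / 2) = 1 := by field_simp
      rw [this, Real.rpow_one]
    rw [h2] at h1
    calc _ ≤ (2 : ℝ) ^ (ι + 1 / δ) * (1 / (8 * (2 : ℝ) ^ (ι + 1 / δ))) := by gcongr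
      _ = 1 / 8 := by field_simp
  obtain ⟨x, x0, -, hx⟩ := exists_small [(16, Q0 ^ 2), (16 * (Δ : ℝ), Q0), (4, σ), (Δ, α * β / 12), (8 * Δ, t),
    (4, Q0 * c), (Δ, q * k / 2), (D * Δ, δ / 2), (2, ρ), (2, φ)] (by
      simp only [List.mem_cons, List.not_mem_nil, or_false, forall_eq_or_imp, forall_eq]
      refine ⟨by positivity, by positivity, by positivity, by positivity, by positivity, by positivity,
        by positivity, by positivity, by positivity, by positivity⟩)
  simp only [List.mem_cons, List.not_mem_nil, or_false, forall_eq_or_imp, forall_eq] at hx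
  obtain ⟨hσ1, hσ2⟩ := hσ
  obtain ⟨hρ1, hρ2, hρ3, hρ4, hρ5⟩ := hρ
  obtain ⟨hι1, hι2⟩ := hι
  obtain ⟨hlam1, hlam2⟩ := hlam
  obtain ⟨hφ1, hφ2, hφ3, hφ4⟩ := hφ
  obtain ⟨heh1, heh2, heh3, heh4, heh5, heh6⟩ := heh
  obtain ⟨hx1, hx2, hx3, hx4, hx5, hx6, hx7, hx8, hx9, hx10⟩ := hx
  exact ⟨{
    Q0 := Q0, D := D, σ := σ, ρ := ρ, γ := γ, β := β, ι := ι, t := t, lam := lam, c := c, φ := φ, k := k,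
    eh := eh, x := x, L := L, qR := qR
    hQ0 := hQ0
    hD := hD
    σ0 := σ0
    σ1 := by linarith
    σ2 := by linarith
    ρ0 := ρ0
    ρ1 := hρ1
    ρ2 := hρ2
    ρ3 := by linarith
    ρ4 := hρ4
    ρ5 := hρ5
    ρ6 := ρ6
    hγ := by rw [hγ]; field_simp
    γ0 := γ0
    γ1 := γ1
    hL3 := by omega
    hL := hL
    hβ := hβ
    β0 := β0
    ι0 := ι0
    ι1 := by linarith
    ι2 := by linarith
    qR1 := by omega
    qR2 := qR2
    t0 := t0
    t1 := t1
    lam0 := lam0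
    lam1 := hlam1
    lam2 := lam2
    c0 := c0
    c1 := hc.1
    c2 := hc.2
    φ0 := φ0
    φ1 := by linarith
    φ2 := hφ2
    φ3 := hφ3
    φ4 := φ4
    φ5 := by linarith
    hk := by rw [hk]; field_simp
    k0 := k0
    k1 := k1
    eh0 := eh0
    eh1 := by linarith
    eh2 := by linarith
    eh3 := by linarith
    eh4 := by linarith
    eh5 := by linarith
    eh6 := eh6
    x0 := x0
    x1 := hx1
    x2 := by linarith
    x3 := hx3
    x4 := by linarith
    x5 := by linarith
    x6 := hx6
    x7 := by linarith
    x8 := by linarith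
    x9 := hx9
    x10 := hx10 }⟩


lemma exists_big (l : List (ℝ × ℝ)) (h : ∀ p ∈ l, 0 < p.1) :
    ∃ N : ℕ, ∀ n : ℕ, N ≤ n → ∀ p ∈ l, p.2 ≤ p.1 * n := by
  induction l with
  | nil => exact ⟨0, by simp⟩
  | cons p l ih =>
    obtain ⟨N, hN⟩ := ih (fun p hp => h p (by simp [hp]))
    obtain ⟨N', hN'⟩ := exists_nat_ge (p.2 / p.1)
    refine ⟨max N N', fun n hn r hr => ?_⟩
    rcases List.mem_cons.1 hr with rfl | hr
    · have h0 := h r (by simp)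
      rw [div_le_iff₀ h0] at hN'
      have : (N' : ℝ) ≤ n := by exact_mod_cast le_trans (le_max_right _ _) hn
      nlinarith
    · exact hN n (le_trans (le_max_left _ _) hn) r hr

lemma nnum_aux {Δ : ℕ} {δ q α : ℝ} (P : Par Δ δ q α) (hΔ : 1 ≤ Δ) (hδ : 0 < δ) (hq : 0 < q) (hq1 : q ≤ 1)
    (n Nv Nw lm io : ℕ) (hn : 1 ≤ n) (hNv : (Nv : ℝ) ≤ n / δ) (hNw : n ≤ Nw)
    (hlm : (lm : ℝ) ≤ P.lam * n) (hlm' : P.lam * n / 2 ≤ lm) (hio : (io : ℝ) ≤ P.ι * n)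
    (hio' : P.ι * n / 2 ≤ io)
    (hexp : 1 / δ * (n : ℝ) ^ 2 * ((2 : ℝ) ^ P.lam * (1 - P.Q0 / 4) ^ (P.ι / 2)) ^ n < 1 / 4) :
    (Nv : ℝ) * (2 ^ lm * (1 - q ^ Δ / 4) ^ io) +
      2 ^ (io + Nv) * (2 * Δ * (P.eh * n) / Nw) ^ lm < 1 := by
  have hΔ0 : (0 : ℝ) < Δ := by exact_mod_cast hΔ
  have Q00 : 0 < P.Q0 := by rw [P.hQ0]; positivity
  have Q01 : P.Q0 ≤ 1 := by rw [P.hQ0]; exact pow_le_one₀ hq.le hq1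
  have hn0 : (1 : ℝ) ≤ n := by exact_mod_cast hn
  have e0 := P.eh0
  rw [← P.hQ0]
  have h1 := two_pow_floor P.lam (1 - P.Q0 / 4) (P.ι / 2) n lm io (by linarith) (by linarith) hlm (by linarith)
  have h2 : (Nv : ℝ) * (2 ^ lm * (1 - P.Q0 / 4) ^ io) < 1 / 4 := by
    refine lt_of_le_of_lt ?_ hexp
    refine mul_le_mul ?_ h1 ?_ (by positivity)
    · refine hNv.trans ?_
      rw [div_eq_inv_mul, one_div]
      apply mul_le_mul_of_nonneg_left _ (by positivity)
      nlinarith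
    · have : 0 ≤ 1 - P.Q0 / 4 := by linarith
      positivity
  have hb1 : 2 * Δ * P.eh < 1 := by
    have := P.eh3
    nlinarith
  have h3 := two_pow_floor (P.ι + 1 / δ) (2 * Δ * P.eh) (P.lam / 2) n (io + Nv) lm (by positivity) hb1
    (by
      push_cast
      have : (n : ℝ) / δ = 1 / δ * n := by ring
      rw [this] at hNv
      linarith) (by linarith)
  have h4 : (2 * Δ * (P.eh * n) / (Nw : ℝ)) ^ lm ≤ (2 * Δ * P.eh) ^ lm := by
    have hNw' : (n : ℝ) ≤ Nw := by exact_mod_cast hNw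
    apply pow_le_pow_left₀ (by positivity)
    rw [div_le_iff₀ (by linarith)]
    have : 2 * Δ * P.eh * n ≤ 2 * Δ * P.eh * Nw := by gcongr
    linarith
  have h5 : ((2 : ℝ) ^ (P.ι + 1 / δ) * (2 * Δ * P.eh) ^ (P.lam / 2)) ^ n ≤ 1 / 8 := by
    have hnn : 0 ≤ (2 : ℝ) ^ (P.ι + 1 / δ) * (2 * Δ * P.eh) ^ (P.lam / 2) := by positivity
    calc _ ≤ ((1 : ℝ) / 8) ^ n := pow_le_pow_left₀ hnn P.eh6 n
      _ ≤ (1 / 8) ^ 1 := pow_le_pow_of_le_one (by norm_num) (by norm_num) hn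
      _ = 1 / 8 := by norm_num
  have h6 : (2 : ℝ) ^ (io + Nv) * (2 * Δ * (P.eh * n) / Nw) ^ lm ≤
      2 ^ (io + Nv) * (2 * Δ * P.eh) ^ lm := mul_le_mul_of_nonneg_left h4 (by positivity)
  linarith

lemma nR_aux {Δ : ℕ} {δ q α : ℝ} (P : Par Δ δ q α) (hδ : 0 < δ)
    (n m h tt s0 : ℕ) (hn : 1 ≤ n) (hm : (m : ℝ) ≤ Δ * (n / δ)) (hh : (h : ℝ) ≤ 2 * n / δ)
    (ht : (tt : ℝ) ≤ P.t * n) (hs : P.σ / 2 * n / 2 ≤ s0)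
    (hexp : (3 + Δ / δ) * (2 / δ) * P.qR * (n : ℝ) ^ 2 *
      ((2 : ℝ) ^ P.t * (1 - 1 / (2 * (P.qR : ℝ))) ^ (P.σ / 4)) ^ n < 1 / 4) :
    (((3 + m) * h : ℕ) : ℝ) * P.qR * (2 ^ tt * (1 - 1 / (2 * P.qR : ℝ)) ^ s0) < 1 := by
  have hq : (1 : ℝ) ≤ P.qR := by exact_mod_cast P.qR1
  have hn0 : (1 : ℝ) ≤ n := by exact_mod_cast hn
  have a1 : 1 / (2 * (P.qR : ℝ)) < 1 := by rw [div_lt_one (by positivity)]; linarith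
  have a2 : 0 < 1 / (2 * (P.qR : ℝ)) := by positivity
  have h1 := two_pow_floor P.t (1 - 1 / (2 * (P.qR : ℝ))) (P.σ / 4) n tt s0 (by linarith) (by linarith) ht
    (by linarith)
  refine lt_of_le_of_lt ?_ (hexp.trans (by norm_num))
  refine mul_le_mul ?_ h1 ?_ (by positivity)
  · have : (((3 + m) * h : ℕ) : ℝ) ≤ (3 + Δ / δ) * (2 / δ) * (n : ℝ) ^ 2 := by
      push_cast
      calc ((3 : ℝ) + m) * h ≤ (3 * n + Δ * (n / δ)) * (2 * n / δ) := by
            apply mul_le_mul _ hh (by positivity) (by positivity)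
            linarith
        _ = _ := by ring
    calc _ ≤ (3 + Δ / δ) * (2 / δ) * (n : ℝ) ^ 2 * P.qR := by gcongr
      _ = _ := by ring
  · have : 0 ≤ 1 - 1 / (2 * (P.qR : ℝ)) := by linarith
    positivity


set_option maxHeartbeats 4000000 in
theorem stmt1_core (Δ : ℕ) (hΔ : 1 ≤ Δ) (d δ : ℝ) (hd : 0 < d) (hd1 : d ≤ 1)
    (hδ : 0 < δ) (hδ1 : δ ≤ 1) :
    ∃ (ε μ : ℝ) (n₀ : ℕ), 0 < ε ∧ 0 < μ ∧
    ∀ n : ℕ, n₀ ≤ n →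
    ∀ (V : Type) [Fintype V] (C : Type) [Fintype C]
      (G : C → SimpleGraph V) (Vs : Bool → Finset V),
      Disjoint (Vs false) (Vs true) →
      (∀ c x y, (G c).Adj x y → (x ∈ Vs false ∧ y ∈ Vs true) ∨ (x ∈ Vs true ∧ y ∈ Vs false)) →
      (∀ i, n ≤ (Vs i).card) → (∀ i, ((Vs i).card : ℝ) ≤ (n : ℝ) / δ) →
      δ * (n : ℝ) ≤ (Fintype.card C : ℝ) →
      (∀ V₁' ⊆ Vs false, ∀ V₂' ⊆ Vs true, ∀ C' : Finset C,
        ε * ((Vs false).card : ℝ) ≤ (V₁'.card : ℝ) → ε * ((Vs true).card : ℝ) ≤ (V₂'.card : ℝ) →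
        ε * (Fintype.card C : ℝ) ≤ (C'.card : ℝ) →
        d * (C'.card : ℝ) * (V₁'.card : ℝ) * (V₂'.card : ℝ) ≤
          ∑ c ∈ C', (pairCount (G c) V₁' V₂' : ℝ)) →
      (∀ i, ∀ v ∈ Vs i, d * (Fintype.card C : ℝ) * (n : ℝ) ≤ ∑ c : C, (degOf (G c) v : ℝ)) →
      (∀ c : C, d * (n : ℝ) ^ 2 ≤ (edgeCnt (G c) : ℝ)) →
      ∀ (W : Type) [Fintype W] (H : SimpleGraph W) (part : W → Bool),
        (∀ x y, H.Adj x y → part y = !(part x)) →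
        (∀ i, ((univ : Finset W).filter (fun w => part w = i)).card = (Vs i).card) →
        Separable H μ → (∀ w, degOf H w ≤ Δ) → (EH H).card = Fintype.card C →
        HasTransversal G H := by
  have hΔ0 : (1 : ℝ) ≤ Δ := by exact_mod_cast hΔ
  have hα0 : 0 < d * δ / 2 := by positivity
  have hdδ : d * δ ≤ d := by nlinarith
  obtain ⟨P⟩ := exists_par Δ hΔ δ (d / 2) (d * δ / 2) hδ hδ1 (by positivity) (by linarith) hα0 (by linarith)
  have Q00 : 0 < P.Q0 := by rw [P.hQ0]; positivity
  have Q01 : P.Q0 ≤ 1 := by rw [P.hQ0]; exact pow_le_one₀ (by positivity) (by linarith)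
  have D0 : 0 < P.D := by rw [P.hD]; positivity
  have qR0 : (1 : ℝ) ≤ P.qR := by exact_mod_cast P.qR1
  obtain ⟨γ0, β0, ι0, t0, l0, σ0, k0, e0, x0, φ0, ρ0, c0⟩ :
      0 < P.γ ∧ 0 < P.β ∧ 0 < P.ι ∧ 0 < P.t ∧ 0 < P.lam ∧ 0 < P.σ ∧ 0 < P.k ∧ 0 < P.eh ∧ 0 < P.x ∧ 0 < P.φ ∧
        0 < P.ρ ∧ 0 < P.c :=
    ⟨P.γ0, P.β0, P.ι0, P.t0, P.lam0, P.σ0, P.k0, P.eh0, P.x0, P.φ0, P.ρ0, P.c0⟩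
  obtain ⟨N1, hN1⟩ := exp_small ((2 : ℝ) ^ P.lam * (1 - P.Q0 / 4) ^ (P.ι / 2)) (1 / δ)
    (mul_nonneg (by positivity) (Real.rpow_nonneg (by linarith) _)) P.lam2 (by positivity)
  obtain ⟨N2, hN2⟩ := exp_small ((2 : ℝ) ^ P.t * (1 - 1 / (2 * (P.qR : ℝ))) ^ (P.σ / 4))
    ((3 + Δ / δ) * (2 / δ) * P.qR)
    (mul_nonneg (by positivity) (Real.rpow_nonneg (by
      have a1 : 1 / (2 * (P.qR : ℝ)) < 1 := by rw [div_lt_one (by positivity)]; linarith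
      linarith) _)) P.t1 (by positivity)
  obtain ⟨N3, hN3⟩ := exists_big [(P.γ / 8, 2), (P.ι, 2), (P.lam, 2), (P.t, 2), (P.σ / 2, 2), (P.k, 2), (P.β, 4),
    (P.Q0 / 8, (Δ : ℝ) * Δ)] (by
      simp only [List.mem_cons, List.not_mem_nil, or_false, forall_eq_or_imp, forall_eq]
      refine ⟨by positivity, by positivity, by positivity, by positivity, by positivity, by positivity,
        by positivity, by positivity⟩)
  refine ⟨min (P.eh * δ) (P.k * δ / (2 * Δ)), P.x * δ / 2, max 1 (max N1 (max N2 N3)),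
    lt_min (by positivity) (by positivity), by positivity, ?_⟩
  intro n hn V _ C _ G Vs hdisj hGb hVn hVn' hCn hreg hdegG hedge W _ H part hbip hpc hsep hdeg hEH
  simp only [max_le_iff] at hn
  obtain ⟨hn1, hnN1, hnN2, hnN3⟩ := hn
  have E1 := hN1 n hnN1
  have E2 := hN2 n hnN2
  have E3 := hN3 n hnN3
  simp only [List.mem_cons, List.not_mem_nil, or_false, forall_eq_or_imp, forall_eq] at E3
  obtain ⟨g1, g2, g3, g4, g5, g6, g7, g8⟩ := E3
  have n1 : (1 : ℝ) ≤ n := by exact_mod_cast hn1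
  have n0 : (0 : ℝ) < n := by linarith
  -- floors
  obtain ⟨a, ha⟩ : ∃ a, a = ⌊P.γ / 8 * n⌋₊ := ⟨_, rfl⟩
  obtain ⟨io, hio⟩ : ∃ a, a = ⌊P.ι * n⌋₊ := ⟨_, rfl⟩
  obtain ⟨lm, hlm⟩ : ∃ a, a = ⌊P.lam * n⌋₊ := ⟨_, rfl⟩
  obtain ⟨tt, htt⟩ : ∃ a, a = ⌊P.t * n⌋₊ := ⟨_, rfl⟩
  obtain ⟨s0, hs0⟩ : ∃ a, a = ⌊P.σ / 2 * n⌋₊ := ⟨_, rfl⟩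
  obtain ⟨k, hk⟩ : ∃ a, a = ⌊P.k * n⌋₊ := ⟨_, rfl⟩
  have a1 : (a : ℝ) ≤ P.γ / 8 * n := by rw [ha]; exact floor_le' _ _ (by positivity)
  have a2 : P.γ / 8 * n / 2 ≤ a := by rw [ha]; exact floor_half _ _ (by positivity) g1
  have io1 : (io : ℝ) ≤ P.ι * n := by rw [hio]; exact floor_le' _ _ (by positivity)
  have io2 : P.ι * n / 2 ≤ io := by rw [hio]; exact floor_half _ _ (by positivity) g2
  have lm1 : (lm : ℝ) ≤ P.lam * n := by rw [hlm]; exact floor_le' _ _ (by positivity)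
  have lm2 : P.lam * n / 2 ≤ lm := by rw [hlm]; exact floor_half _ _ (by positivity) g3
  have tt1 : (tt : ℝ) ≤ P.t * n := by rw [htt]; exact floor_le' _ _ (by positivity)
  have tt2 : P.t * n / 2 ≤ tt := by rw [htt]; exact floor_half _ _ (by positivity) g4
  have s01 : (s0 : ℝ) ≤ P.σ / 2 * n := by rw [hs0]; exact floor_le' _ _ (by positivity)
  have s02 : P.σ / 2 * n / 2 ≤ s0 := by rw [hs0]; exact floor_half _ _ (by positivity) g5
  have k1 : (k : ℝ) ≤ P.k * n := by rw [hk]; exact floor_le' _ _ (by positivity)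
  have k2 : P.k * n / 2 ≤ k := by rw [hk]; exact floor_half _ _ (by positivity) g6
  have kpos : 0 < k := by
    have : (0 : ℝ) < k := lt_of_lt_of_le (by positivity) k2
    exact_mod_cast this
  clear ha hio hlm htt hs0 hk
  -- sizes
  have hWc : (Fintype.card W : ℝ) ≤ 2 * n / δ := by
    have h1 := card_filter_add_card_filter_not (s := (univ : Finset W)) (fun w => part w = false)
    have h2 : (univ : Finset W).filter (fun w => ¬ part w = false) = univ.filter (fun w => part w = true) := by
      ext w; simp
    rw [h2, hpc, hpc, card_univ] at h1
    have h3 := hVn' false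
    have h4 := hVn' true
    have h5 : (Fintype.card W : ℝ) = (Vs false).card + (Vs true).card := by exact_mod_cast h1.symm
    rw [h5]
    calc _ ≤ n / δ + n / δ := add_le_add h3 h4
      _ = _ := by ring
  have hmle : (Fintype.card C : ℝ) ≤ Δ * (n / δ) := by
    have h1 := act_count H Δ hdeg part hbip ∅
    rw [hEH, card_empty, zero_mul, add_zero] at h1
    have h2 : ((univ : Finset W).filter (fun w => part w = false ∧ (∃ y, H.Adj w y) ∧
        ∀ x ∈ (∅ : Finset W), ¬ Nr H 4 x w)).card ≤ (Vs false).card := by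
      rw [← hpc false]
      apply card_le_card
      intro w hw
      exact mem_filter.2 ⟨mem_univ _, (mem_filter.1 hw).2.1⟩
    have h3 : Fintype.card C ≤ (Vs false).card * Δ := h1.trans (Nat.mul_le_mul_right _ h2)
    have h4 : (Fintype.card C : ℝ) ≤ (Vs false).card * Δ := by exact_mod_cast h3
    have h5 := mul_le_mul_of_nonneg_right (hVn' false) (show (0 : ℝ) ≤ Δ by linarith)
    linarith
  have hC0 : (0 : ℝ) < Fintype.card C := lt_of_lt_of_le (by positivity) hCn
  have hC0' : 0 < Fintype.card C := by exact_mod_cast hC0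
  obtain ⟨X, lab, hX, hlab, hcl⟩ := sep_lab H _ hsep
  have hxr : P.x * δ / 2 * Fintype.card W ≤ P.x * n := by
    calc _ ≤ P.x * δ / 2 * (2 * n / δ) := by gcongr
      _ = _ := by field_simp
  have hX' := hX.trans hxr
  have hcl' : ∀ l, (((univ : Finset W).filter (fun w => w ∉ X ∧ lab w = l)).card : ℝ) ≤ P.x * n :=
    fun l => (hcl l).trans hxr
  obtain ⟨f, hf0, hf1, hf2, hf3, hf4⟩ : ∃ f : ℕ → ℕ, f 0 = a ∧ f 1 = a ∧ f 2 = a ∧ f 3 = io ∧ f 4 = io :=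
    ⟨fun j => if j < 3 then a else io, by simp, by simp, by simp, by simp, by simp⟩
  have hγD := P.hγ
  have hkD := P.hk
  have p4 : ((Δ : ℝ) + 1) ^ 4 ≤ P.D := by
    rw [P.hD]
    exact pow_le_pow_right₀ (by linarith) (by norm_num)
  have ρδ : P.ρ ≤ δ / (4 * Δ) := by
    rw [le_div_iff₀ (by positivity)]
    linarith [P.ρ4]
  have hδn : (n : ℝ) ≤ n / δ := by
    rw [le_div_iff₀ hδ]
    exact mul_le_of_le_one_right n0.le hδ1
  obtain ⟨Q, F, GF, Γ, ty, nb, hQt, hFt, hXQ, hXF, hQF, hQc, hFc, hGF, hGFc, hnbF, hnbadj, hGFp, hGF1, hGF2, hGF3,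
    hΓp, hΓnb, hBQ, hBX, hfar, hty⟩ := hstruct H Δ hΔ hdeg part hbip X lab hlab (P.x * n) (2 * n / δ)
      (δ / (2 * Δ) * n) (P.ρ * n) (P.φ * n) f k hX' hcl' (by positivity) hWc
      (by
        rw [hEH]
        refine le_trans ?_ hCn
        have h1 : P.x * (Δ + 1) ^ 4 * Δ ≤ δ / 2 :=
          le_trans (by gcongr) P.x8
        have h2 := mul_le_mul_of_nonneg_right h1 n0.le
        have h3 : δ / (2 * Δ) * n * Δ = δ / 2 * n := by field_simp
        linarith)
      (by
        apply mul_le_mul_of_nonneg_right _ n0.le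
        refine ρδ.trans ?_
        apply div_le_div_of_nonneg_left hδ.le (by positivity)
        linarith)
      (by linarith [mul_le_mul_of_nonneg_right P.x9 n0.le]) (by linarith [mul_le_mul_of_nonneg_right P.x10 n0.le])
      (by
        have := P.ρ6
        have h1 : P.ρ * n ≤ 1 * n := by gcongr
        have h2 : 2 * (2 * n / δ) = 4 * (n / δ) := by ring
        rw [h2]; linarith)
      (by
        have := P.φ4
        have h1 : P.φ * n ≤ 1 * n := by gcongr
        have h2 : 2 * (2 * n / δ) = 4 * (n / δ) := by ring
        rw [h2]; linarith)
      (by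
        rw [← P.hD]
        have h1 : ∑ j ∈ range 5, (f j : ℝ) ≤ P.γ * n := by
          simp only [sum_range_succ, sum_range_zero, hf0, hf1, hf2, hf3, hf4]
          have := mul_le_mul_of_nonneg_right P.ι1 n0.le
          linarith
        calc _ ≤ P.γ * n * P.D := by gcongr
          _ = δ / (2 * Δ) * n * (P.ρ * n) / (4 * (2 * n / δ)) := by
            field_simp
            linarith)
      (by
        rw [← P.hD]
        calc _ ≤ P.k * n * P.D := by gcongr
          _ = (δ / (4 * Δ) * n) * (P.φ * n) / (4 * (2 * n / δ)) := by
            field_simp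
            linarith
          _ ≤ _ := by
            apply div_le_div_of_nonneg_right _ (by positivity)
            apply mul_le_mul_of_nonneg_right _ (by positivity)
            have h1 := mul_le_mul_of_nonneg_right ρδ n0.le
            have h2 : δ / (2 * Δ) * n = 2 * (δ / (4 * Δ) * n) := by field_simp; ring
            linarith)
  set A : AD V C W := {
    G := G, H := H, part := part, Vs := Vs, X := X, Q := Q, F := F, GF := GF, Γ := Γ, ty := ty, nb := nb, lab := lab
    Δ := Δ, k := k, Mx := ⌊P.x * n⌋₊, t := tt, qR := P.qR, t3 := lm, s1 := lm, s0 := s0, L := P.L, n := n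
    q := d / 2, α := d * δ / 2, κ := d * δ / 2, e := P.eh * n, lamI := lm, c0 := P.c * n } with hA
  have hMx : ((⌊P.x * n⌋₊ : ℕ) : ℝ) ≤ P.x * n := Nat.floor_le (by positivity)
  have C0 : (A.Cn 0).card = a := by rw [← hf0]; exact hty 0 (by norm_num)
  have C1 : (A.Cn 1).card = a := by rw [← hf1]; exact hty 1 (by norm_num)
  have C2 : (A.Cn 2).card = a := by rw [← hf2]; exact hty 2 (by norm_num)
  have C3 : (A.Cn 3).card = io := by rw [← hf3]; exact hty 3 (by norm_num)
  have C4 : (A.Cn 4).card = io := by rw [← hf4]; exact hty 4 (by norm_num)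
  have CB : ∀ i, (A.Cn (AD.jB i)).card = a := by
    intro i; cases i
    · exact C1
    · exact C2
  have CI : ∀ i, (A.Cn (AD.jI i)).card = io := by
    intro i; cases i
    · exact C3
    · exact C4
  have hβa : P.β * n ≤ (d * δ / 2) ^ P.L * a := by
    rw [P.hβ]
    have : (0 : ℝ) < (d * δ / 2) ^ P.L := by positivity
    have := mul_le_mul_of_nonneg_left a2 this.le
    linarith
  have sc : ∀ {u v : ℝ}, u ≤ v → u * n ≤ v * n := fun h => mul_le_mul_of_nonneg_right h n0.le
  have hQ0' : (d / 2) ^ Δ = P.Q0 := P.hQ0.symm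
  have hε1 : min (P.eh * δ) (P.k * δ / (2 * Δ)) ≤ P.eh * δ := min_le_left _ _
  have hε2 : min (P.eh * δ) (P.k * δ / (2 * Δ)) ≤ P.k * δ / (2 * Δ) := min_le_right _ _
  have ok : A.Ok := by
    refine {
      hbip := hbip
      hΔ := hΔ
      hdeg := hdeg
      hVs := hdisj
      hcard := ?_
      hEH := hEH
      he := ?_
      hq0 := ?_
      hq1 := ?_
      hTD := ?_
      hXQ := hXQ
      hXF := hXF
      hQF := hQF
      hQ := hQc
      hF := hFc
      hlab := hlab
      hMx := ?_
      hGF := hGF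
      hGFc := hGFc
      hnbF := hnbF
      hnbadj := hnbadj
      hGFp := hGFp
      hGF1 := hGF1
      hGF2 := hGF2
      hGF3 := hGF3
      hn := hVn
      hTdeg := ?_
      hκ := ?_
      hΓp := hΓp
      hΓnb := hΓnb
      hBQ := hBQ
      hBX := hBX
      hfar := hfar
      nQ := ?_
      hα0 := hα0
      hα1 := ?_
      hαq := ?_
      hL3 := P.hL3
      hL := P.hL
      ha := ?_
      ha4 := ?_
      hka := ?_
      hBe := ?_
      nξ := ?_
      nη := ?_
      nnum := ?_
      nt3 := le_rfl
      ns1 := le_rfl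
      nlam := ?_
      hqR := P.qR1
      nR := ?_
      ns0 := ?_
      ns0' := ?_
      nRI := ?_
      nT := ?_
      nfl := ?_
      hc0 := ?_
      hn1 := ?_
      hn2 := ?_
      hn3 := ?_
      hn4 := ?_
      hn5 := ?_
      hn6 := ?_ }
    all_goals try simp only [C0, C3, C4, CB, CI]
    all_goals try simp only [hA]
    · exact hpc
    · positivity
    · positivity
    · linarith
    · -- hTD
      apply typ_aux G Vs d _ (P.eh * n) k hd (by positivity) kpos ?_ ?_ hreg
      · intro i
        calc _ ≤ P.eh * δ * (n / δ) := mul_le_mul hε1 (hVn' i) (by positivity) (by positivity)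
          _ = P.eh * n := by field_simp
      · calc _ ≤ P.k * δ / (2 * Δ) * (Δ * (n / δ)) := mul_le_mul hε2 hmle (by positivity) (by positivity)
          _ = P.k * n / 2 := by field_simp
          _ ≤ k := k2
    · intro l
      exact Nat.le_floor (hcl' l)
    · -- hTdeg
      intro i v hv
      refine tdeg_aux G Vs ?_ d δ n hd hδ hC0' hVn' hdegG i v hv
      intro c x y hxy i hx
      rcases hGb c x y hxy with ⟨h1, h2⟩ | ⟨h1, h2⟩
      · cases i
        · exact h2
        · exact absurd hx (disjoint_left.1 hdisj h1)
      · cases i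
        · exact absurd h1 (disjoint_left.1 hdisj hx)
        · exact h2
    · intro c
      exact kappa_aux (G c) (Vs false) (Vs true) (hGb c) d δ n hd hδ (by omega) (hVn' _) (hVn' _) (hedge c)
    · -- nQ
      rw [hQ0']
      have := sc P.x1
      have := sc P.ρ1
      have := sc P.eh1
      have : 0 < P.Q0 ^ 2 * n := by positivity
      linarith
    · linarith
    · linarith
    · -- ha
      have : (a : ℝ) ≤ Fintype.card C := by
        refine a1.trans (le_trans ?_ hCn)
        have := sc P.γ1
        linarith
      exact_mod_cast this
    · linarith
    · have := sc P.k1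
      have := sc P.φ5
      linarith
    · intro _
      have := sc P.eh2
      linarith
    · -- nxi
      rw [hQ0']
      have h1 := sc P.x2
      have h2 := sc P.ρ5
      have h3 := sc P.eh3
      have h4 : (Δ : ℝ) * X.card ≤ Δ * (P.x * n) := by gcongr
      have h5 : (Δ : ℝ) * (Δ + 1) * Q.card ≤ Δ * (Δ + 1) * (P.ρ * n) := by gcongr
      have : 0 < P.Q0 * n := by positivity
      linarith
    · rw [hQ0']
      have h3 := sc P.eh3
      have : 0 < P.Q0 * n := by positivity
      linarith
    · intro i
      exact nnum_aux P hΔ hδ (by positivity) (by linarith) n _ _ lm io hn1 (hVn' i) (hVn _) lm1 lm2 io1 io2 E1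
    · rw [hQ0']
      have h3 := sc P.eh5
      have := mul_le_mul_of_nonneg_left lm2 Q00.le
      linarith
    · exact nR_aux P hδ n _ _ tt s0 hn1 hmle hWc tt1 s02 E2
    · have := sc P.x3
      have := sc P.ρ2
      have := sc P.σ1
      linarith
    · rw [hQ0']
      have := sc P.x3
      have := sc P.ρ2
      have := sc P.σ2
      linarith
    · intro i
      have h1 := sc P.qR2
      have h2 := sc P.c1
      have h3 : ((Vs i).card : ℝ) / P.qR ≤ 1 / δ / P.qR * n := by
        calc _ ≤ (n / δ) / P.qR := by
              apply div_le_div_of_nonneg_right (hVn' i) (by linarith)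
          _ = _ := by ring
      linarith
    · -- nT
      have h1 := sc P.ρ3
      have h2 := mul_le_mul_of_nonneg_left hCn hα0.le
      have h3 : (Q.card : ℝ) * (Δ + 1) ≤ P.ρ * n * (Δ + 1) := by gcongr
      linarith
    · -- nfl
      have h1 := sc P.x4
      have h2 := sc P.φ1
      have h3 := sc P.ι2
      have h4 := mul_le_mul_of_nonneg_left hβa (show 0 ≤ d * δ / 2 / 4 by positivity)
      refine le_trans ?_ h4
      calc _ ≤ (P.x * n + (P.ι * n + P.ι * n) * (1 + Δ) + P.φ * n) * Δ := by gcongr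
        _ ≤ _ := by linarith
    · positivity
    · have h1 := sc P.c2
      have h2 := sc P.x5
      have h3 := sc P.k1
      have h4 := sc P.φ3
      have h5 : (X.card : ℝ) * Δ ≤ P.x * n * Δ := by gcongr
      linarith
    · rw [hQ0']
      have h1 := sc P.x6
      have h2 := sc P.eh4
      have : 0 < P.Q0 * P.c * n := by positivity
      linarith
    · rw [hQ0']
      have h1 := sc P.φ2
      have h2 := sc P.eh4
      have : 0 < P.Q0 * P.c * n := by positivity
      linarith
    · have h1 := sc P.x7
      have h2 := mul_le_mul_of_nonneg_left k2 (show 0 ≤ d / 2 by positivity)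
      have h5 : ((⌊P.x * n⌋₊ : ℕ) : ℝ) * Δ ≤ P.x * n * Δ := by gcongr
      linarith
    · have h2 := sc P.x5
      have h3 := sc P.k1
      have h4 := sc P.φ3
      have h5 : (X.card : ℝ) * Δ ≤ P.x * n * Δ := by gcongr
      have : (X.card : ℝ) * Δ + k ≤ tt := by
        have : 0 < P.t * n := by positivity
        linarith
      exact_mod_cast this
    · have h1 := sc P.lam1
      have h2 := sc P.x5
      have h4 := sc P.φ3
      have h5 : (X.card : ℝ) * Δ ≤ P.x * n * Δ := by gcongr
      have : 0 < P.t * n := by positivity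
      linarith
  have hVne : 0 < (Vs false).card := lt_of_lt_of_le (by omega) (hVn false)
  obtain ⟨v, _⟩ := card_pos.1 hVne
  have : Nonempty V := ⟨v⟩
  have : Nonempty C := Fintype.card_pos_iff.1 hC0'
  exact ok.final

theorem stmt1 (Δ : ℕ) (hΔ : 1 ≤ Δ) (d δ : ℝ) (hd : 0 < d) (hd1 : d ≤ 1)
    (hδ : 0 < δ) (hδ1 : δ ≤ 1) :
    ∃ (ε μ : ℝ) (n₀ : ℕ), 0 < ε ∧ 0 < μ ∧
    ∀ n : ℕ, n₀ ≤ n →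
    ∀ (V : Type) [Fintype V] (C : Type) [Fintype C]
      (G : C → SimpleGraph V) (V₁ V₂ : Finset V),
      Disjoint V₁ V₂ →
      (∀ c x y, (G c).Adj x y → (x ∈ V₁ ∧ y ∈ V₂) ∨ (x ∈ V₂ ∧ y ∈ V₁)) →
      n ≤ V₁.card → V₁.card ≤ V₂.card → (V₂.card : ℝ) ≤ (n : ℝ) / δ →
      δ * (n : ℝ) ≤ (Fintype.card C : ℝ) →
      (∀ V₁' ⊆ V₁, ∀ V₂' ⊆ V₂, ∀ C' : Finset C,
        ε * (V₁.card : ℝ) ≤ (V₁'.card : ℝ) → ε * (V₂.card : ℝ) ≤ (V₂'.card : ℝ) →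
        ε * (Fintype.card C : ℝ) ≤ (C'.card : ℝ) →
        d * (C'.card : ℝ) * (V₁'.card : ℝ) * (V₂'.card : ℝ) ≤
          ∑ c ∈ C', (pairCount (G c) V₁' V₂' : ℝ)) →
      (∀ v ∈ V₁ ∪ V₂, d * (Fintype.card C : ℝ) * (n : ℝ) ≤ ∑ c : C, (degOf (G c) v : ℝ)) →
      (∀ c : C, d * (n : ℝ) ^ 2 ≤ (edgeCnt (G c) : ℝ)) →
      ∀ (W : Type) [Fintype W] (H : SimpleGraph W) (A₁ A₂ : Finset W),
        Disjoint A₁ A₂ → A₁ ∪ A₂ = (univ : Finset W) →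
        (∀ x y, H.Adj x y → (x ∈ A₁ ∧ y ∈ A₂) ∨ (x ∈ A₂ ∧ y ∈ A₁)) →
        A₁.card = V₁.card → A₂.card = V₂.card →
        Separable H μ → (∀ w, degOf H w ≤ Δ) → edgeCnt H = Fintype.card C →
        HasTransversal G H := by
  obtain ⟨ε, μ, n₀, hε, hμ, h⟩ := stmt1_core Δ hΔ d δ hd hd1 hδ hδ1
  refine ⟨ε, μ, n₀, hε, hμ, ?_⟩
  intro n hn V _ C _ G V₁ V₂ hdisj hGb hn1 h12 h2n hC hreg hdeg hedge W _ H A₁ A₂ hA hAu hHb hA1 hA2 hsep hΔH hEH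
  have h12' : (V₁.card : ℝ) ≤ V₂.card := by exact_mod_cast h12
  have n2 : ∀ w, w ∈ A₁ → w ∉ A₂ := fun w hw => disjoint_left.1 hA hw
  refine h n hn V C G (fun i => if i then V₂ else V₁) (by simpa using hdisj) (by simpa using hGb) ?_ ?_ hC
    (by simpa using hreg) ?_ hedge W H (fun w => decide (w ∈ A₂)) ?_ ?_ hsep hΔH hEH
  · intro i
    cases i
    · simpa using hn1
    · simpa using hn1.trans h12
  · intro i
    cases i
    · simpa using h12'.trans h2n
    · simpa using h2n
  · intro i v hv
    apply hdeg v
    cases i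
    · exact mem_union_left _ (by simpa using hv)
    · exact mem_union_right _ (by simpa using hv)
  · intro x y hxy
    rcases hHb x y hxy with ⟨h1, h2⟩ | ⟨h1, h2⟩
    · simp [n2 x h1, h2]
    · simp [n2 y h2, h1]
  · intro i
    cases i
    · have : (univ : Finset W).filter (fun w => decide (w ∈ A₂) = false) = A₁ := by
        ext w
        simp only [mem_filter, mem_univ, true_and, decide_eq_false_iff_not]
        have hw : w ∈ A₁ ∪ A₂ := hAu ▸ mem_univ w
        constructor
        · intro hw2
          exact (mem_union.1 hw).resolve_right hw2
        · exact n2 w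
      rw [this, hA1]
      simp
    · have : (univ : Finset W).filter (fun w => decide (w ∈ A₂) = true) = A₂ := by
        ext w
        simp
      rw [this, hA2]
      simp
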